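/- (Total flow bounds: phase transition) Let (Ω,σ) be a bounded one-sided NTA pair of mixed dimension in ℝ^n with n ≥ 3, with B(0,4) ⊆ Ω ⊆ B(0,C₀) for some C₀ > 4. For a > 0 let u_a be a flux solution with parameter a and let F(a) = a ∫_{∂Ω} u_a dσ be the total flow. Then there is a constant C > 1, depending only on n, C₀ and the geometric constants (not on a), such that: if a·σ(∂Ω) ≤ 1 then C^{−1}·a·σ(∂Ω) ≤ F(a) ≤ C·a·σ(∂Ω), while if a·σ(∂Ω) ≥ 1 then C^{−1} ≤ F(a) ≤ C. -/

import Mathlib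

open MeasureTheory Metric Set
open scoped RealInnerProductSpace ENNReal NNReal Topology

noncomputable section

/-- The (second-order) Laplacian-based notion of harmonicity: `u` is `C²` near each point of `S`
and its Laplacian (the sum of pure second derivatives) vanishes on `S`. -/
def IsHarmonicOn {n : ℕ} (u : EuclideanSpace ℝ (Fin n) → ℝ)
    (S : Set (EuclideanSpace ℝ (Fin n))) : Prop :=
  ∀ x ∈ S, ContDiffAt ℝ 2 u x ∧
    ∑ i : Fin n, iteratedFDeriv ℝ 2 u x ![EuclideanSpace.single i (1 : ℝ),
      EuclideanSpace.single i (1 : ℝ)] = 0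

/-- One-sided NTA conditions (C1) interior corkscrew and (C2) Harnack chains, with constant `M`. -/
structure IsOneSidedNTA {n : ℕ} (M : ℝ) (Ω : Set (EuclideanSpace ℝ (Fin n))) : Prop where
  isOpen : IsOpen Ω
  M_gt_one : 1 < M
  corkscrew : ∀ Q ∈ frontier Ω, ∀ r : ℝ, 0 < r → r < Metric.diam Ω / 10 →
    ∃ A ∈ Ω ∩ ball Q r, r / M ≤ infDist A (frontier Ω)
  harnack : ∀ r ε : ℝ, ∀ k : ℕ, 0 < r → r < Metric.diam Ω / 10 → 0 < ε → 1 ≤ k →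
    ∀ x ∈ Ω, ∀ y ∈ Ω, dist x y = r → ε ≤ infDist x (frontier Ω) →
      ε ≤ infDist y (frontier Ω) → r ≤ 2 ^ k * ε →
      ∃ (c : ℕ → EuclideanSpace ℝ (Fin n)) (ρ : ℕ → ℝ),
        c 1 = x ∧ c ⌈M * (k : ℝ)⌉₊ = y ∧
        ∀ i : ℕ, 1 ≤ i → i ≤ ⌈M * (k : ℝ)⌉₊ →
          0 < ρ i ∧ ρ i ≤ infDist (c i) (frontier Ω) / 10 ∧ ball (c i) (ρ i) ⊆ Ω ∧
          (i < ⌈M * (k : ℝ)⌉₊ → c (i + 1) ∈ ball (c i) (ρ i))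

/-- A bounded one-sided NTA pair of mixed dimension, with geometric constants `M, Cσ, d, cd`. -/
structure IsMixedPair {n : ℕ} (M Cσ d cd : ℝ) (Ω : Set (EuclideanSpace ℝ (Fin n)))
    (σ : Measure (EuclideanSpace ℝ (Fin n))) : Prop where
  nta : IsOneSidedNTA M Ω
  bounded : Bornology.IsBounded Ω
  nonempty : Ω.Nonempty
  supp_pos : ∀ Q ∈ frontier Ω, ∀ r : ℝ, 0 < r → 0 < σ (ball Q r)
  null_outside : σ (frontier Ω)ᶜ = 0
  finite : σ (frontier Ω) ≠ ⊤
  Cσ_pos : 0 < Cσ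
  doubling : ∀ Q ∈ frontier Ω, ∀ r : ℝ, 0 < r → r < Metric.diam Ω →
    (σ (ball Q (2 * r))).toReal ≤ Cσ * (σ (ball Q r)).toReal
  d_gt : (n : ℝ) - 2 < d
  cd_pos : 0 < cd
  lower_dim : ∀ Q ∈ frontier Ω, ∀ r s : ℝ, 0 < s → s < r → r < Metric.diam Ω →
    cd * (r / s) ^ d * (σ (ball Q s)).toReal ≤ (σ (ball Q r)).toReal

/-- A Robin Green function for the Laplacian on `(Ω, σ)` with parameter `a`. -/
structure IsRobinGreen {n : ℕ} (Ω : Set (EuclideanSpace ℝ (Fin n)))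
    (σ : Measure (EuclideanSpace ℝ (Fin n))) (a : ℝ)
    (G : EuclideanSpace ℝ (Fin n) → EuclideanSpace ℝ (Fin n) → ℝ) : Prop where
  symm : ∀ X ∈ Ω, ∀ Y ∈ Ω, X ≠ Y → G X Y = G Y X
  nonneg : ∀ Y ∈ Ω, ∀ X ∈ closure Ω \ {Y}, 0 ≤ G X Y
  contOn : ∀ Y ∈ Ω, ContinuousOn (fun X => G X Y) (closure Ω \ {Y})
  harmonic : ∀ Y ∈ Ω, IsHarmonicOn (fun X => G X Y) (Ω \ {Y})
  grad_L2 : ∀ Y ∈ Ω, ∀ r : ℝ, 0 < r →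
    IntegrableOn (fun X => ‖gradient (fun Z => G Z Y) X‖ ^ 2) (Ω \ ball Y r) volume
  grad_L1 : ∀ Y ∈ Ω, IntegrableOn (fun X => ‖gradient (fun Z => G Z Y) X‖) Ω volume
  weak : ∀ Y ∈ Ω, ∀ φ : EuclideanSpace ℝ (Fin n) → ℝ,
    ContDiff ℝ (⊤ : ℕ∞) φ → HasCompactSupport φ →
    (∫ X in Ω, ⟪gradient (fun Z => G Z Y) X, gradient φ X⟫) +
      a * ∫ P in frontier Ω, G P Y * φ P ∂σ = φ Y

/-- A Dirichlet Green function for the Laplacian on `Ω`. -/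
structure IsDirichletGreen {n : ℕ} (Ω : Set (EuclideanSpace ℝ (Fin n)))
    (G : EuclideanSpace ℝ (Fin n) → EuclideanSpace ℝ (Fin n) → ℝ) : Prop where
  nonneg : ∀ Y ∈ Ω, ∀ X ∈ closure Ω \ {Y}, 0 ≤ G X Y
  contOn : ∀ Y ∈ Ω, ContinuousOn (fun X => G X Y) (closure Ω \ {Y})
  boundary_zero : ∀ Y ∈ Ω, ∀ Q ∈ frontier Ω, G Q Y = 0
  harmonic : ∀ Y ∈ Ω, IsHarmonicOn (fun X => G X Y) (Ω \ {Y})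
  grad_L2 : ∀ Y ∈ Ω, ∀ r : ℝ, 0 < r →
    IntegrableOn (fun X => ‖gradient (fun Z => G Z Y) X‖ ^ 2) (Ω \ ball Y r) volume
  grad_L1 : ∀ Y ∈ Ω, IntegrableOn (fun X => ‖gradient (fun Z => G Z Y) X‖) Ω volume
  weak : ∀ Y ∈ Ω, ∀ φ : EuclideanSpace ℝ (Fin n) → ℝ,
    ContDiff ℝ (⊤ : ℕ∞) φ → HasCompactSupport φ → tsupport φ ⊆ Ω →
    (∫ X in Ω, ⟪gradient (fun Z => G Z Y) X, gradient φ X⟫) = φ Y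

/-- A solution with pole at `Y` and vanishing Robin condition (parameter `a`). -/
structure IsRobinPoleSolution {n : ℕ} (Ω : Set (EuclideanSpace ℝ (Fin n)))
    (σ : Measure (EuclideanSpace ℝ (Fin n))) (a : ℝ) (Y : EuclideanSpace ℝ (Fin n))
    (u : EuclideanSpace ℝ (Fin n) → ℝ) : Prop where
  contOn : ContinuousOn u (closure Ω \ {Y})
  harmonic : IsHarmonicOn u (Ω \ {Y})
  grad_L2 : ∀ r : ℝ, 0 < r → IntegrableOn (fun X => ‖gradient u X‖ ^ 2) (Ω \ ball Y r) volume
  weak : ∀ φ : EuclideanSpace ℝ (Fin n) → ℝ,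
    ContDiff ℝ (⊤ : ℕ∞) φ → HasCompactSupport φ → Y ∉ tsupport φ →
    (∫ X in Ω, ⟪gradient u X, gradient φ X⟫) + a * ∫ P in frontier Ω, u P * φ P ∂σ = 0

/-- A nonnegative weak solution of the homogeneous Robin problem in `B(Q, ρ)` (parameter `a`). -/
structure IsRobinLocalSolution {n : ℕ} (Ω : Set (EuclideanSpace ℝ (Fin n)))
    (σ : Measure (EuclideanSpace ℝ (Fin n))) (a : ℝ) (Q : EuclideanSpace ℝ (Fin n)) (ρ : ℝ)
    (u : EuclideanSpace ℝ (Fin n) → ℝ) : Prop where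
  nonneg : ∀ X ∈ closure Ω ∩ ball Q ρ, 0 ≤ u X
  contOn : ContinuousOn u (closure Ω ∩ ball Q ρ)
  harmonic : IsHarmonicOn u (Ω ∩ ball Q ρ)
  grad_L2 : ∀ ρ' : ℝ, ρ' < ρ →
    IntegrableOn (fun X => ‖gradient u X‖ ^ 2) (Ω ∩ ball Q ρ') volume
  weak : ∀ φ : EuclideanSpace ℝ (Fin n) → ℝ,
    ContDiff ℝ (⊤ : ℕ∞) φ → HasCompactSupport φ → tsupport φ ⊆ ball Q ρ →
    (∫ X in Ω, ⟪gradient u X, gradient φ X⟫) + a * ∫ P in frontier Ω, u P * φ P ∂σ = 0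

/-- A flux solution: `u = 1` on `cl B(0,1)`, harmonic outside, homogeneous Robin condition. -/
structure IsFluxSolution {n : ℕ} (Ω : Set (EuclideanSpace ℝ (Fin n)))
    (σ : Measure (EuclideanSpace ℝ (Fin n))) (a : ℝ)
    (u : EuclideanSpace ℝ (Fin n) → ℝ) : Prop where
  contOn : ContinuousOn u (closure Ω)
  one_on_ball : ∀ X ∈ closedBall (0 : EuclideanSpace ℝ (Fin n)) 1, u X = 1
  harmonic : IsHarmonicOn u (Ω \ closedBall (0 : EuclideanSpace ℝ (Fin n)) 1)
  grad_L2 : IntegrableOn (fun X => ‖gradient u X‖ ^ 2)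
    (Ω \ closedBall (0 : EuclideanSpace ℝ (Fin n)) 1) volume
  weak : ∀ φ : EuclideanSpace ℝ (Fin n) → ℝ,
    ContDiff ℝ (⊤ : ℕ∞) φ → HasCompactSupport φ →
    tsupport φ ⊆ (closedBall (0 : EuclideanSpace ℝ (Fin n)) 1)ᶜ →
    (∫ X in Ω, ⟪gradient u X, gradient φ X⟫) + a * ∫ P in frontier Ω, u P * φ P ∂σ = 0

/-- A Dirichlet harmonic measure for `Ω`: a family of probability measures on `∂Ω` solving the
Dirichlet problem for continuous boundary data. -/
structure IsDirichletHM {n : ℕ} (Ω : Set (EuclideanSpace ℝ (Fin n)))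
    (ω : EuclideanSpace ℝ (Fin n) → Measure (EuclideanSpace ℝ (Fin n))) : Prop where
  prob : ∀ X ∈ Ω, IsProbabilityMeasure (ω X)
  supported : ∀ X ∈ Ω, (ω X) (frontier Ω)ᶜ = 0
  solves : ∀ f : EuclideanSpace ℝ (Fin n) → ℝ, ContinuousOn f (frontier Ω) →
    ∃ h : EuclideanSpace ℝ (Fin n) → ℝ,
      ContinuousOn h (closure Ω) ∧ IsHarmonicOn h Ω ∧
      (∀ X ∈ Ω, h X = ∫ y, f y ∂(ω X)) ∧ (∀ Q ∈ frontier Ω, h Q = f Q)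

end


open MeasureTheory Metric Set
open scoped RealInnerProductSpace ENNReal NNReal Topology

/-- unnormalised ball average -/
noncomputable def mAvg {n : ℕ} (w : EuclideanSpace ℝ (Fin n) → ℝ)
    (x : EuclideanSpace ℝ (Fin n)) (ρ : ℝ) : ℝ :=
  ∫ z in ball (0 : EuclideanSpace ℝ (Fin n)) 1, w (x + ρ • z)

theorem ball_infDist_frontier_subset {n : ℕ} {Ω : Set (EuclideanSpace ℝ (Fin n))}
    (hΩ : IsOpen Ω) {x : EuclideanSpace ℝ (Fin n)} (hx : x ∈ Ω) :
    ball x (infDist x (frontier Ω)) ⊆ Ω := by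
  rcases (ball x (infDist x (frontier Ω))).eq_empty_or_nonempty with he | hne
  · rw [he]; exact empty_subset _
  have hpos : 0 < infDist x (frontier Ω) := nonempty_ball.1 hne
  have hpc : IsPreconnected (ball x (infDist x (frontier Ω))) :=
    (convex_ball _ _).isPreconnected
  have h := hpc.subset_or_subset hΩ (isClosed_closure (s := Ω)).isOpen_compl ?_ ?_
  · rcases h with h | h
    · exact h
    · exact absurd (subset_closure hx) (h (mem_ball_self hpos))
  · exact disjoint_compl_right.mono_left subset_closure
  · intro y hy
    by_contra hcon
    simp only [mem_union, mem_compl_iff, not_or, not_not] at hcon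
    have hyf : y ∈ frontier Ω := by
      rw [hΩ.frontier_eq]; exact ⟨hcon.2, hcon.1⟩
    have := infDist_le_dist_of_mem (x := x) hyf
    rw [mem_ball, dist_comm] at hy
    linarith

theorem lintegral_ball_affine {n : ℕ} (f : EuclideanSpace ℝ (Fin n) → ℝ≥0∞) (hf : Measurable f)
    (x : EuclideanSpace ℝ (Fin n)) {ρ : ℝ} (hρ : 0 < ρ) :
    ∫⁻ z in ball (0 : EuclideanSpace ℝ (Fin n)) 1, f (x + ρ • z) =
      ENNReal.ofReal ((ρ ^ n)⁻¹) * ∫⁻ z in ball x ρ, f z := by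
  have h1 : ∀ z : EuclideanSpace ℝ (Fin n), (ball (0 : EuclideanSpace ℝ (Fin n)) 1).indicator
      (fun z => f (x + ρ • z)) z = (ball x ρ).indicator f (x + ρ • z) := by
    intro z
    have : z ∈ ball (0 : EuclideanSpace ℝ (Fin n)) 1 ↔ x + ρ • z ∈ ball x ρ := by
      simp only [mem_ball, dist_zero_right, dist_self_add_left, norm_smul, Real.norm_eq_abs,
        abs_of_pos hρ]
      constructor
      · intro h; nlinarith
      · intro h; by_contra hc; push Not at hc; nlinarith
    by_cases hz : z ∈ ball (0 : EuclideanSpace ℝ (Fin n)) 1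
    · rw [indicator_of_mem hz, indicator_of_mem (this.1 hz)]
    · rw [indicator_of_notMem hz, indicator_of_notMem (fun h => hz (this.2 h))]
  rw [← lintegral_indicator measurableSet_ball, ← lintegral_indicator measurableSet_ball]
  simp_rw [h1]
  have hm : Measurable ((ball x ρ).indicator f) := hf.indicator measurableSet_ball
  have h2 : ∫⁻ z, (ball x ρ).indicator f (x + ρ • z) =
      ∫⁻ y, (ball x ρ).indicator f (x + y) ∂(Measure.map (fun z => ρ • z) volume) := by
    have hg : Measurable (fun y => (ball x ρ).indicator f (x + y)) :=
      hm.comp (measurable_const_add x)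
    exact (lintegral_map hg (measurable_const_smul ρ)).symm
  rw [h2, Measure.map_addHaar_smul _ hρ.ne', lintegral_smul_measure,
    lintegral_add_left_eq_self]
  rw [abs_of_pos (by positivity)]
  simp

theorem mAvg_sub_le {n : ℕ} {O : Set (EuclideanSpace ℝ (Fin n))} (hO : IsOpen O)
    {w : EuclideanSpace ℝ (Fin n) → ℝ} (hw : ContDiffOn ℝ 1 w O) {B : ℝ}
    (hB : ∀ x ∈ O, |w x| ≤ B) (hint : IntegrableOn (fun x => ‖fderiv ℝ w x‖) O)
    (x y : EuclideanSpace ℝ (Fin n)) {ρ ρ' ρ₀ : ℝ} (hρ₀ : 0 < ρ₀) (h1 : ρ₀ ≤ ρ) (h2 : ρ₀ ≤ ρ')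
    (hsub : ∀ t ∈ Icc (0 : ℝ) 1, ball ((1 - t) • x + t • y) ((1 - t) * ρ + t * ρ') ⊆ O) :
    |mAvg w x ρ - mAvg w y ρ'| ≤ (‖x - y‖ + |ρ - ρ'|) / ρ₀ ^ n * ∫ z in O, ‖fderiv ℝ w z‖ := by
  have hρt : ∀ t ∈ Icc (0 : ℝ) 1, ρ₀ ≤ (1 - t) * ρ + t * ρ' := by
    intro t ht; nlinarith [ht.1, ht.2]
  set p : ℝ → EuclideanSpace ℝ (Fin n) → EuclideanSpace ℝ (Fin n) :=
    fun t z => ((1 - t) • x + t • y) + ((1 - t) * ρ + t * ρ') • z with hp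
  have hpO : ∀ t ∈ Icc (0 : ℝ) 1, ∀ z ∈ ball (0 : EuclideanSpace ℝ (Fin n)) 1, p t z ∈ O := by
    intro t ht z hz
    apply hsub t ht
    have h3 := hρt t ht
    simp only [hp, mem_ball, dist_self_add_left, norm_smul, Real.norm_eq_abs]
    rw [abs_of_pos (by linarith)]
    have : ‖z‖ < 1 := by simpa using hz
    nlinarith
  have hdiff : ∀ z ∈ O, HasFDerivAt w (fderiv ℝ w z) z := fun z hz =>
    ((hw.contDiffAt (hO.mem_nhds hz)).differentiableAt (by norm_num)).hasFDerivAt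
  have hcfd : ContinuousOn (fderiv ℝ w) O := hw.continuousOn_fderiv_of_isOpen hO (by norm_num)
  set L : ℝ := ‖x - y‖ + |ρ - ρ'| with hL
  have hL0 : 0 ≤ L := by positivity
  -- pointwise
  have hpt : ∀ z ∈ ball (0 : EuclideanSpace ℝ (Fin n)) 1,
      ‖w (p 0 z) - w (p 1 z)‖ₑ ≤ ENNReal.ofReal L * ∫⁻ t in Icc (0 : ℝ) 1, ‖fderiv ℝ w (p t z)‖ₑ := by
    intro z hz
    have hz1 : ‖z‖ < 1 := by simpa using hz
    set v : EuclideanSpace ℝ (Fin n) := (y - x) + (ρ' - ρ) • z with hv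
    have hvL : ‖v‖ ≤ L := by
      calc ‖v‖ ≤ ‖y - x‖ + ‖(ρ' - ρ) • z‖ := norm_add_le _ _
        _ ≤ L := by
          rw [norm_smul, norm_sub_rev y x, Real.norm_eq_abs, abs_sub_comm ρ' ρ, hL]
          nlinarith [abs_nonneg (ρ - ρ'), norm_nonneg z]
    have hpd : ∀ t, HasDerivAt (fun t => p t z) v t := by
      intro t
      have e : (fun t => p t z) = fun t : ℝ => (x + ρ • z) + t • v := by
        funext t; simp only [hp, hv]; module
      rw [e]
      simpa using ((hasDerivAt_id t).smul_const v).const_add (x + ρ • z)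
    have hder : ∀ t ∈ uIcc (0 : ℝ) 1, HasDerivAt (fun t => w (p t z)) (fderiv ℝ w (p t z) v) t := by
      intro t ht
      rw [uIcc_of_le zero_le_one] at ht
      exact (hdiff _ (hpO t ht z hz)).comp_hasDerivAt t (hpd t)
    have hcp : Continuous (fun t => p t z) := by fun_prop
    have hcont : ContinuousOn (fun t => fderiv ℝ w (p t z) v) (uIcc (0 : ℝ) 1) := by
      rw [uIcc_of_le zero_le_one]
      exact (hcfd.comp hcp.continuousOn (fun t ht => hpO t ht z hz)).clm_apply continuousOn_const
    have hFTC := intervalIntegral.integral_eq_sub_of_hasDerivAt hder hcont.intervalIntegrable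
    rw [← enorm_neg, neg_sub, ← hFTC, intervalIntegral.integral_of_le zero_le_one]
    refine (enorm_integral_le_lintegral_enorm _).trans ?_
    rw [← lintegral_const_mul' _ _ ENNReal.ofReal_ne_top]
    refine (lintegral_mono' (Measure.restrict_mono Ioc_subset_Icc_self le_rfl) le_rfl).trans ?_
    refine lintegral_mono fun t => ?_
    rw [mul_comm]
    calc ‖fderiv ℝ w (p t z) v‖ₑ ≤ ‖fderiv ℝ w (p t z)‖ₑ * ‖v‖ₑ :=
          ContinuousLinearMap.le_opENorm _ _
      _ ≤ _ := by
          gcongr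
          rw [← ofReal_norm]
          exact ENNReal.ofReal_le_ofReal hvL
  -- integrability
  have hI : ∀ t ∈ Icc (0 : ℝ) 1, IntegrableOn (fun z => w (p t z))
      (ball (0 : EuclideanSpace ℝ (Fin n)) 1) := by
    intro t ht
    refine IntegrableOn.of_bound (measure_ball_lt_top (μ := volume)) ?_ B ?_
    · have hc : ContinuousOn (fun z => w (p t z)) (ball (0 : EuclideanSpace ℝ (Fin n)) 1) := ?_
      · exact hc.aestronglyMeasurable measurableSet_ball
      refine hw.continuousOn.comp (Continuous.continuousOn (by fun_prop)) (fun z hz => hpO t ht z hz)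
    · filter_upwards [ae_restrict_mem (measurableSet_ball (x := (0 : EuclideanSpace ℝ (Fin n))) (ε := 1))] with z hz
      exact hB _ (hpO t ht z hz)
  have e1 : mAvg w x ρ - mAvg w y ρ' =
      ∫ z in ball (0 : EuclideanSpace ℝ (Fin n)) 1, (w (p 0 z) - w (p 1 z)) := by
    rw [integral_sub (hI 0 (by simp)) (hI 1 (by simp))]
    simp [mAvg, hp]
  have hmf : Measurable (fun z => ‖fderiv ℝ w z‖ₑ) := (measurable_fderiv ℝ w).enorm
  have hmain : ‖mAvg w x ρ - mAvg w y ρ'‖ₑ ≤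
      ENNReal.ofReal (L / ρ₀ ^ n) * ∫⁻ z in O, ‖fderiv ℝ w z‖ₑ := by
    rw [e1]
    calc _ ≤ ∫⁻ z in ball (0 : EuclideanSpace ℝ (Fin n)) 1, ‖w (p 0 z) - w (p 1 z)‖ₑ :=
          enorm_integral_le_lintegral_enorm _
      _ ≤ ∫⁻ z in ball (0 : EuclideanSpace ℝ (Fin n)) 1,
          ENNReal.ofReal L * ∫⁻ t in Icc (0 : ℝ) 1, ‖fderiv ℝ w (p t z)‖ₑ :=
          setLIntegral_mono' measurableSet_ball hpt
      _ = ENNReal.ofReal L * ∫⁻ t in Icc (0 : ℝ) 1,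
            ∫⁻ z in ball (0 : EuclideanSpace ℝ (Fin n)) 1, ‖fderiv ℝ w (p t z)‖ₑ := by
          rw [lintegral_const_mul' _ _ ENNReal.ofReal_ne_top, lintegral_lintegral_swap]
          refine Measurable.aemeasurable ?_
          refine hmf.comp (Continuous.measurable ?_)
          simp only [hp]
          fun_prop
      _ ≤ ENNReal.ofReal L * ∫⁻ t in Icc (0 : ℝ) 1,
            ENNReal.ofReal ((ρ₀ ^ n)⁻¹) * ∫⁻ z in O, ‖fderiv ℝ w z‖ₑ := by
          gcongr ENNReal.ofReal L * ?_
          refine setLIntegral_mono' measurableSet_Icc fun t ht => ?_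
          have h3 := hρt t ht
          simp only [hp]
          rw [lintegral_ball_affine _ hmf _ (by linarith)]
          gcongr
          exact hsub t ht
      _ = _ := by
          rw [setLIntegral_const]
          simp only [Real.volume_Icc, sub_zero, ENNReal.ofReal_one, mul_one]
          rw [← mul_assoc, ← ENNReal.ofReal_mul hL0, div_eq_mul_inv]
  have e2 : ∫⁻ z in O, ‖fderiv ℝ w z‖ₑ = ENNReal.ofReal (∫ z in O, ‖fderiv ℝ w z‖) := by
    rw [ofReal_integral_eq_lintegral_ofReal hint (ae_of_all _ fun _ => norm_nonneg _)]
    simp_rw [ofReal_norm]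
  rw [e2, ← ENNReal.ofReal_mul (by positivity), ← ofReal_norm] at hmain
  exact (ENNReal.ofReal_le_ofReal_iff (mul_nonneg (by positivity)
    (integral_nonneg fun _ => norm_nonneg _))).1 hmain

theorem sq_integral_le {α : Type*} [MeasurableSpace α] {μ : Measure α} [IsFiniteMeasure μ]
    {f : α → ℝ} (hf : Integrable f μ) (hf2 : Integrable (fun x => f x ^ 2) μ) :
    (∫ x, f x ∂μ) ^ 2 ≤ μ.real univ * ∫ x, f x ^ 2 ∂μ := by
  set m := μ.real univ with hm
  set I := ∫ x, f x ∂μ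
  set J := ∫ x, f x ^ 2 ∂μ
  have hm0 : 0 ≤ m := measureReal_nonneg
  have key : 0 ≤ m ^ 2 * J - 2 * m * I * I + I ^ 2 * m := by
    have : ∫ x, (m * f x - I) ^ 2 ∂μ = m ^ 2 * J - 2 * m * I * I + I ^ 2 * m := by
      have e : ∀ x, (m * f x - I) ^ 2 = m ^ 2 * f x ^ 2 - 2 * m * I * f x + I ^ 2 := by
        intro x; ring
      simp_rw [e]
      have i1 : Integrable (fun x => m ^ 2 * f x ^ 2 - 2 * m * I * f x) μ :=
        (hf2.const_mul _).sub (hf.const_mul _)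
      rw [integral_add i1 (integrable_const _),
        integral_sub (hf2.const_mul _) (hf.const_mul _), integral_const_mul, integral_const_mul,
        integral_const]
      simp only [smul_eq_mul, ← hm]; ring
    rw [← this]
    exact integral_nonneg fun x => sq_nonneg _
  rcases hm0.eq_or_lt with h0 | hpos
  · have : μ = 0 := by
      rw [hm, measureReal_def] at h0
      have := (ENNReal.toReal_eq_zero_iff _).1 h0.symm
      rcases this with h | h
      · exact Measure.measure_univ_eq_zero.1 h
      · exact absurd h (measure_ne_top _ _)
    simp [I, J, this]
  · have : 0 ≤ m * (m * J - I ^ 2) := by nlinarith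
    have := nonneg_of_mul_nonneg_right this hpos
    linarith

set_option maxHeartbeats 2000000 in
theorem chain_le (n : ℕ) (M Λ : ℝ) (hM : 1 < M) (hΛ : 1 ≤ Λ) :
    ∃ θ K : ℝ, 0 < θ ∧ θ ≤ 1 / (2 * Λ) ∧ 4 * Λ ≤ K ∧
      ∀ Ω : Set (EuclideanSpace ℝ (Fin n)), IsOneSidedNTA M Ω →
      ∀ w : EuclideanSpace ℝ (Fin n) → ℝ, ContDiffOn ℝ 1 w Ω →
      ∀ B : ℝ, (∀ x ∈ Ω, |w x| ≤ B) → IntegrableOn (fun x => ‖fderiv ℝ w x‖) Ω →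
      ∀ x ∈ Ω, ∀ y ∈ Ω, ∀ r : ℝ, 0 < r → Λ * r < Metric.diam Ω / 10 → dist x y ≤ Λ * r →
        r / Λ ≤ infDist x (frontier Ω) → r / Λ ≤ infDist y (frontier Ω) →
        |mAvg w x (θ * r) - mAvg w y (θ * r)| ≤
          K * r / r ^ n * ∫ z in Ω ∩ ball x (K * r), ‖fderiv ℝ w z‖ := by
  have hΛ0 : 0 < Λ := by linarith
  obtain ⟨k₀, hk₀⟩ := pow_unbounded_of_one_lt (Λ ^ 2) (one_lt_two (α := ℝ))
  set k := k₀ + 1 with hk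
  have hk2 : Λ ^ 2 ≤ 2 ^ k := by
    have e : (2:ℝ) ^ k = 2 ^ k₀ * 2 := pow_succ _ _
    have : (0:ℝ) < 2 ^ k₀ := by positivity
    linarith
  set N := ⌈M * (k : ℝ)⌉₊ with hN
  have hN1 : 1 ≤ N := by
    rw [hN, Nat.one_le_ceil_iff]; positivity
  set θ : ℝ := (9 / 10) ^ N / (2 * Λ) with hθ
  have hθ0 : 0 < θ := by positivity
  have hθ1 : θ ≤ 1 / (2 * Λ) := by
    rw [hθ]; gcongr; exact pow_le_one₀ (by norm_num) (by norm_num)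
  have hθ2 : θ ≤ 1 / 2 := hθ1.trans (by
    apply one_div_le_one_div_of_le <;> linarith)
  have hθn : θ ^ n ≤ 1 := pow_le_one₀ hθ0.le (by linarith)
  have hθn0 : 0 < θ ^ n := by positivity
  set K : ℝ := (N + 1) * (2 ^ N * (4 * Λ)) / θ ^ n with hK
  have h2N : (1 : ℝ) ≤ 2 ^ N := one_le_pow₀ (by norm_num)
  have hK1 : 2 ^ N * (4 * Λ) ≤ K := by
    rw [hK, le_div_iff₀ hθn0]
    have : (0:ℝ) ≤ 2 ^ N * (4 * Λ) := by positivity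
    have hN0 : (0:ℝ) ≤ N := by positivity
    nlinarith
  have hK4 : 4 * Λ ≤ K := by nlinarith
  refine ⟨θ, K, hθ0, hθ1, hK4, ?_⟩
  intro Ω hΩ w hw B hB hint x hx y hy r hr hrd hxy hdx hdy
  have hK0 : 0 < K := by linarith
  have hO : IsOpen (Ω ∩ ball x (K * r)) := hΩ.isOpen.inter isOpen_ball
  have hwO := hw.mono (inter_subset_left : Ω ∩ ball x (K * r) ⊆ Ω)
  have hBO : ∀ z ∈ Ω ∩ ball x (K * r), |w z| ≤ B := fun z hz => hB z hz.1
  have hintO := hint.mono_set (inter_subset_left : Ω ∩ ball x (K * r) ⊆ Ω)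
  set I := ∫ z in Ω ∩ ball x (K * r), ‖fderiv ℝ w z‖ with hI
  have hI0 : 0 ≤ I := integral_nonneg fun _ => norm_nonneg _
  have hθr : 0 < θ * r := by positivity
  -- general step
  have step : ∀ p q : EuclideanSpace ℝ (Fin n), ∀ s R : ℝ, dist p q ≤ s →
      s + θ * r ≤ R → ball p R ⊆ Ω → dist x p + R ≤ K * r →
      |mAvg w p (θ * r) - mAvg w q (θ * r)| ≤ s / (θ * r) ^ n * I := by
    intro p q s R hpq hsR hpR hxp
    have := mAvg_sub_le hO hwO hBO hintO p q hθr le_rfl le_rfl (by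
      intro t ht z hz
      have hz' : z ∈ ball p R := by
        have e1 : dist ((1 - t) • p + t • q) p ≤ s := by
          have : (1 - t) • p + t • q - p = t • (q - p) := by module
          rw [dist_eq_norm, this, norm_smul, Real.norm_eq_abs, abs_of_nonneg ht.1, ← dist_eq_norm,
            dist_comm]
          nlinarith [ht.2, dist_nonneg (x := p) (y := q)]
        rw [mem_ball] at hz ⊢
        have := dist_triangle z ((1 - t) • p + t • q) p
        have e2 : (1 - t) * (θ * r) + t * (θ * r) = θ * r := by ring
        linarith
      refine ⟨hpR hz', ?_⟩
      rw [mem_ball] at hz' ⊢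
      have := dist_triangle z p x
      rw [dist_comm p x] at this
      linarith)
    refine this.trans ?_
    rw [sub_self, abs_zero, add_zero, ← dist_eq_norm]
    gcongr
  have hfin : ∀ s : ℝ, s ≤ (N + 1) * (2 ^ N * (4 * Λ)) * r →
      s / (θ * r) ^ n * I ≤ K * r / r ^ n * I := by
    intro s hs
    refine mul_le_mul_of_nonneg_right ?_ hI0
    have : K * r / r ^ n = ((N + 1) * (2 ^ N * (4 * Λ)) * r) / (θ * r) ^ n := by
      rw [hK, mul_pow]; field_simp
    rw [this]
    gcongr
  have hN0 : (0:ℝ) ≤ N := by positivity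
  rcases le_or_gt (2 * Λ * r) (infDist x (frontier Ω)) with hbig | hsmall
  · have := step x y (Λ * r) (2 * Λ * r) hxy (by nlinarith)
      ((ball_subset_ball hbig).trans (ball_infDist_frontier_subset hΩ.isOpen hx))
      (by rw [dist_self]; nlinarith)
    refine this.trans (hfin _ ?_)
    have : Λ * r * 1 ≤ Λ * r * ((N + 1) * (2 ^ N * 4)) := by
      gcongr; nlinarith
    nlinarith
  · rcases eq_or_ne x y with rfl | hne
    · rw [sub_self, abs_zero]; positivity
    obtain ⟨c, ρ, hc1, hcN, hc⟩ := hΩ.harnack (dist x y) (r / Λ) k (dist_pos.2 hne)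
      (by linarith) (by positivity) (by omega) x hx y hy rfl hdx hdy (by
        calc dist x y ≤ Λ * r := hxy
          _ = Λ ^ 2 * (r / Λ) := by field_simp
          _ ≤ _ := by gcongr)
    rw [← hN] at hcN hc
    have hcΩ : ∀ i, 1 ≤ i → i ≤ N → c i ∈ Ω := fun i h1 h2 =>
      (hc i h1 h2).2.2.1 (mem_ball_self (hc i h1 h2).1)
    have ind : ∀ j : ℕ, j + 1 ≤ N →
        (9 / 10 : ℝ) ^ j * (r / Λ) ≤ infDist (c (j + 1)) (frontier Ω) ∧
        infDist (c (j + 1)) (frontier Ω) ≤ 2 ^ j * (2 * Λ * r) ∧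
        dist x (c (j + 1)) ≤ 2 ^ j * (2 * Λ * r) ∧
        |mAvg w x (θ * r) - mAvg w (c (j + 1)) (θ * r)| ≤
          j * ((2 ^ N * (4 * Λ) * r) / (θ * r) ^ n * I) := by
      intro j
      induction j with
      | zero =>
        intro _
        rw [zero_add, hc1]
        refine ⟨by simpa using hdx, by simpa using hsmall.le, ?_, by simp⟩
        rw [dist_self]; positivity
      | succ j ih =>
        intro hj
        obtain ⟨i1, i2, i3, i4⟩ := ih (by omega)
        obtain ⟨q1, q2, q3, q4⟩ := hc (j + 1) (by omega) (by omega)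
        have q5 := q4 (by omega)
        rw [mem_ball] at q5
        have l1 := infDist_le_infDist_add_dist (s := frontier Ω) (x := c (j + 1)) (y := c (j + 1 + 1))
        have l2 := infDist_le_infDist_add_dist (s := frontier Ω) (x := c (j + 1 + 1)) (y := c (j + 1))
        rw [dist_comm] at l1
        have hj0 : (0:ℝ) < 2 ^ j * (2 * Λ * r) := by positivity
        have l3 := dist_triangle x (c (j + 1)) (c (j + 1 + 1))
        rw [dist_comm (c (j + 1))] at l3
        refine ⟨?_, ?_, ?_, ?_⟩
        · have e : (9 / 10 : ℝ) ^ (j + 1) * (r / Λ) = 9 / 10 * ((9 / 10 : ℝ) ^ j * (r / Λ)) := by ring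
          linarith
        · have e : (2:ℝ) ^ (j + 1) * (2 * Λ * r) = 2 * (2 ^ j * (2 * Λ * r)) := by ring
          linarith
        · have e : (2:ℝ) ^ (j + 1) * (2 * Λ * r) = 2 * (2 ^ j * (2 * Λ * r)) := by ring
          linarith
        · have h2j : (2:ℝ) ^ j ≤ 2 ^ N := pow_le_pow_right₀ (by norm_num) (by omega)
          have h9j : (9/10:ℝ) ^ N ≤ (9/10) ^ j :=
            pow_le_pow_of_le_one (by norm_num) (by norm_num) (by omega)
          have hΛr : 0 < Λ * r := by positivity
          have hp1 : 2 ^ j * (2 * Λ * r) * 2 ≤ 2 ^ N * (4 * Λ) * r := by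
            calc 2 ^ j * (2 * Λ * r) * 2 ≤ 2 ^ N * (2 * Λ * r) * 2 := by gcongr
              _ = _ := by ring
          have hθr2 : θ * r ≤ infDist (c (j + 1)) (frontier Ω) / 2 := by
            calc θ * r = (9/10:ℝ) ^ N * (r / Λ) / 2 := by rw [hθ]; field_simp
              _ ≤ (9/10:ℝ) ^ j * (r / Λ) / 2 := by gcongr
              _ ≤ _ := by linarith
          have hst := step (c (j + 1)) (c (j + 1 + 1)) (infDist (c (j + 1)) (frontier Ω) / 10)
            (infDist (c (j + 1)) (frontier Ω)) (by rw [dist_comm]; linarith) (by linarith)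
            (ball_infDist_frontier_subset hΩ.isOpen (hcΩ _ (by omega) (by omega)))
            (by
              have e : 2 ^ N * (4 * Λ) * r ≤ K * r := by gcongr
              linarith)
          have hst2 : |mAvg w (c (j + 1)) (θ * r) - mAvg w (c (j + 1 + 1)) (θ * r)| ≤
              (2 ^ N * (4 * Λ) * r) / (θ * r) ^ n * I := by
            refine hst.trans ?_
            gcongr
            have := infDist_nonneg (x := c (j + 1)) (s := frontier Ω)
            linarith
          have tri := abs_sub_le (mAvg w x (θ * r)) (mAvg w (c (j + 1)) (θ * r))
            (mAvg w (c (j + 1 + 1)) (θ * r))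
          push_cast
          linarith
    have hlast := (ind (N - 1) (by omega)).2.2.2
    rw [Nat.sub_add_cancel hN1, hcN] at hlast
    refine hlast.trans ?_
    refine le_trans (le_of_eq ?_) (hfin ((N - 1 : ℕ) * (2 ^ N * (4 * Λ) * r)) ?_)
    · ring
    · have : ((N - 1 : ℕ) : ℝ) ≤ N + 1 := by
        have : ((N - 1 : ℕ) : ℝ) ≤ N := by exact_mod_cast Nat.sub_le _ _
        linarith
      calc ((N - 1 : ℕ) : ℝ) * (2 ^ N * (4 * Λ) * r) ≤ (N + 1) * (2 ^ N * (4 * Λ) * r) := by gcongr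
        _ = _ := by ring

/-- class of admissible functions -/
structure GoodFn {n : ℕ} (Ω : Set (EuclideanSpace ℝ (Fin n)))
    (w : EuclideanSpace ℝ (Fin n) → ℝ) : Prop where
  cd : ContDiffOn ℝ 1 w Ω
  cont : ContinuousOn w (closure Ω)
  int2 : IntegrableOn (fun x => ‖fderiv ℝ w x‖ ^ 2) Ω

theorem GoodFn.bdd {n : ℕ} {Ω : Set (EuclideanSpace ℝ (Fin n))}
    {w : EuclideanSpace ℝ (Fin n) → ℝ} (h : GoodFn Ω w) (hb : Bornology.IsBounded Ω) :
    ∃ B : ℝ, 0 ≤ B ∧ ∀ x ∈ closure Ω, |w x| ≤ B := by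
  obtain ⟨C, hC⟩ := hb.isCompact_closure.exists_bound_of_continuousOn h.cont
  exact ⟨max C 0, le_max_right _ _, fun x hx => (hC x hx).trans (le_max_left _ _)⟩

theorem GoodFn.int1 {n : ℕ} {Ω : Set (EuclideanSpace ℝ (Fin n))}
    {w : EuclideanSpace ℝ (Fin n) → ℝ} (h : GoodFn Ω w) (hb : Bornology.IsBounded Ω) :
    IntegrableOn (fun x => ‖fderiv ℝ w x‖) Ω := by
  have h1 : IntegrableOn (fun x => 1 + ‖fderiv ℝ w x‖ ^ 2) Ω :=
    (integrableOn_const hb.measure_lt_top.ne).add h.int2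
  refine h1.mono' (measurable_fderiv ℝ w).norm.aestronglyMeasurable (ae_of_all _ fun x => ?_)
  rw [norm_norm]
  nlinarith [sq_nonneg (‖fderiv ℝ w x‖ - 1)]

theorem chain_sq (n : ℕ) (M Λ : ℝ) (hM : 1 < M) (hΛ : 1 ≤ Λ) :
    ∃ θ K : ℝ, 0 < θ ∧ θ ≤ 1 / (2 * Λ) ∧ 4 * Λ ≤ K ∧
      ∀ Ω : Set (EuclideanSpace ℝ (Fin n)), IsOneSidedNTA M Ω → Bornology.IsBounded Ω →
      ∀ w : EuclideanSpace ℝ (Fin n) → ℝ, GoodFn Ω w →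
      ∀ x ∈ Ω, ∀ y ∈ Ω, ∀ r : ℝ, 0 < r → Λ * r < Metric.diam Ω / 10 → dist x y ≤ Λ * r →
        r / Λ ≤ infDist x (frontier Ω) → r / Λ ≤ infDist y (frontier Ω) →
        (mAvg w x (θ * r) - mAvg w y (θ * r)) ^ 2 ≤
          K * r ^ 2 / r ^ n * ∫ z in Ω ∩ ball x (K * r), ‖fderiv ℝ w z‖ ^ 2 := by
  obtain ⟨θ, K, hθ, hθ1, hK, H⟩ := chain_le n M Λ hM hΛ
  set v : ℝ := (volume (ball (0 : EuclideanSpace ℝ (Fin n)) 1)).toReal with hv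
  have hv0 : 0 ≤ v := ENNReal.toReal_nonneg
  have hK0 : 0 < K := by linarith
  refine ⟨θ, max K (K ^ 2 * K ^ n * v), hθ, hθ1, hK.trans (le_max_left _ _), ?_⟩
  set K' := max K (K ^ 2 * K ^ n * v) with hK'
  intro Ω hΩ hb w hw x hx y hy r hr hrd hxy hdx hdy
  obtain ⟨B, -, hB⟩ := hw.bdd hb
  have h1 := H Ω hΩ w hw.cd B (fun x hx => hB x (subset_closure hx)) (hw.int1 hb) x hx y hy r hr
    hrd hxy hdx hdy
  set O := Ω ∩ ball x (K * r) with hO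
  have hO1 : O ⊆ Ω := inter_subset_left
  have hfin : volume O < ⊤ := (hb.subset hO1).measure_lt_top
  have : IsFiniteMeasure (volume.restrict O) := ⟨by simpa using hfin⟩
  have hcs := sq_integral_le (μ := volume.restrict O) ((hw.int1 hb).mono_set hO1)
    (hw.int2.mono_set hO1)
  have hvol : (volume.restrict O).real univ ≤ (K * r) ^ n * v := by
    rw [measureReal_restrict_apply_univ, measureReal_def]
    refine (ENNReal.toReal_mono measure_ball_lt_top.ne (measure_mono inter_subset_right)).trans ?_
    rw [Measure.addHaar_ball_of_pos _ _ (by positivity), ENNReal.toReal_mul, ENNReal.toReal_ofReal (by positivity)]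
    simp [hv]
  have hI0 : 0 ≤ ∫ z in O, ‖fderiv ℝ w z‖ ^ 2 := integral_nonneg fun _ => by positivity
  have hmono : ∫ z in O, ‖fderiv ℝ w z‖ ^ 2 ≤ ∫ z in Ω ∩ ball x (K' * r), ‖fderiv ℝ w z‖ ^ 2 := by
    refine setIntegral_mono_set (hw.int2.mono_set inter_subset_left)
      (ae_of_all _ fun _ => by positivity) (LE.le.eventuallyLE ?_)
    exact inter_subset_inter_right _ (ball_subset_ball (by gcongr; exact le_max_left _ _))
  calc (mAvg w x (θ * r) - mAvg w y (θ * r)) ^ 2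
      = |mAvg w x (θ * r) - mAvg w y (θ * r)| ^ 2 := (sq_abs _).symm
    _ ≤ (K * r / r ^ n * ∫ z in O, ‖fderiv ℝ w z‖) ^ 2 := by gcongr
    _ = (K * r / r ^ n) ^ 2 * (∫ z in O, ‖fderiv ℝ w z‖) ^ 2 := by ring
    _ ≤ (K * r / r ^ n) ^ 2 * (((K * r) ^ n * v) * ∫ z in O, ‖fderiv ℝ w z‖ ^ 2) := by
        gcongr
        exact hcs.trans (by gcongr)
    _ = (K ^ 2 * K ^ n * v) * r ^ 2 / r ^ n * ∫ z in O, ‖fderiv ℝ w z‖ ^ 2 := by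
        rw [mul_pow]; field_simp
    _ ≤ _ := by
        gcongr
        exact le_max_right _ _

theorem cont_of_tsupp {n : ℕ} {U : Set (EuclideanSpace ℝ (Fin n))} (hU : IsOpen U)
    {f : EuclideanSpace ℝ (Fin n) → ℝ} (hf : ContinuousOn f U) {K : Set (EuclideanSpace ℝ (Fin n))}
    (hK : IsClosed K) (hKU : K ⊆ U)
    (h : ∀ x ∉ K, f x = 0) : Continuous f := by
  rw [continuous_iff_continuousAt]
  intro x
  by_cases hx : x ∈ K
  · exact hf.continuousAt (hU.mem_nhds (hKU hx))
  · have : f =ᶠ[𝓝 x] fun _ => 0 :=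
      Filter.eventually_of_mem (hK.isOpen_compl.mem_nhds hx) h
    exact (continuousAt_const).congr this.symm

theorem integrable_of_tsupp {n : ℕ} {U : Set (EuclideanSpace ℝ (Fin n))} (hU : IsOpen U)
    {f : EuclideanSpace ℝ (Fin n) → ℝ} (hf : ContinuousOn f U) {K : Set (EuclideanSpace ℝ (Fin n))}
    (hK : IsCompact K) (hKU : K ⊆ U)
    (h : ∀ x ∉ K, f x = 0) : Integrable f :=
  (cont_of_tsupp hU hf hK.isClosed hKU h).integrable_of_hasCompactSupport
    (HasCompactSupport.intro hK h)

theorem inner_grad {n : ℕ} (u ψ : EuclideanSpace ℝ (Fin n) → ℝ) (x : EuclideanSpace ℝ (Fin n)) :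
    ⟪gradient u x, gradient ψ x⟫ = ∑ i : Fin n, fderiv ℝ u x (EuclideanSpace.single i 1) *
      fderiv ℝ ψ x (EuclideanSpace.single i 1) := by
  rw [← (EuclideanSpace.basisFun (Fin n) ℝ).sum_inner_mul_inner (gradient u x) (gradient ψ x)]
  refine Finset.sum_congr rfl fun i _ => ?_
  rw [EuclideanSpace.basisFun_apply, real_inner_comm (gradient ψ x), inner_gradient_left,
    inner_gradient_left]

theorem norm_grad {n : ℕ} (u : EuclideanSpace ℝ (Fin n) → ℝ) (x : EuclideanSpace ℝ (Fin n)) :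
    ‖gradient u x‖ = ‖fderiv ℝ u x‖ := by
  rw [← toDual_gradient, LinearIsometryEquiv.norm_map]

theorem green0 {n : ℕ} {U : Set (EuclideanSpace ℝ (Fin n))} (hU : IsOpen U)
    {u : EuclideanSpace ℝ (Fin n) → ℝ} (hu : IsHarmonicOn u U)
    {ψ : EuclideanSpace ℝ (Fin n) → ℝ} (hψ : ContDiff ℝ 1 ψ) (hc : HasCompactSupport ψ)
    (hs : tsupport ψ ⊆ U) : ∫ x, ⟪gradient u x, gradient ψ x⟫ = 0 := by
  have hu2 : ContDiffOn ℝ 2 u U := fun x hx => ((hu x hx).1).contDiffWithinAt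
  have hdu : ContDiffOn ℝ 1 (fderiv ℝ u) U :=
    hu2.fderiv_of_isOpen hU (by norm_num)
  have hdui : ∀ v, ContDiffOn ℝ 1 (fun x => fderiv ℝ u x v) U := fun v =>
    hdu.clm_apply contDiffOn_const
  have hdψ : Continuous (fderiv ℝ ψ) := hψ.continuous_fderiv (by norm_num)
  have hψ0 : ∀ x ∉ tsupport ψ, ψ x = 0 := fun x hx => image_eq_zero_of_notMem_tsupport hx
  have hψ1 : ∀ x ∉ tsupport ψ, fderiv ℝ ψ x = 0 := fun x hx =>
    image_eq_zero_of_notMem_tsupport (fun h => hx (tsupport_fderiv_subset ℝ h))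
  have hddu : ∀ v, ContinuousOn (fun x => fderiv ℝ (fun y => fderiv ℝ u y v) x v) U := fun v =>
    ((hdui v).continuousOn_fderiv_of_isOpen hU (by norm_num)).clm_apply continuousOn_const
  have key : ∀ v, ∫ x, fderiv ℝ u x v * fderiv ℝ ψ x v =
      - ∫ x, fderiv ℝ (fun y => fderiv ℝ u y v) x v * ψ x := fun v => by
    refine integral_mul_fderiv_eq_neg_fderiv_mul_of_integrable ?_ ?_ ?_ ?_ ?_
    · exact integrable_of_tsupp hU ((hddu v).mul hψ.continuous.continuousOn) hc hs
        fun x hx => by simp [hψ0 x hx]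
    · exact integrable_of_tsupp hU ((hdui v).continuousOn.mul
        (hdψ.clm_apply continuous_const).continuousOn) hc hs fun x hx => by simp [hψ1 x hx]
    · exact integrable_of_tsupp hU ((hdui v).continuousOn.mul hψ.continuous.continuousOn) hc hs
        fun x hx => by simp [hψ0 x hx]
    · intro x hx
      exact ((hdui v).contDiffAt (hU.mem_nhds (hs hx))).differentiableAt (by norm_num)
    · intro x _
      exact hψ.differentiable (by norm_num) x
  have hint : ∀ v, Integrable (fun x => fderiv ℝ u x v * fderiv ℝ ψ x v) := fun v =>
    integrable_of_tsupp hU ((hdui v).continuousOn.mul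
        (hdψ.clm_apply continuous_const).continuousOn) hc hs fun x hx => by simp [hψ1 x hx]
  have hint2 : ∀ v, Integrable (fun x => fderiv ℝ (fun y => fderiv ℝ u y v) x v * ψ x) := fun v =>
    integrable_of_tsupp hU ((hddu v).mul hψ.continuous.continuousOn) hc hs
        fun x hx => by simp [hψ0 x hx]
  simp_rw [inner_grad]
  rw [integral_finsetSum _ (fun i _ => hint _)]
  simp_rw [key]
  rw [Finset.sum_neg_distrib, ← integral_finsetSum _ (fun i _ => hint2 _), neg_eq_zero]
  refine integral_eq_zero_of_ae (ae_of_all _ fun x => ?_)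
  show ∑ i, fderiv ℝ (fun y => fderiv ℝ u y (EuclideanSpace.single i 1)) x
    (EuclideanSpace.single i 1) * ψ x = 0
  rw [← Finset.sum_mul]
  by_cases hx : x ∈ tsupport ψ
  · have h2 := (hu x (hs hx)).2
    have : ∀ i : Fin n, fderiv ℝ (fun y => fderiv ℝ u y (EuclideanSpace.single i 1)) x
        (EuclideanSpace.single i 1) = iteratedFDeriv ℝ 2 u x ![EuclideanSpace.single i (1 : ℝ),
      EuclideanSpace.single i (1 : ℝ)] := fun i => by
      rw [iteratedFDeriv_two_apply, fderiv_clm_apply]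
      · simp
      · exact (hdu.contDiffAt (hU.mem_nhds (hs hx))).differentiableAt (by norm_num)
      · exact differentiableAt_const _
    simp_rw [this]
    rw [h2]; simp
  · rw [hψ0 x hx]; simp

/-- gradient vanishes a.e. on a level set -/
theorem level_set {n : ℕ} {U : Set (EuclideanSpace ℝ (Fin n))} (hU : IsOpen U)
    {u : EuclideanSpace ℝ (Fin n) → ℝ} (hu : ContDiffOn ℝ 1 u U) (hn : 0 < n) :
    ∀ᵐ x ∂(volume.restrict U), u x = 1 → fderiv ℝ u x = 0 := by
  set e : EuclideanSpace ℝ (Fin n) := EuclideanSpace.single ⟨0, hn⟩ 1 with he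
  have hen : ‖e‖ = 1 := by simp [he]
  set f : EuclideanSpace ℝ (Fin n) → EuclideanSpace ℝ (Fin n) := fun x => (u x - 1) • e with hf
  set s := U ∩ u ⁻¹' {1} with hs
  have hsm : MeasurableSet s := by
    obtain ⟨t, ht, hst⟩ := (continuousOn_iff_isClosed.1 hu.continuousOn) {1} isClosed_singleton
    rw [hs, inter_comm, hst]
    exact ht.measurableSet.inter hU.measurableSet
  have hd : ∀ x ∈ s, HasFDerivAt f ((fderiv ℝ u x).smulRight e) x := fun x hx => by
    have h1 : HasFDerivAt u (fderiv ℝ u x) x :=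
      ((hu.contDiffAt (hU.mem_nhds hx.1)).differentiableAt (by norm_num)).hasFDerivAt
    exact (h1.sub_const 1).smul_const e
  have hA : ApproximatesLinearOn f (0 : EuclideanSpace ℝ (Fin n) →L[ℝ] EuclideanSpace ℝ (Fin n)) s 0 := by
    intro x hx y hy
    have h1 : u x = 1 := hx.2
    have h2 : u y = 1 := hy.2
    simp [hf, h1, h2]
  have h := hA.norm_fderiv_sub_le volume hsm (fun x => (fderiv ℝ u x).smulRight e)
    (fun x hx => (hd x hx).hasFDerivWithinAt)
  rw [ae_restrict_iff' hsm] at h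
  rw [ae_restrict_iff' hU.measurableSet]
  filter_upwards [h] with x hx hxU hx1
  have := hx ⟨hxU, hx1⟩
  have he0 : e ≠ 0 := fun h => by simp [h] at hen
  simpa [ContinuousLinearMap.norm_smulRight_apply, he0] using this

theorem tonelli_ball {n : ℕ} (μ : Measure (EuclideanSpace ℝ (Fin n))) [SFinite μ]
    (Ω : Set (EuclideanSpace ℝ (Fin n))) (hΩ : MeasurableSet Ω)
    (f : EuclideanSpace ℝ (Fin n) → ℝ≥0∞) (hf : Measurable f) (s : ℝ) :
    ∫⁻ x, (∫⁻ z in Ω ∩ ball x s, f z) ∂μ = ∫⁻ z in Ω, f z * μ (ball z s) := by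
  have h1 : ∀ x, ∫⁻ z in Ω ∩ ball x s, f z =
      ∫⁻ z in Ω, ({p : EuclideanSpace ℝ (Fin n) × EuclideanSpace ℝ (Fin n) |
        dist p.1 p.2 < s}.indicator (fun p => f p.2)) (x, z) := by
    intro x
    rw [inter_comm, ← Measure.restrict_restrict measurableSet_ball, ← lintegral_indicator
      measurableSet_ball]
    refine lintegral_congr fun z => ?_
    by_cases h : dist x z < s
    · rw [indicator_of_mem, indicator_of_mem] <;> simpa [dist_comm z x] using h
    · rw [indicator_of_notMem, indicator_of_notMem] <;> simpa [dist_comm z x] using h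
  have hm : MeasurableSet {p : EuclideanSpace ℝ (Fin n) × EuclideanSpace ℝ (Fin n) |
        dist p.1 p.2 < s} := (isOpen_lt (by fun_prop) (by fun_prop)).measurableSet
  simp_rw [h1]
  rw [lintegral_lintegral_swap (f := fun x z => ({p : EuclideanSpace ℝ (Fin n) ×
      EuclideanSpace ℝ (Fin n) | dist p.1 p.2 < s}.indicator (fun p => f p.2)) (x, z))
    (((hf.comp measurable_snd).indicator hm).aemeasurable)]
  refine lintegral_congr fun z => ?_
  have : ∀ x, ({p : EuclideanSpace ℝ (Fin n) × EuclideanSpace ℝ (Fin n) |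
        dist p.1 p.2 < s}.indicator (fun p => f p.2)) (x, z) = (ball z s).indicator (fun _ => f z) x := by
    intro x
    by_cases h : dist x z < s
    · rw [indicator_of_mem, indicator_of_mem] <;> simpa using h
    · rw [indicator_of_notMem, indicator_of_notMem] <;> simpa using h
  simp_rw [this]
  rw [lintegral_indicator_const measurableSet_ball]

theorem mAvg_integrable {n : ℕ} {w : EuclideanSpace ℝ (Fin n) → ℝ}
    {O : Set (EuclideanSpace ℝ (Fin n))} {B : ℝ} (hw : ContinuousOn w O) (hB : ∀ z ∈ O, |w z| ≤ B)
    {p : EuclideanSpace ℝ (Fin n)} {ρ : ℝ} (hρ : 0 < ρ) (h : ball p ρ ⊆ O) :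
    IntegrableOn (fun z => w (p + ρ • z)) (ball 0 1) := by
  have hmap : MapsTo (fun z : EuclideanSpace ℝ (Fin n) => p + ρ • z) (ball 0 1) O := by
    intro z hz
    apply h
    rw [mem_ball_zero_iff] at hz
    simp only [mem_ball, dist_self_add_left, norm_smul, Real.norm_eq_abs, abs_of_pos hρ]
    nlinarith
  refine IntegrableOn.of_bound measure_ball_lt_top ?_ B ?_
  · exact (hw.comp (by fun_prop) hmap).aestronglyMeasurable measurableSet_ball
  · exact (ae_restrict_mem measurableSet_ball).mono fun z hz => hB _ (hmap hz)

theorem mAvg_close {n : ℕ} {w : EuclideanSpace ℝ (Fin n) → ℝ}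
    {O : Set (EuclideanSpace ℝ (Fin n))} {B : ℝ} (hw : ContinuousOn w O) (hB : ∀ z ∈ O, |w z| ≤ B)
    {p : EuclideanSpace ℝ (Fin n)} {ρ : ℝ} (hρ : 0 < ρ) (h : ball p ρ ⊆ O) {c τ : ℝ}
    (hc : ∀ z ∈ ball p ρ, |w z - c| ≤ τ) :
    |mAvg w p ρ - volume.real (ball (0 : EuclideanSpace ℝ (Fin n)) 1) * c| ≤
      volume.real (ball (0 : EuclideanSpace ℝ (Fin n)) 1) * τ := by
  have e : mAvg w p ρ - volume.real (ball (0 : EuclideanSpace ℝ (Fin n)) 1) * c =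
      ∫ z in ball (0 : EuclideanSpace ℝ (Fin n)) 1, (w (p + ρ • z) - c) := by
    rw [integral_sub (mAvg_integrable hw hB hρ h) (integrableOn_const measure_ball_lt_top.ne)]
    rw [setIntegral_const, smul_eq_mul]; rfl
  rw [e, mul_comm, ← Real.norm_eq_abs]
  refine norm_setIntegral_le_of_norm_le_const measure_ball_lt_top fun z hz => ?_
  apply hc
  rw [mem_ball_zero_iff] at hz
  simp only [mem_ball, dist_self_add_left, norm_smul, Real.norm_eq_abs, abs_of_pos hρ]
  nlinarith

theorem exists_sel {n : ℕ} (V : Set (EuclideanSpace ℝ (Fin n))) (hV : IsOpen V) (s : ℝ)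
    (G : EuclideanSpace ℝ (Fin n) → ℝ) :
    ∃ g : EuclideanSpace ℝ (Fin n) → ℝ, Measurable g ∧
      (∀ Y, (∃ p ∈ V, dist p Y < s) → ∃ p ∈ V, dist p Y < s ∧ g Y = G p) ∧
      ∀ Y, (¬ ∃ p ∈ V, dist p Y < s) → g Y = 0 := by
  classical
  set d := TopologicalSpace.denseSeq (EuclideanSpace ℝ (Fin n)) with hd
  set good : EuclideanSpace ℝ (Fin n) → ℕ → Prop := fun Y k => d k ∈ V ∧ dist (d k) Y < s with hgood
  have hgm : ∀ k, MeasurableSet {Y | good Y k} := fun k =>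
    (MeasurableSet.const (d k ∈ V)).inter (measurableSet_lt (f := fun Y => dist (d k) Y)
      (g := fun _ => s) (by fun_prop) (by fun_prop))
  have hp : ∀ Y, ∃ k, good Y k ∨ ∀ j, ¬ good Y j := fun Y => by
    by_cases h : ∃ k, good Y k
    · obtain ⟨k, hk⟩ := h; exact ⟨k, Or.inl hk⟩
    · exact ⟨0, Or.inr (not_exists.1 h)⟩
  have hmf := measurable_find hp (fun k => by
    refine (hgm k).union ?_
    have : {a | ∀ j, ¬ good a j} = ⋂ j, {a | good a j}ᶜ := by ext; simp
    rw [show (fun a => ∀ j, ¬ good a j) = {a | ∀ j, ¬ good a j} from rfl, this]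
    exact MeasurableSet.iInter fun j => (hgm j).compl)
  have hdense : ∀ Y, (∃ p ∈ V, dist p Y < s) → ∃ k, good Y k := by
    rintro Y ⟨p, hp, hps⟩
    have ho : IsOpen (V ∩ ball Y s) := hV.inter isOpen_ball
    obtain ⟨k, hk⟩ := (TopologicalSpace.denseRange_denseSeq
      (EuclideanSpace ℝ (Fin n))).exists_mem_open ho ⟨p, hp, hps⟩
    exact ⟨k, hk.1, hk.2⟩
  refine ⟨fun Y => if ∃ k, good Y k then G (d (Nat.find (hp Y))) else 0, ?_, ?_, ?_⟩
  · refine Measurable.ite ?_ ?_ measurable_const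
    · have : {a | ∃ k, good a k} = ⋃ j, {a | good a j} := by ext; simp
      rw [this]; exact MeasurableSet.iUnion hgm
    · exact (measurable_from_nat (f := fun k => G (d k))).comp hmf
  · intro Y hY
    have hk := hdense Y hY
    rcases Nat.find_spec (hp Y) with h | h
    · exact ⟨_, h.1, h.2, by simp only [if_pos hk]⟩
    · obtain ⟨k, hk⟩ := hk; exact absurd hk (h k)
  · intro Y hY
    have : ¬ ∃ k, good Y k := fun ⟨k, hk⟩ => hY ⟨d k, hk.1, hk.2⟩
    simp only [if_neg this]

theorem mollify (n : ℕ) : ∃ C : ℝ, 0 ≤ C ∧ ∀ ε : ℝ, 0 < ε → ∀ g : EuclideanSpace ℝ (Fin n) → ℝ,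
    Measurable g → HasCompactSupport g → (∃ B, ∀ x, |g x| ≤ B) →
    ∃ φ : EuclideanSpace ℝ (Fin n) → ℝ, ContDiff ℝ (⊤ : ℕ∞) φ ∧ HasCompactSupport φ ∧
      (∀ X c τ, (∀ Y ∈ ball X ε, |g Y - c| ≤ τ) → |φ X - c| ≤ τ) ∧
      (∀ X c G, 0 ≤ G → (∀ Y ∈ ball X (2 * ε), |g Y - c| ≤ ε * G) → ‖fderiv ℝ φ X‖ ≤ C * G) := by
  let b : ContDiffBump (0 : EuclideanSpace ℝ (Fin n)) := ⟨1/2, 1, by norm_num, by norm_num⟩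
  set ζ : EuclideanSpace ℝ (Fin n) → ℝ := b.normed volume with hζ
  have hζs : ContDiff ℝ (⊤ : ℕ∞) ζ := b.contDiff_normed
  have hζc : HasCompactSupport ζ := b.hasCompactSupport_normed
  have hζ0 : ∀ x, 0 ≤ ζ x := b.nonneg_normed
  have hζ1 : ∫ x, ζ x = 1 := b.integral_normed
  have hζz : ∀ x, 1 ≤ ‖x‖ → ζ x = 0 := fun x hx => by
    have : x ∉ Function.support ζ := by
      rw [hζ, b.support_normed_eq]; simpa using hx
    simpa using this
  obtain ⟨L, hL⟩ := ContDiff.lipschitzWith_of_hasCompactSupport hζc hζs (by simp)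
  set v := volume.real (ball (0 : EuclideanSpace ℝ (Fin n)) 1) with hv
  have hv0 : 0 ≤ v := measureReal_nonneg
  refine ⟨L * (2 ^ n * v), by positivity, ?_⟩
  intro ε hε g hgm hgc ⟨B, hB⟩
  set η : EuclideanSpace ℝ (Fin n) → ℝ := fun x => (ε ^ n)⁻¹ * ζ (ε⁻¹ • x) with hη
  have hηs : ContDiff ℝ (⊤ : ℕ∞) η := contDiff_const.mul (hζs.comp (contDiff_const_smul _))
  have hη0 : ∀ x, 0 ≤ η x := fun x => mul_nonneg (by positivity) (hζ0 _)
  have hηz : ∀ x, ε ≤ ‖x‖ → η x = 0 := fun x hx => by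
    simp only [hη]
    rw [hζz, mul_zero]
    rw [norm_smul, norm_inv, Real.norm_eq_abs, abs_of_pos hε, ← div_eq_inv_mul, one_le_div hε]
    exact hx
  have hηc : HasCompactSupport η := by
    refine HasCompactSupport.intro (isCompact_closedBall 0 ε) fun x hx => hηz x ?_
    rw [mem_closedBall_zero_iff] at hx; linarith
  have hηi : Integrable η := hηs.continuous.integrable_of_hasCompactSupport hηc
  have hη1 : ∫ x, η x = 1 := by
    simp only [hη]
    rw [integral_const_mul, Measure.integral_comp_inv_smul_of_nonneg _ _ hε.le, hζ1]
    simp; field_simp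
  have hηX : ∀ X, Integrable (fun t => η (X - t)) := fun X => hηi.comp_sub_left X
  have hηX1 : ∀ X, ∫ t, η (X - t) = 1 := fun X => by rw [integral_sub_left_eq_self]; exact hη1
  have hgi : Integrable g := by
    have : IntegrableOn g (tsupport g) := IntegrableOn.of_bound hgc.measure_lt_top
      hgm.aestronglyMeasurable B (ae_of_all _ hB)
    rwa [integrableOn_iff_integrable_of_support_subset (subset_tsupport g)] at this
  set φ := convolution g η (ContinuousLinearMap.lsmul ℝ ℝ) volume with hφ
  have hφe : ∀ X, φ X = ∫ t, g t * η (X - t) := fun X => by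
    rw [hφ, convolution_def]; rfl
  have hgη : ∀ X, Integrable (fun t => g t * η (X - t)) := fun X =>
    (hηX X).bdd_mul hgm.aestronglyMeasurable (ae_of_all _ hB)
  have hsub : ∀ X c, φ X - c = ∫ t, (g t - c) * η (X - t) := fun X c => by
    simp_rw [sub_mul]
    rw [integral_sub (hgη X) ((hηX X).const_mul c), integral_const_mul, hηX1, hφe, mul_one]
  have hsubi : ∀ X c, Integrable (fun t => (g t - c) * η (X - t)) := fun X c => by
    simp_rw [sub_mul]
    exact (hgη X).sub ((hηX X).const_mul c)
  refine ⟨φ, hηc.contDiff_convolution_right _ hgi.locallyIntegrable hηs, hgc.convolution _ hηc, ?_, ?_⟩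
  · intro X c τ h
    rw [hsub, ← Real.norm_eq_abs]
    calc ‖∫ t, (g t - c) * η (X - t)‖ ≤ ∫ t, τ * η (X - t) := by
          refine norm_integral_le_of_norm_le ((hηX X).const_mul τ) (ae_of_all _ fun t => ?_)
          rw [norm_mul, Real.norm_eq_abs, Real.norm_eq_abs, abs_of_nonneg (hη0 _)]
          by_cases ht : t ∈ ball X ε
          · exact mul_le_mul_of_nonneg_right (h t ht) (hη0 _)
          · rw [hηz _ (by rw [← dist_eq_norm, dist_comm]; simpa using ht)]; simp
      _ = τ := by rw [integral_const_mul, hηX1, mul_one]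
  · intro X c G hG h
    refine norm_fderiv_le_of_lip' ℝ (by positivity) ?_
    filter_upwards [ball_mem_nhds X hε] with X' hX'
    have e : φ X' - φ X = ∫ t, (g t - c) * (η (X' - t) - η (X - t)) := by
      rw [show φ X' - φ X = (φ X' - c) - (φ X - c) by ring, hsub, hsub,
        ← integral_sub (hsubi _ _) (hsubi _ _)]
      congr 1; ext t; ring
    rw [e]
    have hlip : ∀ t, |η (X' - t) - η (X - t)| ≤ (ε ^ n)⁻¹ * (L * (ε⁻¹ * ‖X' - X‖)) := by
      intro t
      have h1 := hL.dist_le_mul (ε⁻¹ • (X' - t)) (ε⁻¹ • (X - t))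
      rw [Real.dist_eq, dist_eq_norm, ← smul_sub, norm_smul, norm_inv, Real.norm_eq_abs,
        abs_of_pos hε, sub_sub_sub_cancel_right] at h1
      simp only [hη]
      rw [← mul_sub, abs_mul, abs_of_pos (by positivity : 0 < (ε ^ n)⁻¹)]
      gcongr
    calc ‖∫ t, (g t - c) * (η (X' - t) - η (X - t))‖
        ≤ ∫ t, (ball X (2 * ε)).indicator
            (fun _ => (ε * G) * ((ε ^ n)⁻¹ * (L * (ε⁻¹ * ‖X' - X‖)))) t := by
          refine norm_integral_le_of_norm_le ?_ (ae_of_all _ fun t => ?_)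
          · rw [integrable_indicator_iff measurableSet_ball]
            exact integrableOn_const measure_ball_lt_top.ne
          · by_cases ht : t ∈ ball X (2 * ε)
            · rw [indicator_of_mem ht, norm_mul, Real.norm_eq_abs, Real.norm_eq_abs]
              exact mul_le_mul (h t ht) (hlip t) (abs_nonneg _) (by positivity)
            · rw [indicator_of_notMem ht]
              rw [mem_ball, not_lt] at ht
              rw [mem_ball] at hX'
              have t1 := dist_triangle t X' X
              rw [hηz (X' - t), hηz (X - t)]
              · simp
              · rw [← dist_eq_norm, dist_comm]; linarith
              · rw [← dist_eq_norm, dist_comm]; linarith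
      _ = (2 * ε) ^ n * v * ((ε * G) * ((ε ^ n)⁻¹ * (L * (ε⁻¹ * ‖X' - X‖)))) := by
          rw [integral_indicator_const _ measurableSet_ball, smul_eq_mul, measureReal_def,
            Measure.addHaar_ball_of_pos _ _ (by positivity), ENNReal.toReal_mul,
            ENNReal.toReal_ofReal (by positivity)]
          simp [hv, measureReal_def]
      _ = L * (2 ^ n * v) * G * ‖X' - X‖ := by
          rw [mul_pow]; field_simp

theorem vol_ball_real {n : ℕ} (x : EuclideanSpace ℝ (Fin n)) {r : ℝ} (hr : 0 < r) :
    volume (ball x r) =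
      ENNReal.ofReal (r ^ n * volume.real (ball (0 : EuclideanSpace ℝ (Fin n)) 1)) := by
  rw [Measure.addHaar_ball_of_pos _ _ hr, ENNReal.ofReal_mul (by positivity), measureReal_def,
    ENNReal.ofReal_toReal measure_ball_lt_top.ne]
  simp

theorem exists_near {n : ℕ} {M : ℝ} {Ω : Set (EuclideanSpace ℝ (Fin n))} (hΩ : IsOneSidedNTA M Ω)
    (hne : (frontier Ω).Nonempty) {ε : ℝ} (hε : 0 < ε) (hεd : ε < diam Ω / 10)
    {X : EuclideanSpace ℝ (Fin n)} (hX : X ∈ closure Ω) :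
    ∃ p ∈ Ω, dist p X < 2 * ε ∧ ε / M ≤ infDist p (frontier Ω) := by
  have hM := hΩ.M_gt_one
  by_cases h : ε ≤ infDist X (frontier Ω)
  · have hXΩ : X ∈ Ω := by
      by_contra hc
      have : X ∈ frontier Ω := by rw [hΩ.isOpen.frontier_eq]; exact ⟨hX, hc⟩
      rw [infDist_zero_of_mem this] at h
      linarith
    refine ⟨X, hXΩ, by rw [dist_self]; positivity, le_trans ?_ h⟩
    exact div_le_self hε.le hM.le
  · push Not at h
    obtain ⟨Q, hQ, hQd⟩ := (infDist_lt_iff hne).1 h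
    obtain ⟨A, hA, hAd⟩ := hΩ.corkscrew Q hQ ε hε hεd
    refine ⟨A, hA.1, ?_, hAd⟩
    have h1 := hA.2
    rw [mem_ball] at h1
    have := dist_triangle A Q X
    rw [dist_comm Q X] at this
    linarith

theorem ofReal_int_sq {n : ℕ} {w : EuclideanSpace ℝ (Fin n) → ℝ}
    {s : Set (EuclideanSpace ℝ (Fin n))} (h : IntegrableOn (fun x => ‖fderiv ℝ w x‖ ^ 2) s) :
    ENNReal.ofReal (∫ x in s, ‖fderiv ℝ w x‖ ^ 2) =
      ∫⁻ x in s, ENNReal.ofReal (‖fderiv ℝ w x‖ ^ 2) :=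
  ofReal_integral_eq_lintegral_ofReal h (ae_of_all _ fun _ => by positivity)

theorem smooth_int2 {n : ℕ} {φ : EuclideanSpace ℝ (Fin n) → ℝ} (hφs : ContDiff ℝ (⊤ : ℕ∞) φ)
    (hφc : HasCompactSupport φ) {Ω : Set (EuclideanSpace ℝ (Fin n))} :
    IntegrableOn (fun x => ‖fderiv ℝ φ x‖ ^ 2) Ω := by
  have hc : Continuous (fderiv ℝ φ) := hφs.continuous_fderiv (by simp)
  have h2 : HasCompactSupport (fun x => ‖fderiv ℝ φ x‖ ^ 2) :=
    HasCompactSupport.intro hφc fun x hx => by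
      have : fderiv ℝ φ x = 0 :=
        image_eq_zero_of_notMem_tsupport (fun h => hx (tsupport_fderiv_subset ℝ h))
      rw [this, norm_zero]; norm_num
  have : Integrable (fun x => ‖fderiv ℝ φ x‖ ^ 2) :=
    (hc.norm.pow 2).integrable_of_hasCompactSupport h2
  exact this.integrableOn

theorem fin_tonelli {n : ℕ} {φ w : EuclideanSpace ℝ (Fin n) → ℝ} 
    {Ω : Set (EuclideanSpace ℝ (Fin n))} (hΩ : MeasurableSet Ω)
    (hw : IntegrableOn (fun x => ‖fderiv ℝ w x‖ ^ 2) Ω)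
    (hφi : IntegrableOn (fun x => ‖fderiv ℝ φ x‖ ^ 2) Ω) {C2 C K2 ε : ℝ} (hC20 : 0 ≤ C2)
    (hε : 0 < ε) (hK2 : 0 < K2)
    (hpt : ∀ X ∈ Ω, ‖fderiv ℝ φ X‖ ^ 2 ≤
        C2 * ∫ z in Ω ∩ ball X (K2 * ε), ‖fderiv ℝ w z‖ ^ 2)
    (hC : C2 * ((K2 * ε) ^ n * volume.real (ball (0 : EuclideanSpace ℝ (Fin n)) 1)) = C) :
    ∫ x in Ω, ‖fderiv ℝ φ x‖ ^ 2 ≤ C * ∫ x in Ω, ‖fderiv ℝ w x‖ ^ 2 := by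
  set v := volume.real (ball (0 : EuclideanSpace ℝ (Fin n)) 1) with hv
  have hv0 : 0 ≤ v := measureReal_nonneg
  have hI0 : 0 ≤ ∫ x in Ω, ‖fderiv ℝ w x‖ ^ 2 := integral_nonneg fun _ => by positivity
  rw [← ENNReal.ofReal_le_ofReal_iff (by rw [← hC]; positivity), ofReal_int_sq hφi]
  have hsf : Measurable fun z => ENNReal.ofReal (‖fderiv ℝ w z‖ ^ 2) :=
    ((measurable_fderiv ℝ w).norm.pow_const 2).ennreal_ofReal
  calc ∫⁻ x in Ω, ENNReal.ofReal (‖fderiv ℝ φ x‖ ^ 2)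
      ≤ ∫⁻ x in Ω, ENNReal.ofReal C2 * ∫⁻ z in Ω ∩ ball x (K2 * ε),
          ENNReal.ofReal (‖fderiv ℝ w z‖ ^ 2) := by
        refine setLIntegral_mono' hΩ fun X hX => ?_
        rw [← ofReal_int_sq (hw.mono_set inter_subset_left), ← ENNReal.ofReal_mul hC20]
        exact ENNReal.ofReal_le_ofReal (hpt X hX)
    _ = ENNReal.ofReal C2 * ∫⁻ z in Ω, ENNReal.ofReal (‖fderiv ℝ w z‖ ^ 2) *
          (volume.restrict Ω) (ball z (K2 * ε)) := by
        rw [lintegral_const_mul' _ _ ENNReal.ofReal_ne_top,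
          tonelli_ball _ Ω hΩ _ hsf]
    _ ≤ ENNReal.ofReal C2 * ∫⁻ z in Ω, ENNReal.ofReal (‖fderiv ℝ w z‖ ^ 2) *
          ENNReal.ofReal ((K2 * ε) ^ n * v) := by
        gcongr with z
        rw [hv, ← vol_ball_real z (by positivity)]
        exact Measure.restrict_apply_le _ _
    _ = ENNReal.ofReal (C * ∫ x in Ω, ‖fderiv ℝ w x‖ ^ 2) := by
        rw [lintegral_mul_const' _ _ ENNReal.ofReal_ne_top, ← ofReal_int_sq hw,
          ← ENNReal.ofReal_mul hI0, ← ENNReal.ofReal_mul hC20, ← hC]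
        congr 1
        ring

set_option maxHeartbeats 1000000 in
theorem approx_scale {n : ℕ} {M : ℝ} {Ω : Set (EuclideanSpace ℝ (Fin n))}
    (hΩ : IsOneSidedNTA M Ω) (hb : Bornology.IsBounded Ω) (hne : (frontier Ω).Nonempty)
    (hdiam : 0 < diam Ω) :
    ∃ C ε₀ : ℝ, 0 ≤ C ∧ 0 < ε₀ ∧ ∀ w : EuclideanSpace ℝ (Fin n) → ℝ, GoodFn Ω w →
      ∀ ε : ℝ, 0 < ε → ε < ε₀ → ∃ φ : EuclideanSpace ℝ (Fin n) → ℝ,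
        ContDiff ℝ (⊤ : ℕ∞) φ ∧ HasCompactSupport φ ∧
        (∀ X ∈ closure Ω, ∀ c τ, (∀ z ∈ Ω ∩ ball X (6 * ε), |w z - c| ≤ τ) → |φ X - c| ≤ τ) ∧
        ∫ x in Ω, ‖fderiv ℝ φ x‖ ^ 2 ≤ C * ∫ x in Ω, ‖fderiv ℝ w x‖ ^ 2 := by
  have hM := hΩ.M_gt_one
  set Λ := 2 * M + 20 with hΛ
  have hΛ1 : 1 ≤ Λ := by linarith
  have hΛ0 : 0 < Λ := by linarith
  obtain ⟨θ, K, hθ, hθ1, hK, H⟩ := chain_sq n M Λ hM hΛ1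
  obtain ⟨C1, hC1, HM⟩ := mollify n
  set v := volume.real (ball (0 : EuclideanSpace ℝ (Fin n)) 1) with hv
  have hv0 : 0 < v := ENNReal.toReal_pos (measure_ball_pos _ _ one_pos).ne' measure_ball_lt_top.ne
  have hK0 : 0 < K := by linarith
  set K2 := K + 4 with hK2
  refine ⟨C1 ^ 2 * (K / v ^ 2) * (K2 ^ n * v), diam Ω / 10 / Λ, by positivity, by positivity, ?_⟩
  intro w hw ε hε hε0
  have hεd : Λ * ε < diam Ω / 10 := by rwa [lt_div_iff₀ hΛ0, mul_comm] at hε0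
  have hεd' : ε < diam Ω / 10 := by nlinarith
  obtain ⟨B, hB0, hB⟩ := hw.bdd hb
  have hBΩ : ∀ z ∈ Ω, |w z| ≤ B := fun z hz => hB z (subset_closure hz)
  have hwc : ContinuousOn w Ω := hw.cd.continuousOn
  set V := Ω ∩ {p | ε / (2 * M) < infDist p (frontier Ω)} with hV
  have hVo : IsOpen V := hΩ.isOpen.inter (isOpen_lt continuous_const (continuous_infDist_pt _))
  have hθε : 0 < θ * ε := by positivity
  have hθΛ : θ * ε ≤ ε / (2 * M) := by
    calc θ * ε ≤ 1 / (2 * Λ) * ε := by gcongr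
      _ = ε / (2 * Λ) := by ring
      _ ≤ ε / (2 * M) := by gcongr; linarith
  have hθ2 : θ * ε ≤ ε / 2 := hθΛ.trans (by gcongr; linarith)
  have hball : ∀ p ∈ V, ball p (θ * ε) ⊆ Ω := fun p hp =>
    (ball_subset_ball (hθΛ.trans (le_of_lt hp.2))).trans (ball_infDist_frontier_subset hΩ.isOpen hp.1)
  obtain ⟨g, hgm, hg1, hg2⟩ := exists_sel V hVo (4 * ε) (fun p => mAvg w p (θ * ε) / v)
  have hdiv : ∀ p c τ, |mAvg w p (θ * ε) - v * c| ≤ v * τ → |mAvg w p (θ * ε) / v - c| ≤ τ := by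
    intro p c τ h
    have e : mAvg w p (θ * ε) / v - c = (mAvg w p (θ * ε) - v * c) / v := by field_simp
    rw [e, abs_div, abs_of_pos hv0, div_le_iff₀ hv0, mul_comm τ]
    exact h
  have hgB : ∀ x, |g x| ≤ B := by
    intro x
    by_cases h : ∃ p ∈ V, dist p x < 4 * ε
    · obtain ⟨p, hp, -, hpg⟩ := hg1 x h
      rw [hpg]
      have := hdiv p 0 B (mAvg_close hwc hBΩ hθε (hball p hp) (c := 0) (τ := B)
        fun z hz => by rw [sub_zero]; exact hBΩ z (hball p hp hz))
      simpa using this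
    · rw [hg2 x h]; simpa using hB0
  have hgc : HasCompactSupport g := by
    obtain ⟨R, hR⟩ := hb.subset_ball 0
    refine HasCompactSupport.intro (isCompact_closedBall 0 (R + 4 * ε)) fun x hx => hg2 x ?_
    rintro ⟨p, hp, hpx⟩
    apply hx
    have h1 := hR hp.1
    rw [mem_ball] at h1
    rw [mem_closedBall]
    have := dist_triangle x p 0
    rw [dist_comm x p] at this
    linarith
  have hex : ∀ X ∈ closure Ω, ∀ Y ∈ ball X (2 * ε), ∃ p ∈ V, dist p Y < 4 * ε ∧
      g Y = mAvg w p (θ * ε) / v := by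
    intro X hX Y hY
    apply hg1
    obtain ⟨p, hp, hpX, hpd⟩ := exists_near hΩ hne hε hεd' hX
    refine ⟨p, ⟨hp, ?_⟩, ?_⟩
    · show ε / (2 * M) < infDist p (frontier Ω)
      refine lt_of_lt_of_le ?_ hpd
      apply div_lt_div_of_pos_left hε (by linarith) (by linarith)
    · rw [mem_ball, dist_comm] at hY
      have := dist_triangle p X Y
      linarith
  obtain ⟨φ, hφs, hφc, hφ1, hφ2⟩ := HM ε hε g hgm hgc ⟨B, hgB⟩
  refine ⟨φ, hφs, hφc, ?_, ?_⟩
  · intro X hX c τ h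
    refine hφ1 X c τ fun Y hY => ?_
    obtain ⟨p, hp, hpY, hpg⟩ := hex X hX Y (ball_subset_ball (by linarith) hY)
    rw [hpg]
    refine hdiv p c τ (mAvg_close hwc hBΩ hθε (hball p hp) fun z hz => h z ⟨hball p hp hz, ?_⟩)
    rw [mem_ball] at hz hY ⊢
    have t1 := dist_triangle z p X
    have t2 := dist_triangle p Y X
    linarith
  · set C2 := C1 ^ 2 * (K / v ^ 2) / ε ^ n with hC2
    have hC20 : 0 ≤ C2 := by positivity
    have hpt : ∀ X ∈ Ω, ‖fderiv ℝ φ X‖ ^ 2 ≤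
        C2 * ∫ z in Ω ∩ ball X (K2 * ε), ‖fderiv ℝ w z‖ ^ 2 := by
      intro X hX
      have hXc := subset_closure hX
      obtain ⟨p, hp, hpX, hpg⟩ := hex X hXc X (mem_ball_self (by positivity))
      set J := ∫ z in Ω ∩ ball X (K2 * ε), ‖fderiv ℝ w z‖ ^ 2 with hJ
      have hJ0 : 0 ≤ J := integral_nonneg fun _ => by positivity
      set G := Real.sqrt (K / v ^ 2 / ε ^ n * J) with hG
      have hGsq : G ^ 2 = K / v ^ 2 / ε ^ n * J := Real.sq_sqrt (by positivity)
      have := hφ2 X (g X) G (Real.sqrt_nonneg _) (fun Y hY => by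
        obtain ⟨q, hq, hqY, hqg⟩ := hex X hXc Y hY
        rw [mem_ball] at hY
        have t1 := dist_triangle p X q
        have t2 := dist_triangle X Y q
        rw [dist_comm Y q, dist_comm X Y] at t2
        have hdl : ∀ q ∈ V, ε / Λ ≤ infDist q (frontier Ω) := fun q hq =>
          le_trans (by gcongr; linarith) (le_of_lt hq.2)
        have h1 := H Ω hΩ hb w hw p hp.1 q hq.1 ε hε hεd (by
          have : 10 * ε ≤ Λ * ε := by gcongr; linarith
          linarith) (hdl p hp) (hdl q hq)
        have h2 : ∫ z in Ω ∩ ball p (K * ε), ‖fderiv ℝ w z‖ ^ 2 ≤ J := by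
          refine setIntegral_mono_set (hw.int2.mono_set inter_subset_left)
            (ae_of_all _ fun _ => by positivity) (LE.le.eventuallyLE ?_)
          refine inter_subset_inter_right _ (ball_subset_ball' ?_)
          rw [hK2]; linarith
        rw [hqg, hpg, ← abs_of_nonneg (mul_nonneg hε.le (Real.sqrt_nonneg _)), ← sq_le_sq, mul_pow,
          hGsq]
        have e : (mAvg w q (θ * ε) / v - mAvg w p (θ * ε) / v) ^ 2 =
            (mAvg w p (θ * ε) - mAvg w q (θ * ε)) ^ 2 / v ^ 2 := by ring
        rw [e]
        calc (mAvg w p (θ * ε) - mAvg w q (θ * ε)) ^ 2 / v ^ 2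
            ≤ (K * ε ^ 2 / ε ^ n * J) / v ^ 2 := by
              gcongr
              exact h1.trans (by gcongr)
          _ = _ := by ring)
      calc ‖fderiv ℝ φ X‖ ^ 2 ≤ (C1 * G) ^ 2 := by gcongr
        _ = C2 * J := by rw [mul_pow, hGsq, hC2]; ring
    exact fin_tonelli hΩ.isOpen.measurableSet hw.int2 (smooth_int2 hφs hφc) hC20 hε (by positivity) hpt (by
      rw [hC2, mul_pow, ← hv]; field_simp)

theorem smooth_cutoff {n : ℕ} {K U : Set (EuclideanSpace ℝ (Fin n))} (hK : IsCompact K)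
    (hU : IsOpen U) (hKU : K ⊆ U) : ∃ χ : EuclideanSpace ℝ (Fin n) → ℝ,
      ContDiff ℝ (⊤ : ℕ∞) χ ∧ HasCompactSupport χ ∧ tsupport χ ⊆ U ∧ (∀ x ∈ K, χ x = 1) ∧
      ∀ x, 0 ≤ χ x ∧ χ x ≤ 1 := by
  obtain ⟨δ, hδ, hδU⟩ := hK.exists_cthickening_subset_open hU hKU
  obtain ⟨C, -, H⟩ := mollify n
  set g : EuclideanSpace ℝ (Fin n) → ℝ := (thickening (δ / 2) K).indicator (fun _ => 1) with hg
  have hcc : IsCompact (cthickening δ K) := hK.cthickening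
  have hg1 : ∀ x, |g x - 1 / 2| ≤ 1 / 2 := fun x => by
    by_cases h : x ∈ thickening (δ / 2) K
    · rw [hg, indicator_of_mem h]; norm_num [abs_le]
    · rw [hg, indicator_of_notMem h]; norm_num [abs_le]
  obtain ⟨χ, h1, h2, h3, -⟩ := H (δ / 4) (by positivity) g
    (measurable_const.indicator isOpen_thickening.measurableSet)
    (HasCompactSupport.intro hcc fun x hx => by
      rw [hg, indicator_of_notMem]
      exact fun h => hx (thickening_subset_cthickening_of_le (by linarith) _ h))
    ⟨1, fun x => by have := abs_le.1 (hg1 x); rw [abs_le]; constructor <;> linarith⟩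
  have hz : ∀ x ∉ cthickening δ K, χ x = 0 := fun X hX => by
    have := h3 X 0 0 (fun Y hY => by
      rw [hg, indicator_of_notMem]
      · simp
      · intro hYt
        rw [mem_thickening_iff] at hYt
        obtain ⟨z, hz, hYz⟩ := hYt
        rw [mem_ball, dist_comm] at hY
        have := dist_triangle X Y z
        exact hX (mem_cthickening_of_dist_le _ z _ _ hz (by linarith)))
    simpa using this
  refine ⟨χ, h1, h2, ?_, ?_, ?_⟩
  · refine (closure_minimal ?_ isClosed_cthickening).trans hδU
    intro x hx
    by_contra hc
    exact hx (hz x hc)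
  · intro X hX
    have := h3 X 1 0 (fun Y hY => by
      rw [hg, indicator_of_mem]
      · simp
      · rw [mem_thickening_iff]
        rw [mem_ball] at hY
        exact ⟨X, hX, by linarith⟩)
    have h := abs_nonpos_iff.1 this
    linarith
  · intro X
    have := abs_le.1 (h3 X (1 / 2) (1 / 2) (fun Y _ => hg1 Y))
    constructor <;> linarith

theorem inner_grad' {n : ℕ} (u ψ : EuclideanSpace ℝ (Fin n) → ℝ) (x : EuclideanSpace ℝ (Fin n)) :
    ⟪gradient u x, gradient ψ x⟫ = fderiv ℝ ψ x (gradient u x) := by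
  rw [real_inner_comm, inner_gradient_left]

theorem measurable_grad {n : ℕ} (u : EuclideanSpace ℝ (Fin n) → ℝ) : Measurable (gradient u) := by
  have : gradient u = fun x => (InnerProductSpace.toDual ℝ (EuclideanSpace ℝ (Fin n))).symm
    (fderiv ℝ u x) := rfl
  rw [this]
  exact ((InnerProductSpace.toDual ℝ (EuclideanSpace ℝ (Fin n))).symm.continuous.measurable).comp
    (measurable_fderiv ℝ u)

theorem abs_inner_grad {n : ℕ} (u ψ : EuclideanSpace ℝ (Fin n) → ℝ) (x : EuclideanSpace ℝ (Fin n)) :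
    |⟪gradient u x, gradient ψ x⟫| ≤ ‖fderiv ℝ u x‖ * ‖fderiv ℝ ψ x‖ := by
  rw [← norm_grad, ← norm_grad]
  exact abs_real_inner_le_norm _ _

theorem int_inner {n : ℕ} {u ψ : EuclideanSpace ℝ (Fin n) → ℝ} {s : Set (EuclideanSpace ℝ (Fin n))}
    (h1 : IntegrableOn (fun x => ‖fderiv ℝ u x‖ ^ 2) s)
    (h2 : IntegrableOn (fun x => ‖fderiv ℝ ψ x‖ ^ 2) s) :
    IntegrableOn (fun x => ⟪gradient u x, gradient ψ x⟫) s := by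
  refine (h1.add h2).mono' ((measurable_grad u).inner (measurable_grad ψ)).aestronglyMeasurable
    (ae_of_all _ fun x => ?_)
  refine (abs_inner_grad u ψ x).trans ?_
  simp only [Pi.add_apply]
  nlinarith [sq_nonneg (‖fderiv ℝ u x‖ - ‖fderiv ℝ ψ x‖), norm_nonneg (fderiv ℝ u x),
    norm_nonneg (fderiv ℝ ψ x)]

theorem exists_compact_small {n : ℕ} {u : EuclideanSpace ℝ (Fin n) → ℝ}
    {U : Set (EuclideanSpace ℝ (Fin n))} (hU : IsOpen U)
    (h : IntegrableOn (fun x => ‖fderiv ℝ u x‖ ^ 2) U) {κ : ℝ} (hκ : 0 < κ) :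
    ∃ K ⊆ U, IsCompact K ∧ ∫ x in U \ K, ‖fderiv ℝ u x‖ ^ 2 ≤ κ := by
  set ν := (volume.restrict U).withDensity (fun x => ENNReal.ofReal (‖fderiv ℝ u x‖ ^ 2)) with hν
  have : IsFiniteMeasure ν := isFiniteMeasure_withDensity_ofReal h.2
  obtain ⟨K, hKU, hK, hlt⟩ := hU.measurableSet.exists_isCompact_sdiff_lt (μ := ν)
    (measure_ne_top _ _) (ε := ENNReal.ofReal κ) (by simpa using hκ)
  refine ⟨K, hKU, hK, ?_⟩
  have hm : MeasurableSet (U \ K) := hU.measurableSet.diff hK.measurableSet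
  rw [hν, withDensity_apply _ hm, Measure.restrict_restrict hm,
    inter_eq_left.2 sdiff_subset, ← ofReal_int_sq (h.mono_set sdiff_subset)] at hlt
  exact ((ENNReal.ofReal_lt_ofReal_iff hκ).1 hlt).le

theorem flux_fderiv_zero {n : ℕ} {u : EuclideanSpace ℝ (Fin n) → ℝ}
    (h1 : ∀ X ∈ closedBall (0 : EuclideanSpace ℝ (Fin n)) 1, u X = 1) :
    ∀ᵐ x, x ∈ closedBall (0 : EuclideanSpace ℝ (Fin n)) 1 → fderiv ℝ u x = 0 := by
  have h0 : volume (sphere (0 : EuclideanSpace ℝ (Fin n)) 1) = 0 :=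
    Measure.addHaar_sphere_of_ne_zero _ _ one_ne_zero
  filter_upwards [compl_mem_ae_iff.2 h0] with x hx hxb
  have hxb' : x ∈ ball (0 : EuclideanSpace ℝ (Fin n)) 1 := by
    rw [mem_ball]; exact lt_of_le_of_ne hxb (fun h => hx h)
  have : u =ᶠ[𝓝 x] fun _ => (1 : ℝ) :=
    Filter.eventually_of_mem (isOpen_ball.mem_nhds hxb') fun y hy => h1 y (ball_subset_closedBall hy)
  rw [this.fderiv_eq]; simp

theorem flux_int2 {n : ℕ} {u : EuclideanSpace ℝ (Fin n) → ℝ} {Ω : Set (EuclideanSpace ℝ (Fin n))}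
    {σ : Measure (EuclideanSpace ℝ (Fin n))} {a : ℝ} (hu : IsFluxSolution Ω σ a u) :
    IntegrableOn (fun x => ‖fderiv ℝ u x‖ ^ 2) Ω := by
  have h1 := hu.grad_L2
  simp_rw [norm_grad] at h1
  have h2 : IntegrableOn (fun x => ‖fderiv ℝ u x‖ ^ 2)
      (closedBall (0 : EuclideanSpace ℝ (Fin n)) 1) := by
    have : IntegrableOn (fun _ => (0 : ℝ)) (closedBall (0 : EuclideanSpace ℝ (Fin n)) 1) :=
      integrableOn_zero
    refine this.congr ?_
    rw [Filter.EventuallyEq, ae_restrict_iff' measurableSet_closedBall]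
    filter_upwards [flux_fderiv_zero hu.one_on_ball] with x hx hxb
    rw [hx hxb]; simp
  exact (h1.union h2).mono_set fun x hx => by
    by_cases h : x ∈ closedBall (0 : EuclideanSpace ℝ (Fin n)) 1
    · exact Or.inr h
    · exact Or.inl ⟨hx, h⟩

theorem mixed_finite {n : ℕ} {M Cσ d cd : ℝ} {Ω : Set (EuclideanSpace ℝ (Fin n))}
    {σ : Measure (EuclideanSpace ℝ (Fin n))} (h : IsMixedPair M Cσ d cd Ω σ) :
    IsFiniteMeasure σ := by
  refine ⟨?_⟩
  rw [← union_compl_self (frontier Ω)]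
  refine (measure_union_le _ _).trans_lt ?_
  rw [h.null_outside, add_zero]
  exact lt_top_iff_ne_top.2 h.finite

theorem cont_int {n : ℕ} {Ω : Set (EuclideanSpace ℝ (Fin n))} (hb : Bornology.IsBounded Ω)
    (σ : Measure (EuclideanSpace ℝ (Fin n))) [IsFiniteMeasure σ] {f : EuclideanSpace ℝ (Fin n) → ℝ}
    (hf : ContinuousOn f (closure Ω)) : IntegrableOn f (frontier Ω) σ :=
  ((hf.integrableOn_compact hb.isCompact_closure).mono_set frontier_subset_closure)

theorem approx_unif {n : ℕ} {M : ℝ} {Ω : Set (EuclideanSpace ℝ (Fin n))}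
    (hΩ : IsOneSidedNTA M Ω) (hb : Bornology.IsBounded Ω) (hne : (frontier Ω).Nonempty)
    (hdiam : 0 < diam Ω) (h4 : ball 0 4 ⊆ Ω) :
    ∃ C : ℝ, 0 ≤ C ∧ ∀ w : EuclideanSpace ℝ (Fin n) → ℝ, GoodFn Ω w →
      ∀ R : ℝ, 1 < R → R ≤ 4 → (∀ x ∈ ball 0 R, w x = 0) → ∀ τ : ℝ, 0 < τ →
      ∃ φ : EuclideanSpace ℝ (Fin n) → ℝ,
        ContDiff ℝ (⊤ : ℕ∞) φ ∧ HasCompactSupport φ ∧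
        tsupport φ ⊆ (closedBall (0 : EuclideanSpace ℝ (Fin n)) 1)ᶜ ∧
        (∀ X ∈ closure Ω, |φ X - w X| ≤ τ) ∧
        ∫ x in Ω, ‖fderiv ℝ φ x‖ ^ 2 ≤ C * ∫ x in Ω, ‖fderiv ℝ w x‖ ^ 2 := by
  obtain ⟨C, ε₀, hC, hε₀, H⟩ := approx_scale hΩ hb hne hdiam
  refine ⟨C, hC, ?_⟩
  intro w hw R hR hR4 hw0 τ hτ
  have huc := hb.isCompact_closure.uniformContinuousOn_of_continuous hw.cont
  rw [Metric.uniformContinuousOn_iff] at huc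
  obtain ⟨δ, hδ, hδw⟩ := huc τ hτ
  set ε := min (ε₀ / 2) (min (δ / 6) ((R - 1) / 12)) with hε
  have e1 : ε ≤ ε₀ / 2 := min_le_left _ _
  have e2 : ε ≤ δ / 6 := (min_le_right _ _).trans (min_le_left _ _)
  have e3 : ε ≤ (R - 1) / 12 := (min_le_right _ _).trans (min_le_right _ _)
  have e0 : 0 < ε := lt_min (by positivity) (lt_min (by positivity) (by linarith))
  obtain ⟨φ, h1, h2, h3, h5⟩ := H w hw ε e0 (by linarith)
  refine ⟨φ, h1, h2, ?_, ?_, h5⟩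
  · have hz : ∀ X ∈ ball (0 : EuclideanSpace ℝ (Fin n)) ((1 + R) / 2), φ X = 0 := by
      intro X hX
      have := h3 X (subset_closure (h4 (ball_subset_ball (by linarith) hX))) 0 0 (by
        rintro z ⟨-, hz⟩
        rw [hw0 z, sub_zero, abs_zero]
        rw [mem_ball] at hz hX ⊢
        have := dist_triangle z X 0
        linarith)
      simpa using this
    have : tsupport φ ⊆ (ball (0 : EuclideanSpace ℝ (Fin n)) ((1 + R) / 2))ᶜ :=
      closure_minimal (fun x hx hxb => hx (hz x hxb)) isOpen_ball.isClosed_compl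
    refine this.trans (compl_subset_compl.2 (closedBall_subset_ball (by linarith)))
  · intro X hX
    refine h3 X hX (w X) τ ?_
    rintro z ⟨hz, hzX⟩
    rw [mem_ball] at hzX
    have := hδw z (subset_closure hz) X hX (by linarith)
    rw [Real.dist_eq] at this
    exact this.le

set_option maxHeartbeats 1000000 in
theorem weak_good {n : ℕ} {M : ℝ} {Ω : Set (EuclideanSpace ℝ (Fin n))}
    (hΩ : IsOneSidedNTA M Ω) (hb : Bornology.IsBounded Ω) (hne : (frontier Ω).Nonempty)
    (hdiam : 0 < diam Ω) (h4 : ball 0 4 ⊆ Ω) (σ : Measure (EuclideanSpace ℝ (Fin n)))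
    [IsFiniteMeasure σ] {a : ℝ} {u : EuclideanSpace ℝ (Fin n) → ℝ} (hu : IsFluxSolution Ω σ a u)
    {w : EuclideanSpace ℝ (Fin n) → ℝ} (hw : GoodFn Ω w) {R : ℝ} (hR : 1 < R) (hR4 : R ≤ 4)
    (hw0 : ∀ x ∈ ball 0 R, w x = 0) :
    (∫ X in Ω, ⟪gradient u X, gradient w X⟫) + a * ∫ P in frontier Ω, u P * w P ∂σ = 0 := by
  obtain ⟨C, hC, H⟩ := approx_unif hΩ hb hne hdiam h4
  set N := ∫ x in Ω, ‖fderiv ℝ w x‖ ^ 2 with hN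
  have hN0 : 0 ≤ N := integral_nonneg fun _ => by positivity
  have hui := flux_int2 hu
  set U := Ω \ closedBall (0 : EuclideanSpace ℝ (Fin n)) 1 with hU
  have hUo : IsOpen U := hΩ.isOpen.sdiff isClosed_closedBall
  have hΩm := hΩ.isOpen.measurableSet
  have hUΩ : U ⊆ Ω := sdiff_subset
  set S := (∫ X in Ω, ⟪gradient u X, gradient w X⟫) + a * ∫ P in frontier Ω, u P * w P ∂σ with hS
  set c1 := 1 / 2 + (C + 1) * N + 1 with hc1
  have hc10 : 0 < c1 := by positivity
  suffices h : ∀ κ : ℝ, 0 < κ → |S| ≤ κ * c1 by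
    by_contra hne
    have hp : 0 < |S| := abs_pos.2 hne
    have := h (|S| / (2 * c1)) (by positivity)
    have e : |S| / (2 * c1) * c1 = |S| / 2 := by field_simp
    linarith
  intro κ hκ
  obtain ⟨K, hKU, hK, hKs⟩ := exists_compact_small hUo (hui.mono_set hUΩ) (κ := κ ^ 2) (by positivity)
  obtain ⟨χ, hχs, hχc, hχU, hχ1, hχ01⟩ := smooth_cutoff hK hUo hKU
  have hχi : IntegrableOn (fun x => ‖fderiv ℝ χ x‖ ^ 2) Ω := smooth_int2 hχs hχc
  set T := (∫ x in Ω, |⟪gradient u x, gradient χ x⟫|) + |a| * ∫ P in frontier Ω, |u P| ∂σ with hT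
  have hT0 : 0 ≤ T := add_nonneg (integral_nonneg fun _ => abs_nonneg _)
    (mul_nonneg (abs_nonneg _) (integral_nonneg fun _ => abs_nonneg _))
  set τ := κ / (T + 1) with hτ
  have hτ0 : 0 < τ := by positivity
  have hτT : τ * T ≤ κ := by
    rw [hτ, div_mul_eq_mul_div, div_le_iff₀ (by positivity)]; nlinarith
  obtain ⟨φ, hφs, hφc, hφt, hφw, hφN⟩ := H w hw R hR hR4 hw0 τ hτ0
  have hweak := hu.weak φ hφs hφc hφt
  have hφi : IntegrableOn (fun x => ‖fderiv ℝ φ x‖ ^ 2) Ω := smooth_int2 hφs hφc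
  have hq1 := int_inner hui hφi
  have hq2 := int_inner hui hw.int2
  have hqχ := int_inner hui hχi
  have hwd : ∀ x ∈ Ω, DifferentiableAt ℝ w x := fun x hx =>
    (hw.cd.contDiffAt (hΩ.isOpen.mem_nhds hx)).differentiableAt (by norm_num)
  have hφd : Differentiable ℝ φ := hφs.differentiable (by simp)
  have hχd : Differentiable ℝ χ := hχs.differentiable (by simp)
  -- the localized test function
  set ψ : EuclideanSpace ℝ (Fin n) → ℝ := fun x => χ x * (φ x - w x) with hψ
  have hψ0 : ∀ x ∉ tsupport χ, ψ x = 0 := fun x hx => by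
    simp only [hψ]; rw [image_eq_zero_of_notMem_tsupport hx, zero_mul]
  have hψt : tsupport ψ ⊆ tsupport χ :=
    closure_minimal (fun x hx => by by_contra h; exact hx (hψ0 x h)) isClosed_closure
  have hψs : ContDiff ℝ 1 ψ := by
    rw [contDiff_iff_contDiffAt]
    intro x
    by_cases hx : x ∈ tsupport χ
    · exact (hχs.contDiffAt.of_le (by norm_cast)).mul
        ((hφs.contDiffAt.of_le (by norm_cast)).sub
        (hw.cd.contDiffAt (hΩ.isOpen.mem_nhds (hUΩ (hχU hx)))))
    · have : ψ =ᶠ[𝓝 x] fun _ => 0 :=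
        Filter.eventually_of_mem (isClosed_closure.isOpen_compl.mem_nhds hx) hψ0
      exact contDiffAt_const.congr_of_eventuallyEq this
  have hψc : HasCompactSupport ψ := HasCompactSupport.intro hχc hψ0
  have hgreen := green0 hUo hu.harmonic hψs hψc (hψt.trans hχU)
  have hgreenΩ : ∫ x in Ω, ⟪gradient u x, gradient ψ x⟫ = 0 := by
    rw [setIntegral_eq_integral_of_forall_compl_eq_zero, hgreen]
    intro x hx
    have : fderiv ℝ ψ x = 0 := image_eq_zero_of_notMem_tsupport
      (fun h => hx (hUΩ (hχU (hψt (tsupport_fderiv_subset ℝ h)))))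
    rw [inner_grad', this]; simp
  have hprod : ∀ x ∈ Ω, ⟪gradient u x, gradient ψ x⟫ =
      χ x * (⟪gradient u x, gradient φ x⟫ - ⟪gradient u x, gradient w x⟫) +
        (φ x - w x) * ⟪gradient u x, gradient χ x⟫ := by
    intro x hx
    have hd := (hχd x).hasFDerivAt.mul ((hφd x).hasFDerivAt.sub (hwd x hx).hasFDerivAt)
    have hd' : fderiv ℝ ψ x = _ := hd.fderiv
    simp only [inner_grad', hd']
    simp
  -- integrability
  have hφwm : AEStronglyMeasurable (fun x => φ x - w x) (volume.restrict Ω) :=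
    (hφs.continuous.continuousOn.sub hw.cd.continuousOn).aestronglyMeasurable hΩm
  have hi1 : IntegrableOn (fun x => (φ x - w x) * ⟪gradient u x, gradient χ x⟫) Ω :=
    hqχ.bdd_mul hφwm (c := τ) ((ae_restrict_mem hΩm).mono fun x hx => hφw x (subset_closure hx))
  have hq : IntegrableOn (fun x => ⟪gradient u x, gradient φ x⟫ - ⟪gradient u x, gradient w x⟫) Ω :=
    hq1.sub hq2
  have hi2 : IntegrableOn (fun x => χ x * (⟪gradient u x, gradient φ x⟫ -
      ⟪gradient u x, gradient w x⟫)) Ω :=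
    hq.bdd_mul hχs.continuous.aestronglyMeasurable (c := 1) (ae_of_all _ fun x => by
      rw [Real.norm_eq_abs, abs_of_nonneg (hχ01 x).1]; exact (hχ01 x).2)
  have hi3 : IntegrableOn (fun x => (1 - χ x) * (⟪gradient u x, gradient φ x⟫ -
      ⟪gradient u x, gradient w x⟫)) Ω :=
    hq.bdd_mul (continuous_const.sub hχs.continuous).aestronglyMeasurable (c := 1)
      (ae_of_all _ fun x => by
        have := hχ01 x
        rw [Real.norm_eq_abs, abs_of_nonneg (by linarith)]; linarith)
  have hA : ∫ x in Ω, χ x * (⟪gradient u x, gradient φ x⟫ - ⟪gradient u x, gradient w x⟫) =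
      - ∫ x in Ω, (φ x - w x) * ⟪gradient u x, gradient χ x⟫ := by
    rw [setIntegral_congr_fun hΩm hprod, integral_add hi2 hi1] at hgreenΩ
    linarith
  have hA' : |∫ x in Ω, χ x * (⟪gradient u x, gradient φ x⟫ - ⟪gradient u x, gradient w x⟫)| ≤
      τ * ∫ x in Ω, |⟪gradient u x, gradient χ x⟫| := by
    rw [hA, abs_neg, ← integral_const_mul, ← Real.norm_eq_abs]
    refine norm_integral_le_of_norm_le (hqχ.abs.const_mul τ) ?_
    refine (ae_restrict_mem hΩm).mono fun x hx => ?_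
    rw [norm_mul, Real.norm_eq_abs, Real.norm_eq_abs]
    gcongr
    exact hφw x (subset_closure hx)
  have hB : |∫ x in Ω, (1 - χ x) * (⟪gradient u x, gradient φ x⟫ - ⟪gradient u x, gradient w x⟫)| ≤
      κ * (1 / 2 + (C + 1) * N) := by
    have hind : IntegrableOn ((U \ K).indicator (fun x => ‖fderiv ℝ u x‖ ^ 2)) Ω :=
      hui.indicator (hUo.measurableSet.diff hK.measurableSet)
    rw [← Real.norm_eq_abs]
    calc ‖∫ x in Ω, (1 - χ x) * (⟪gradient u x, gradient φ x⟫ - ⟪gradient u x, gradient w x⟫)‖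
        ≤ ∫ x in Ω, (1 / (2 * κ) * (U \ K).indicator (fun x => ‖fderiv ℝ u x‖ ^ 2) x +
            κ * (‖fderiv ℝ φ x‖ ^ 2 + ‖fderiv ℝ w x‖ ^ 2)) := by
          refine norm_integral_le_of_norm_le
            ((hind.const_mul _).add ((hφi.add hw.int2).const_mul κ)) ?_
          filter_upwards [ae_restrict_mem hΩm, ae_restrict_of_ae (flux_fderiv_zero hu.one_on_ball)]
            with x hx hx0
          rw [Real.norm_eq_abs, abs_mul]
          have hχx := hχ01 x
          by_cases hxU : x ∈ U \ K
          · rw [indicator_of_mem hxU]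
            have i1 := abs_inner_grad u φ x
            have i2 := abs_inner_grad u w x
            have i3 : |⟪gradient u x, gradient φ x⟫ - ⟪gradient u x, gradient w x⟫| ≤
              ‖fderiv ℝ u x‖ * (‖fderiv ℝ φ x‖ + ‖fderiv ℝ w x‖) := by
              refine (abs_sub _ _).trans ?_
              linarith
            set p := ‖fderiv ℝ u x‖
            set q := ‖fderiv ℝ φ x‖
            set s := ‖fderiv ℝ w x‖
            calc |1 - χ x| * |⟪gradient u x, gradient φ x⟫ - ⟪gradient u x, gradient w x⟫|
                ≤ 1 * (p * (q + s)) := by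
                  gcongr
                  rw [abs_of_nonneg (by linarith)]; linarith
              _ ≤ 1 / (2 * κ) * p ^ 2 + κ * (q ^ 2 + s ^ 2) := by
                  have e : 1 / (2 * κ) * p ^ 2 + κ * (q ^ 2 + s ^ 2) - 1 * (p * (q + s)) =
                    1 / (2 * κ) * (p - κ * (q + s)) ^ 2 + κ / 2 * (q - s) ^ 2 := by
                    field_simp; ring
                  have : 0 ≤ 1 / (2 * κ) * (p - κ * (q + s)) ^ 2 + κ / 2 * (q - s) ^ 2 := by positivity
                  linarith
          · rw [indicator_of_notMem hxU, mul_zero, zero_add]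
            have hz : |1 - χ x| * |⟪gradient u x, gradient φ x⟫ - ⟪gradient u x, gradient w x⟫| = 0 := by
              by_cases hxK : x ∈ K
              · rw [hχ1 x hxK]; simp
              · have hxb : x ∈ closedBall (0 : EuclideanSpace ℝ (Fin n)) 1 := by
                  by_contra hc; exact hxU ⟨⟨hx, hc⟩, hxK⟩
                have : gradient u x = 0 := by
                  rw [← norm_eq_zero, norm_grad, hx0 hxb, norm_zero]
                rw [this]; simp
            rw [hz]; positivity
      _ = 1 / (2 * κ) * (∫ x in U \ K, ‖fderiv ℝ u x‖ ^ 2) +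
            κ * ((∫ x in Ω, ‖fderiv ℝ φ x‖ ^ 2) + N) := by
          have hsum : IntegrableOn (fun x => ‖fderiv ℝ φ x‖ ^ 2 + ‖fderiv ℝ w x‖ ^ 2) Ω :=
            hφi.add hw.int2
          have g1 : IntegrableOn (fun x => 1 / (2 * κ) *
            (U \ K).indicator (fun x => ‖fderiv ℝ u x‖ ^ 2) x) Ω := hind.const_mul _
          have g2 : IntegrableOn (fun x => κ * (‖fderiv ℝ φ x‖ ^ 2 + ‖fderiv ℝ w x‖ ^ 2)) Ω :=
            hsum.const_mul κ
          rw [integral_add g1 g2, integral_const_mul,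
            integral_const_mul, integral_add hφi hw.int2,
            integral_indicator (hUo.measurableSet.diff hK.measurableSet),
            Measure.restrict_restrict (hUo.measurableSet.diff hK.measurableSet),
            inter_eq_left.2 (sdiff_subset.trans hUΩ)]
      _ ≤ 1 / (2 * κ) * κ ^ 2 + κ * (C * N + N) := by gcongr
      _ = κ * (1 / 2 + (C + 1) * N) := by field_simp
  have hAB : (∫ x in Ω, ⟪gradient u x, gradient φ x⟫) - ∫ x in Ω, ⟪gradient u x, gradient w x⟫ =
      (∫ x in Ω, χ x * (⟪gradient u x, gradient φ x⟫ - ⟪gradient u x, gradient w x⟫)) +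
      ∫ x in Ω, (1 - χ x) * (⟪gradient u x, gradient φ x⟫ - ⟪gradient u x, gradient w x⟫) := by
    rw [← integral_sub hq1 hq2, ← integral_add hi2 hi3]
    congr 1; ext x; ring
  have hcu := hu.contOn
  have hbd : |(∫ P in frontier Ω, u P * φ P ∂σ) - ∫ P in frontier Ω, u P * w P ∂σ| ≤
      τ * ∫ P in frontier Ω, |u P| ∂σ := by
    have j1 : IntegrableOn (fun P => u P * φ P) (frontier Ω) σ := cont_int hb σ (hcu.mul hφs.continuous.continuousOn)
    have j2 : IntegrableOn (fun P => u P * w P) (frontier Ω) σ := cont_int hb σ (hcu.mul hw.cont)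
    have j3 := cont_int hb σ hcu
    rw [← integral_sub j1 j2, ← integral_const_mul, ← Real.norm_eq_abs]
    refine norm_integral_le_of_norm_le (j3.abs.const_mul τ) ?_
    refine (ae_restrict_mem isClosed_frontier.measurableSet).mono fun x hx => ?_
    rw [← mul_sub, norm_mul, Real.norm_eq_abs, Real.norm_eq_abs, mul_comm]
    gcongr
    exact hφw x (frontier_subset_closure hx)
  have hSe : S = -((∫ x in Ω, ⟪gradient u x, gradient φ x⟫) - ∫ x in Ω, ⟪gradient u x, gradient w x⟫)
      - a * ((∫ P in frontier Ω, u P * φ P ∂σ) - ∫ P in frontier Ω, u P * w P ∂σ) := by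
    rw [hS]; linarith
  rw [hSe, hAB]
  set I1 := ∫ x in Ω, χ x * (⟪gradient u x, gradient φ x⟫ - ⟪gradient u x, gradient w x⟫)
  set I2 := ∫ x in Ω, (1 - χ x) * (⟪gradient u x, gradient φ x⟫ - ⟪gradient u x, gradient w x⟫)
  set I3 := (∫ P in frontier Ω, u P * φ P ∂σ) - ∫ P in frontier Ω, u P * w P ∂σ
  have f1 : |a * I3| ≤ |a| * (τ * ∫ P in frontier Ω, |u P| ∂σ) := by
    rw [abs_mul]; gcongr
  have f2 : |-(I1 + I2) - a * I3| ≤ |I1| + |I2| + |a * I3| := by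
    refine (abs_sub _ _).trans ?_
    rw [abs_neg]
    linarith [abs_add_le I1 I2]
  have f3 : τ * T = (τ * ∫ x in Ω, |⟪gradient u x, gradient χ x⟫|) +
    |a| * (τ * ∫ P in frontier Ω, |u P| ∂σ) := by rw [hT]; ring
  rw [hc1]
  linarith

noncomputable section

def tk (η t : ℝ) : ℝ := min 1 (max 0 (|t| / η - 1))
def tF (η s : ℝ) : ℝ := ∫ t in (0:ℝ)..s, tk η t

theorem tk_cont (η : ℝ) : Continuous (tk η) := by unfold tk; fun_prop
theorem tk_nonneg (η t : ℝ) : 0 ≤ tk η t := le_min zero_le_one (le_max_left _ _)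
theorem tk_le (η t : ℝ) : tk η t ≤ 1 := min_le_left _ _
theorem tk_small {η t : ℝ} (hη : 0 < η) (h : |t| ≤ η) : tk η t = 0 := by
  unfold tk
  have : |t| / η - 1 ≤ 0 := by rw [sub_nonpos, div_le_one hη]; exact h
  rw [max_eq_left this]; simp
theorem tk_big {η t : ℝ} (hη : 0 < η) (h : 2 * η ≤ |t|) : tk η t = 1 := by
  unfold tk
  have : 1 ≤ |t| / η - 1 := by
    have : 2 ≤ |t| / η := by rw [le_div_iff₀ hη]; exact h
    linarith
  rw [max_eq_right (by linarith), min_eq_left this]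

theorem tF_deriv (η s : ℝ) : HasDerivAt (tF η) (tk η s) s :=
  intervalIntegral.integral_hasDerivAt_right ((tk_cont η).intervalIntegrable _ _)
    ((tk_cont η).stronglyMeasurableAtFilter _ _) (tk_cont η).continuousAt

theorem tF_zero {η s : ℝ} (hη : 0 < η) (h : |s| ≤ η) : tF η s = 0 := by
  unfold tF
  rw [intervalIntegral.integral_congr (g := fun _ => (0:ℝ))]
  · simp
  · intro t ht
    refine tk_small hη (le_trans ?_ h)
    simpa using abs_sub_left_of_mem_uIcc ht

theorem tF_close_pos {η s : ℝ} (hη : 0 < η) (hs : 0 ≤ s) : |tF η s - s| ≤ 2 * η := by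
  have hi : ∀ a b : ℝ, IntervalIntegrable (fun t => tk η t - 1) volume a b := fun a b =>
    ((tk_cont η).sub continuous_const).intervalIntegrable _ _
  have e : tF η s - s = ∫ t in (0:ℝ)..s, (tk η t - 1) := by
    rw [intervalIntegral.integral_sub ((tk_cont η).intervalIntegrable _ _) (by simp)]
    simp [tF]
  have hb : ∀ t, ‖tk η t - 1‖ ≤ 1 := fun t => by
    rw [Real.norm_eq_abs, abs_le]; constructor <;> linarith [tk_nonneg η t, tk_le η t]
  rw [e]
  rcases le_total s (2 * η) with h | h
  · have := intervalIntegral.norm_integral_le_of_norm_le_const (a := 0) (b := s)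
      (f := fun t => tk η t - 1) (C := 1) fun t _ => hb t
    rw [Real.norm_eq_abs, sub_zero, abs_of_nonneg hs] at this
    linarith
  · rw [← intervalIntegral.integral_add_adjacent_intervals (hi 0 (2 * η)) (hi (2 * η) s)]
    have h0 : ∫ t in (2 * η)..s, (tk η t - 1) = 0 := by
      rw [intervalIntegral.integral_congr (g := fun _ => (0:ℝ))]
      · simp
      · intro t ht
        rw [uIcc_of_le h] at ht
        have : tk η t = 1 := tk_big hη (ht.1.trans (le_abs_self t))
        simp [this]
    rw [h0, add_zero]
    have := intervalIntegral.norm_integral_le_of_norm_le_const (a := 0) (b := 2 * η)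
      (f := fun t => tk η t - 1) (C := 1) fun t _ => hb t
    rw [Real.norm_eq_abs, sub_zero, abs_of_nonneg (show (0:ℝ) ≤ 2 * η by positivity)] at this
    linarith

theorem tF_neg (η s : ℝ) : tF η (-s) = - tF η s := by
  unfold tF
  have h := intervalIntegral.integral_comp_neg (a := 0) (b := s) (fun t => tk η t)
  have h2 : ∀ t, tk η (-t) = tk η t := fun t => by simp [tk]
  simp only [h2, neg_zero] at h
  rw [h, intervalIntegral.integral_symm]

theorem tF_close {η : ℝ} (s : ℝ) (hη : 0 < η) : |tF η s - s| ≤ 2 * η := by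
  rcases le_total 0 s with h | h
  · exact tF_close_pos hη h
  · have := tF_close_pos hη (neg_nonneg.2 h)
    rw [tF_neg] at this
    rw [← abs_neg]; convert this using 2; ring

theorem tF_contDiff (η : ℝ) : ContDiff ℝ 1 (tF η) := by
  rw [contDiff_one_iff_deriv]
  refine ⟨fun s => (tF_deriv η s).differentiableAt, ?_⟩
  have : deriv (tF η) = tk η := funext fun s => (tF_deriv η s).deriv
  rw [this]; exact tk_cont η

theorem trunc {n : ℕ} {Ω : Set (EuclideanSpace ℝ (Fin n))} (hΩ : IsOpen Ω)
    (h4 : ball 0 4 ⊆ Ω) {σ : Measure (EuclideanSpace ℝ (Fin n))}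
    {a : ℝ} {u : EuclideanSpace ℝ (Fin n) → ℝ} (hu : IsFluxSolution Ω σ a u) {η : ℝ} (hη : 0 < η) :
    GoodFn Ω (fun x => tF η (1 - u x)) ∧
    (∃ R, 1 < R ∧ R ≤ 4 ∧ ∀ x ∈ ball (0 : EuclideanSpace ℝ (Fin n)) R, tF η (1 - u x) = 0) ∧
    (∀ x ∈ Ω \ closedBall 0 1, fderiv ℝ (fun x => tF η (1 - u x)) x =
      (-(tk η (1 - u x))) • fderiv ℝ u x) ∧
    (∀ x ∈ closedBall (0 : EuclideanSpace ℝ (Fin n)) 1,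
      fderiv ℝ (fun x => tF η (1 - u x)) x = 0) := by
  have hcont4 : ContinuousOn u (ball 0 4) := hu.contOn.mono (h4.trans subset_closure)
  have hopen : IsOpen (ball (0 : EuclideanSpace ℝ (Fin n)) 4 ∩ u ⁻¹' {s | |1 - s| < η}) :=
    hcont4.isOpen_inter_preimage isOpen_ball (isOpen_lt (by fun_prop) continuous_const)
  have hR : ∃ R, 1 < R ∧ R ≤ 4 ∧
      ∀ x ∈ ball (0 : EuclideanSpace ℝ (Fin n)) R, tF η (1 - u x) = 0 := by
    obtain ⟨δ, hδ, hsub⟩ := (isCompact_closedBall (0 : EuclideanSpace ℝ (Fin n)) 1).exists_thickening_subset_open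
      hopen (fun x hx => ⟨closedBall_subset_ball (by norm_num) hx, by
        simp [hu.one_on_ball x hx, hη]⟩)
    rw [thickening_closedBall hδ (by norm_num)] at hsub
    refine ⟨min (δ + 1) 4, lt_min (by linarith) (by norm_num), min_le_right _ _, fun x hx => ?_⟩
    exact tF_zero hη (hsub (ball_subset_ball (min_le_left _ _) hx)).2.le
  have hU : ∀ x ∈ Ω \ closedBall (0 : EuclideanSpace ℝ (Fin n)) 1, ContDiffAt ℝ 1 u x := fun x hx =>
    (hu.harmonic x hx).1.of_le (by norm_num)
  have hd1 : ∀ x ∈ Ω \ closedBall (0 : EuclideanSpace ℝ (Fin n)) 1,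
      fderiv ℝ (fun x => tF η (1 - u x)) x = (-(tk η (1 - u x))) • fderiv ℝ u x := by
    intro x hx
    have h1 := ((hU x hx).differentiableAt (by norm_num)).hasFDerivAt
    have h2 := (tF_deriv η (1 - u x)).comp_hasFDerivAt x (h1.const_sub 1)
    have h3 := h2.fderiv
    simp only [Function.comp_def] at h3
    rw [h3]; simp
  obtain ⟨R, hR1, hR4, hR0⟩ := hR
  have hd2 : ∀ x ∈ closedBall (0 : EuclideanSpace ℝ (Fin n)) 1,
      fderiv ℝ (fun x => tF η (1 - u x)) x = 0 := by
    intro x hx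
    have : (fun x => tF η (1 - u x)) =ᶠ[𝓝 x] fun _ => (0 : ℝ) :=
      Filter.eventually_of_mem (isOpen_ball.mem_nhds (closedBall_subset_ball hR1 hx)) hR0
    rw [this.fderiv_eq]; simp
  refine ⟨⟨?_, ?_, ?_⟩, ⟨R, hR1, hR4, hR0⟩, hd1, hd2⟩
  · intro x hx
    by_cases hb : x ∈ closedBall (0 : EuclideanSpace ℝ (Fin n)) 1
    · have : (fun x => tF η (1 - u x)) =ᶠ[𝓝 x] fun _ => (0 : ℝ) :=
        Filter.eventually_of_mem (isOpen_ball.mem_nhds (closedBall_subset_ball hR1 hb)) hR0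
      exact (contDiffAt_const.congr_of_eventuallyEq this).contDiffWithinAt
    · exact ((tF_contDiff η).contDiffAt.comp x (contDiffAt_const.sub (hU x ⟨hx, hb⟩))).contDiffWithinAt
  · exact (tF_contDiff η).continuous.comp_continuousOn (continuousOn_const.sub hu.contOn)
  · refine Integrable.mono (flux_int2 hu) ((measurable_fderiv ℝ _).norm.pow_const 2).aestronglyMeasurable ?_
    refine (ae_restrict_mem hΩ.measurableSet).mono fun x hx => ?_
    rw [norm_pow, norm_norm, norm_pow, norm_norm]
    gcongr
    by_cases hb : x ∈ closedBall (0 : EuclideanSpace ℝ (Fin n)) 1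
    · rw [hd2 x hb, norm_zero]; positivity
    · rw [hd1 x ⟨hx, hb⟩, norm_smul, norm_neg, Real.norm_eq_abs, abs_of_nonneg (tk_nonneg _ _)]
      exact mul_le_of_le_one_left (norm_nonneg _) (tk_le _ _)

theorem trunc_le {n : ℕ} {Ω : Set (EuclideanSpace ℝ (Fin n))} (hΩ : IsOpen Ω)
    (h4 : ball 0 4 ⊆ Ω) {σ : Measure (EuclideanSpace ℝ (Fin n))}
    {a : ℝ} {u : EuclideanSpace ℝ (Fin n) → ℝ} (hu : IsFluxSolution Ω σ a u) {η : ℝ} (hη : 0 < η) :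
    ∫ x in Ω, ‖fderiv ℝ (fun x => tF η (1 - u x)) x‖ ^ 2 ≤ ∫ x in Ω, ‖fderiv ℝ u x‖ ^ 2 := by
  obtain ⟨hg, -, hd1, hd2⟩ := trunc hΩ h4 hu hη
  refine setIntegral_mono_on hg.int2 (flux_int2 hu) hΩ.measurableSet fun x hx => ?_
  gcongr
  by_cases hb : x ∈ closedBall (0 : EuclideanSpace ℝ (Fin n)) 1
  · rw [hd2 x hb, norm_zero]; positivity
  · rw [hd1 x ⟨hx, hb⟩, norm_smul, norm_neg, Real.norm_eq_abs, abs_of_nonneg (tk_nonneg _ _)]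
    exact mul_le_of_le_one_left (norm_nonneg _) (tk_le _ _)

theorem trunc_weak {n : ℕ} {M : ℝ} {Ω : Set (EuclideanSpace ℝ (Fin n))}
    (hΩ : IsOneSidedNTA M Ω) (hb : Bornology.IsBounded Ω) (hne : (frontier Ω).Nonempty)
    (hdiam : 0 < diam Ω) (h4 : ball 0 4 ⊆ Ω) (σ : Measure (EuclideanSpace ℝ (Fin n)))
    [IsFiniteMeasure σ] {a : ℝ} {u : EuclideanSpace ℝ (Fin n) → ℝ} (hu : IsFluxSolution Ω σ a u)
    {η : ℝ} (hη : 0 < η) :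
    ∫ x in Ω, tk η (1 - u x) * ‖fderiv ℝ u x‖ ^ 2 =
      a * ∫ P in frontier Ω, u P * tF η (1 - u P) ∂σ := by
  obtain ⟨hg, ⟨R, hR1, hR4, hR0⟩, hd1, hd2⟩ := trunc hΩ.isOpen h4 hu hη
  have h := weak_good hΩ hb hne hdiam h4 σ hu hg hR1 hR4 hR0
  have e : (∫ X in Ω, ⟪gradient u X, gradient (fun x => tF η (1 - u x)) X⟫) =
      - ∫ x in Ω, tk η (1 - u x) * ‖fderiv ℝ u x‖ ^ 2 := by
    rw [← integral_neg]
    refine integral_congr_ae ?_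
    filter_upwards [ae_restrict_mem hΩ.isOpen.measurableSet,
      ae_restrict_of_ae (flux_fderiv_zero hu.one_on_ball)] with x hx hx0
    by_cases hxb : x ∈ closedBall (0 : EuclideanSpace ℝ (Fin n)) 1
    · rw [inner_grad', hd2 x hxb, hx0 hxb]; simp
    · rw [inner_grad', hd1 x ⟨hx, hxb⟩]
      simp only [FunLike.coe_smul, Pi.smul_apply, smul_eq_mul]
      rw [← inner_grad', real_inner_self_eq_norm_sq, norm_grad]; ring
  rw [e] at h
  linarith

theorem energy {n : ℕ} (hn : 0 < n) {M : ℝ} {Ω : Set (EuclideanSpace ℝ (Fin n))}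
    (hΩ : IsOneSidedNTA M Ω) (hb : Bornology.IsBounded Ω) (hne : (frontier Ω).Nonempty)
    (hdiam : 0 < diam Ω) (h4 : ball 0 4 ⊆ Ω) (σ : Measure (EuclideanSpace ℝ (Fin n)))
    [IsFiniteMeasure σ] {a : ℝ} {u : EuclideanSpace ℝ (Fin n) → ℝ} (hu : IsFluxSolution Ω σ a u) :
    (∫ x in Ω, ‖fderiv ℝ u x‖ ^ 2) + a * ∫ P in frontier Ω, u P ^ 2 ∂σ =
      a * ∫ P in frontier Ω, u P ∂σ := by
  set e : ℕ → ℝ := fun m => 1 / ((m : ℝ) + 1) with he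
  have he0 : ∀ m, 0 < e m := fun m => by simp only [he]; positivity
  have het : Filter.Tendsto e Filter.atTop (𝓝 0) := tendsto_one_div_add_atTop_nhds_zero_nat
  have hUo : IsOpen (Ω \ closedBall (0 : EuclideanSpace ℝ (Fin n)) 1) :=
    hΩ.isOpen.sdiff isClosed_closedBall
  have hl := level_set hUo (u := u) (fun x hx => ((hu.harmonic x hx).1.of_le
    (by norm_num)).contDiffWithinAt) hn
  rw [ae_restrict_iff' hUo.measurableSet] at hl
  have huΩ : AEStronglyMeasurable u (volume.restrict Ω) :=
    (hu.contOn.mono subset_closure).aestronglyMeasurable hΩ.isOpen.measurableSet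
  have t1 : Filter.Tendsto (fun m => ∫ x in Ω, tk (e m) (1 - u x) * ‖fderiv ℝ u x‖ ^ 2)
      Filter.atTop (𝓝 (∫ x in Ω, ‖fderiv ℝ u x‖ ^ 2)) := by
    refine tendsto_integral_of_dominated_convergence (fun x => ‖fderiv ℝ u x‖ ^ 2) ?_
      (flux_int2 hu) ?_ ?_
    · intro m
      exact ((tk_cont (e m)).comp_aestronglyMeasurable (aestronglyMeasurable_const.sub huΩ)).mul
        ((measurable_fderiv ℝ u).norm.pow_const 2).aestronglyMeasurable
    · intro m
      refine Filter.Eventually.of_forall fun x => ?_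
      rw [norm_mul, Real.norm_eq_abs, abs_of_nonneg (tk_nonneg _ _), norm_pow, norm_norm]
      exact mul_le_of_le_one_left (by positivity) (tk_le _ _)
    · filter_upwards [ae_restrict_mem hΩ.isOpen.measurableSet,
        ae_restrict_of_ae (flux_fderiv_zero hu.one_on_ball), ae_restrict_of_ae hl] with x hx hx0 hx1
      by_cases h1 : u x = 1
      · have : fderiv ℝ u x = 0 := by
          by_cases hxb : x ∈ closedBall (0 : EuclideanSpace ℝ (Fin n)) 1
          · exact hx0 hxb
          · exact hx1 ⟨hx, hxb⟩ h1
        simp [this]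
      · have hp : 0 < |1 - u x| / 2 := by
          have : 1 - u x ≠ 0 := fun h => h1 (by linarith)
          positivity
        refine tendsto_const_nhds.congr' ?_
        filter_upwards [het.eventually (gt_mem_nhds hp)] with m hm
        rw [tk_big (he0 m) (by linarith), one_mul]
  have hc := hu.contOn
  have j1 : IntegrableOn (fun P => u P * (1 - u P)) (frontier Ω) σ :=
    cont_int hb σ (hc.mul (continuousOn_const.sub hc))
  have j2 : ∀ m, IntegrableOn (fun P => u P * tF (e m) (1 - u P)) (frontier Ω) σ := fun m =>
    cont_int hb σ (hc.mul ((tF_contDiff (e m)).continuous.comp_continuousOn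
      (continuousOn_const.sub hc)))
  have j3 : IntegrableOn u (frontier Ω) σ := cont_int hb σ hc
  have j4 : IntegrableOn (fun P => u P ^ 2) (frontier Ω) σ := cont_int hb σ (hc.pow 2)
  have t2 : Filter.Tendsto (fun m => ∫ P in frontier Ω, u P * tF (e m) (1 - u P) ∂σ)
      Filter.atTop (𝓝 (∫ P in frontier Ω, u P * (1 - u P) ∂σ)) := by
    rw [tendsto_iff_norm_sub_tendsto_zero]
    have t3 : Filter.Tendsto (fun m => (2 * e m) * ∫ P in frontier Ω, |u P| ∂σ)
      Filter.atTop (𝓝 0) := by simpa using (het.const_mul 2).mul_const _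
    refine squeeze_zero (fun _ => norm_nonneg _) (fun m => ?_) t3
    rw [← integral_sub (j2 m) j1, ← integral_const_mul]
    refine norm_integral_le_of_norm_le (j3.abs.const_mul _) (Filter.Eventually.of_forall fun x => ?_)
    rw [← mul_sub, norm_mul, Real.norm_eq_abs, Real.norm_eq_abs, mul_comm]
    gcongr
    exact tF_close _ (he0 m)
  have t4 := tendsto_nhds_unique t1 ((t2.const_mul a).congr fun m =>
    (trunc_weak hΩ hb hne hdiam h4 σ hu (he0 m)).symm)
  have e5 : ∫ P in frontier Ω, u P * (1 - u P) ∂σ =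
      (∫ P in frontier Ω, u P ∂σ) - ∫ P in frontier Ω, u P ^ 2 ∂σ := by
    rw [← integral_sub j3 j4]; congr 1; ext x; ring
  rw [t4, e5]; ring

end

theorem upper1 {n : ℕ} (hn : 0 < n) {M : ℝ} {Ω : Set (EuclideanSpace ℝ (Fin n))}
    (hΩ : IsOneSidedNTA M Ω) (hb : Bornology.IsBounded Ω) (hne : (frontier Ω).Nonempty)
    (hdiam : 0 < diam Ω) (h4 : ball 0 4 ⊆ Ω) (σ : Measure (EuclideanSpace ℝ (Fin n)))
    [IsFiniteMeasure σ] {a : ℝ} (ha : 0 < a) {u : EuclideanSpace ℝ (Fin n) → ℝ}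
    (hu : IsFluxSolution Ω σ a u) :
    a * ∫ P in frontier Ω, u P ∂σ ≤ a * σ.real (frontier Ω) := by
  have h := energy hn hΩ hb hne hdiam h4 σ hu
  have hE : 0 ≤ ∫ x in Ω, ‖fderiv ℝ u x‖ ^ 2 := integral_nonneg fun _ => by positivity
  have hc := hu.contOn
  have j3 : IntegrableOn u (frontier Ω) σ := cont_int hb σ hc
  have j4 : IntegrableOn (fun P => u P ^ 2) (frontier Ω) σ := cont_int hb σ (hc.pow 2)
  have j5 : IntegrableOn (fun _ => (1:ℝ)) (frontier Ω) σ := cont_int hb σ continuousOn_const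
  have j6 : IntegrableOn (fun P => 1 + u P ^ 2) (frontier Ω) σ := j5.add j4
  have k : ∫ P in frontier Ω, 2 * u P ∂σ ≤ ∫ P in frontier Ω, (1 + u P ^ 2) ∂σ := by
    refine integral_mono (j3.const_mul 2) j6 fun x => ?_
    show 2 * u x ≤ 1 + u x ^ 2
    nlinarith [sq_nonneg (u x - 1)]
  rw [integral_const_mul, integral_add j5 j4] at k
  simp only [integral_const, smul_eq_mul, mul_one, measureReal_restrict_apply_univ] at k
  nlinarith

theorem upper2 (n : ℕ) (hn : 0 < n) : ∃ C : ℝ, 0 ≤ C ∧ ∀ (M : ℝ) (Ω : Set (EuclideanSpace ℝ (Fin n))),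
    IsOneSidedNTA M Ω → Bornology.IsBounded Ω → (frontier Ω).Nonempty → 0 < diam Ω → ball 0 4 ⊆ Ω →
    ∀ (σ : Measure (EuclideanSpace ℝ (Fin n))) [IsFiniteMeasure σ], ∀ a : ℝ, 0 < a →
    ∀ u : EuclideanSpace ℝ (Fin n) → ℝ, IsFluxSolution Ω σ a u →
    a * ∫ P in frontier Ω, u P ∂σ ≤ C := by
  obtain ⟨χ, hs, hc, hts, h1, h01⟩ := smooth_cutoff
    (isCompact_closedBall (0 : EuclideanSpace ℝ (Fin n)) 2) (isOpen_ball (x := 0) (ε := 3))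
    (closedBall_subset_ball (by norm_num))
  have hint : Integrable (fun x => ‖fderiv ℝ χ x‖ ^ 2) := by
    have := smooth_int2 (Ω := univ) hs hc
    rwa [integrableOn_univ] at this
  refine ⟨∫ x, ‖fderiv ℝ χ x‖ ^ 2, integral_nonneg fun _ => by positivity, ?_⟩
  intro M Ω hΩ hb hne hdiam h4 σ _ a ha u hu
  have h := energy hn hΩ hb hne hdiam h4 σ hu
  obtain ⟨χ', hs', hc', -, h1', h01'⟩ := smooth_cutoff hb.isCompact_closure isOpen_univ (subset_univ _)
  have hw := hu.weak (fun x => χ' x - χ x) (hs'.sub hs) (hc'.sub hc) (by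
    have h0 : ∀ x ∈ ball (0 : EuclideanSpace ℝ (Fin n)) 2, χ' x - χ x = 0 := fun x hx => by
      rw [h1 x (ball_subset_closedBall hx), h1' x (subset_closure (h4 (ball_subset_ball (by norm_num) hx)))]
      simp
    have hts2 : tsupport (fun x => χ' x - χ x) ⊆ (ball 0 2)ᶜ :=
      closure_minimal (fun x hx hxb => hx (h0 x hxb)) isOpen_ball.isClosed_compl
    exact hts2.trans (compl_subset_compl.2 (closedBall_subset_ball (by norm_num))))
  have e1 : ∫ P in frontier Ω, u P * (χ' P - χ P) ∂σ = ∫ P in frontier Ω, u P ∂σ := by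
    refine setIntegral_congr_fun isClosed_frontier.measurableSet fun x hx => ?_
    have hx2 : χ x = 0 := image_eq_zero_of_notMem_tsupport fun hxt => by
      have hxΩ : x ∈ Ω := h4 (ball_subset_ball (by norm_num) (hts hxt))
      rw [hΩ.isOpen.frontier_eq] at hx
      exact hx.2 hxΩ
    show u x * (χ' x - χ x) = u x
    rw [hx2, h1' x (frontier_subset_closure hx)]; ring
  have e2 : ∫ X in Ω, ⟪gradient u X, gradient (fun x => χ' x - χ x) X⟫ =
      - ∫ X in Ω, ⟪gradient u X, gradient χ X⟫ := by
    rw [← integral_neg]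
    refine setIntegral_congr_fun hΩ.isOpen.measurableSet fun x hx => ?_
    have : (fun x => χ' x - χ x) =ᶠ[𝓝 x] fun x => 1 - χ x :=
      Filter.eventually_of_mem (hΩ.isOpen.mem_nhds hx) fun y hy => by
        show χ' y - χ y = 1 - χ y
        rw [h1' y (subset_closure hy)]
    show ⟪gradient u x, gradient (fun x => χ' x - χ x) x⟫ = - ⟪gradient u x, gradient χ x⟫
    rw [inner_grad', inner_grad', this.fderiv_eq, fderiv_const_sub]; simp
  rw [e1, e2] at hw
  have hui := flux_int2 hu
  have hχi : IntegrableOn (fun x => ‖fderiv ℝ χ x‖ ^ 2) Ω := hint.integrableOn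
  have hsum : IntegrableOn (fun x => ‖fderiv ℝ u x‖ ^ 2 + ‖fderiv ℝ χ x‖ ^ 2) Ω := hui.add hχi
  have k : ∫ X in Ω, 2 * ⟪gradient u X, gradient χ X⟫ ≤
      ∫ x in Ω, (‖fderiv ℝ u x‖ ^ 2 + ‖fderiv ℝ χ x‖ ^ 2) := by
    refine integral_mono ((int_inner hui hχi).const_mul 2) hsum fun x => ?_
    have := (le_abs_self _).trans (abs_inner_grad u χ x)
    show 2 * ⟪gradient u x, gradient χ x⟫ ≤ ‖fderiv ℝ u x‖ ^ 2 + ‖fderiv ℝ χ x‖ ^ 2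
    nlinarith [sq_nonneg (‖fderiv ℝ u x‖ - ‖fderiv ℝ χ x‖)]
  rw [integral_const_mul, integral_add hui hχi] at k
  have k2 : ∫ x in Ω, ‖fderiv ℝ χ x‖ ^ 2 ≤ ∫ x, ‖fderiv ℝ χ x‖ ^ 2 :=
    setIntegral_le_integral hint (Filter.Eventually.of_forall fun _ => by positivity)
  have hq : 0 ≤ ∫ P in frontier Ω, u P ^ 2 ∂σ := integral_nonneg fun _ => by positivity
  nlinarith

theorem radius_sq {n : ℕ} {Ω : Set (EuclideanSpace ℝ (Fin n))} (hb : Bornology.IsBounded Ω)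
    {w : EuclideanSpace ℝ (Fin n) → ℝ} (hw : GoodFn Ω w) {A : EuclideanSpace ℝ (Fin n)} {s : ℝ}
    (hs : 0 < s) (hsub : ball A (2 * s) ⊆ Ω) :
    (mAvg w A (2 * s) - mAvg w A s) ^ 2 ≤
      2 ^ n * volume.real (ball (0 : EuclideanSpace ℝ (Fin n)) 1) * (s ^ 2 / s ^ n) *
        ∫ z in ball A (2 * s), ‖fderiv ℝ w z‖ ^ 2 := by
  obtain ⟨B, hB0, hB⟩ := hw.bdd hb
  have i1 : IntegrableOn (fun x => ‖fderiv ℝ w x‖) (ball A (2 * s)) := (hw.int1 hb).mono_set hsub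
  have i2 : IntegrableOn (fun x => ‖fderiv ℝ w x‖ ^ 2) (ball A (2 * s)) := hw.int2.mono_set hsub
  have h := mAvg_sub_le isOpen_ball (hw.cd.mono hsub) (fun x hx => hB x (subset_closure (hsub hx))) i1
    A A (ρ := 2 * s) (ρ' := s) hs (by linarith) le_rfl (by
      intro t ht
      have : (1 - t) • A + t • A = A := by rw [← add_smul]; simp
      rw [this]
      exact ball_subset_ball (by nlinarith [ht.1, ht.2]))
  rw [sub_self, norm_zero, zero_add, show 2 * s - s = s by ring, abs_of_pos hs] at h
  have : Fact (volume (ball A (2 * s)) < ⊤) := ⟨measure_ball_lt_top⟩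
  have h2 := sq_integral_le i1 i2
  rw [measureReal_restrict_apply_univ, measureReal_def, vol_ball_real A (by positivity : 0 < 2 * s),
    ENNReal.toReal_ofReal (by positivity)] at h2
  set I := ∫ z in ball A (2 * s), ‖fderiv ℝ w z‖
  set J := ∫ z in ball A (2 * s), ‖fderiv ℝ w z‖ ^ 2
  set v := volume.real (ball (0 : EuclideanSpace ℝ (Fin n)) 1)
  calc (mAvg w A (2 * s) - mAvg w A s) ^ 2 = |mAvg w A (2 * s) - mAvg w A s| ^ 2 := (sq_abs _).symm
    _ ≤ (s / s ^ n * I) ^ 2 := by gcongr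
    _ = (s / s ^ n) ^ 2 * I ^ 2 := by ring
    _ ≤ (s / s ^ n) ^ 2 * ((2 * s) ^ n * v * J) := by gcongr
    _ = _ := by rw [mul_pow]; field_simp

theorem step_sq (n : ℕ) (M : ℝ) (hM : 1 < M) :
    ∃ θ K Λ C : ℝ, 0 < θ ∧ θ ≤ 1 / 2 ∧ θ ≤ 1 / (2 * M) ∧ 1 ≤ K ∧ 1 ≤ Λ ∧ 0 < C ∧
      ∀ Ω : Set (EuclideanSpace ℝ (Fin n)), IsOneSidedNTA M Ω → Bornology.IsBounded Ω →
      ∀ w : EuclideanSpace ℝ (Fin n) → ℝ, GoodFn Ω w →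
      ∀ Q, ∀ A ∈ Ω, ∀ A' ∈ Ω, ∀ r : ℝ, 0 < r → Λ * r < Metric.diam Ω / 10 → dist A Q < 2 * r →
        dist A' Q < r → (2 * r) / (2 * M) ≤ infDist A (frontier Ω) →
        r / (2 * M) ≤ infDist A' (frontier Ω) →
        (mAvg w A (θ * (2 * r)) - mAvg w A' (θ * r)) ^ 2 ≤
          C * (r ^ 2 / r ^ n) * ∫ z in Ω ∩ ball Q (K * r), ‖fderiv ℝ w z‖ ^ 2 := by
  have hΛ1 : 1 ≤ 2 * M + 3 := by linarith
  obtain ⟨θ, K, hθ, hθ1, hK, H⟩ := chain_sq n M (2 * M + 3) hM hΛ1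
  have hK0 : 0 < K := by linarith
  set v := volume.real (ball (0 : EuclideanSpace ℝ (Fin n)) 1) with hv
  have hθ2 : θ ≤ 1 / 2 := hθ1.trans (one_div_le_one_div_of_le (by norm_num) (by linarith))
  have hθ3 : θ ≤ 1 / (2 * M) := hθ1.trans (one_div_le_one_div_of_le (by linarith) (by linarith))
  refine ⟨θ, K + 2, 2 * M + 3, 2 * K + 2 * (2 ^ n * v * (θ ^ 2 / θ ^ n)), hθ, hθ2, hθ3,
    by linarith, hΛ1, by positivity, ?_⟩
  intro Ω hΩ hb w hw Q A hA A' hA' r hr hrd hAQ hAQ' hdA hdA'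
  have hM0 : 0 < M := by linarith
  have hsub : ball A (2 * (θ * r)) ⊆ Ω := by
    refine (ball_subset_ball (le_trans ?_ hdA)).trans (ball_infDist_frontier_subset hΩ.isOpen hA)
    calc 2 * (θ * r) ≤ 2 * (1 / (2 * M) * r) := by gcongr
      _ = _ := by field_simp
  have h1 := radius_sq hb hw (A := A) (s := θ * r) (by positivity) hsub
  have hr1 : r / (2 * M + 3) ≤ r / (2 * M) :=
    div_le_div_of_nonneg_left hr.le (by linarith) (by linarith)
  have h2 := H Ω hΩ hb w hw A hA A' hA' r hr hrd (by
    have := dist_triangle_right A A' Q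
    nlinarith) (by
      refine le_trans (hr1.trans ?_) hdA
      gcongr; linarith) (hr1.trans hdA')
  have hmono : ∀ s : Set (EuclideanSpace ℝ (Fin n)), s ⊆ Ω ∩ ball Q ((K + 2) * r) →
      ∫ z in s, ‖fderiv ℝ w z‖ ^ 2 ≤ ∫ z in Ω ∩ ball Q ((K + 2) * r), ‖fderiv ℝ w z‖ ^ 2 := by
    intro s hs
    exact setIntegral_mono_set (hw.int2.mono_set inter_subset_left)
      (Filter.Eventually.of_forall fun _ => by positivity) (LE.le.eventuallyLE hs)
  have h3 := hmono (Ω ∩ ball A (K * r)) (by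
    refine inter_subset_inter_right _ (ball_subset_ball' ?_)
    nlinarith)
  have h4 := hmono (ball A (2 * (θ * r))) (by
    refine subset_inter hsub (ball_subset_ball' ?_)
    nlinarith)
  set J := ∫ z in Ω ∩ ball Q ((K + 2) * r), ‖fderiv ℝ w z‖ ^ 2
  have h1' : (mAvg w A (θ * (2 * r)) - mAvg w A (θ * r)) ^ 2 ≤
      2 ^ n * v * (θ ^ 2 / θ ^ n) * (r ^ 2 / r ^ n) * J := by
    rw [show θ * (2 * r) = 2 * (θ * r) by ring]
    refine h1.trans ?_
    calc _ ≤ 2 ^ n * v * ((θ * r) ^ 2 / (θ * r) ^ n) * J := by gcongr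
      _ = _ := by rw [mul_pow, mul_pow]; field_simp
  have h2' : (mAvg w A (θ * r) - mAvg w A' (θ * r)) ^ 2 ≤ K * (r ^ 2 / r ^ n) * J := by
    refine h2.trans ?_
    rw [← mul_div_assoc]
    gcongr
  set x := mAvg w A (θ * (2 * r)); set y := mAvg w A (θ * r); set z := mAvg w A' (θ * r)
  calc (x - z) ^ 2 ≤ 2 * (x - y) ^ 2 + 2 * (y - z) ^ 2 := by nlinarith [sq_nonneg (x - 2 * y + z)]
    _ ≤ 2 * (2 ^ n * v * (θ ^ 2 / θ ^ n) * (r ^ 2 / r ^ n) * J) + 2 * (K * (r ^ 2 / r ^ n) * J) := by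
        gcongr
    _ = _ := by ring

theorem sigma_ball {n : ℕ} {M Cσ d cd : ℝ} {Ω : Set (EuclideanSpace ℝ (Fin n))}
    {σ : Measure (EuclideanSpace ℝ (Fin n))} (h : IsMixedPair M Cσ d cd Ω σ) (hD : 1 < diam Ω)
    (Y : EuclideanSpace ℝ (Fin n)) {s : ℝ} (hs : 0 < s) (hs1 : s < 1 / 2) :
    σ (ball Y s) ≤ ENNReal.ofReal (2 ^ d / cd * s ^ d * σ.real (frontier Ω)) := by
  have := mixed_finite h
  by_cases hY : (ball Y s ∩ frontier Ω).Nonempty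
  · obtain ⟨Q, hQ, hQf⟩ := hY
    have h1 := h.lower_dim Q hQf 1 (2 * s) (by positivity) (by linarith) hD
    have h2 : σ (ball Q 1) ≤ σ (frontier Ω) := by
      calc σ (ball Q 1) ≤ σ (frontier Ω) + σ (frontier Ω)ᶜ :=
            (measure_mono (subset_univ _)).trans (by
              rw [← union_compl_self (frontier Ω)]; exact measure_union_le _ _)
        _ = _ := by rw [h.null_outside, add_zero]
    have h3 : ball Y s ⊆ ball Q (2 * s) := ball_subset_ball' (by
      rw [mem_ball, dist_comm] at hQ; linarith)
    refine (measure_mono h3).trans ?_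
    have h4 := ENNReal.toReal_mono h.finite h2
    rw [← ENNReal.ofReal_toReal (measure_ne_top σ (ball Q (2 * s)))]
    refine ENNReal.ofReal_le_ofReal ?_
    rw [Real.div_rpow zero_le_one (by positivity), Real.one_rpow, Real.mul_rpow (by norm_num) hs.le] at h1
    have hcd := h.cd_pos
    have p1 : (0:ℝ) < 2 ^ d := by positivity
    have p2 : 0 < s ^ d := by positivity
    rw [measureReal_def]
    calc (σ (ball Q (2 * s))).toReal
        = 2 ^ d / cd * s ^ d * (cd * (1 / (2 ^ d * s ^ d)) * (σ (ball Q (2 * s))).toReal) := by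
          field_simp
      _ ≤ 2 ^ d / cd * s ^ d * (σ (frontier Ω)).toReal := by
          gcongr; exact h1.trans h4
  · have : σ (ball Y s) = 0 := measure_mono_null (fun x hx => fun hxf => hY ⟨x, hx, hxf⟩) h.null_outside
    rw [this]; exact zero_le

theorem mAvg_lim {n : ℕ} {Ω : Set (EuclideanSpace ℝ (Fin n))} (hb : Bornology.IsBounded Ω)
    {w : EuclideanSpace ℝ (Fin n) → ℝ} (hw : GoodFn Ω w) {Q : EuclideanSpace ℝ (Fin n)}
    (hQ : Q ∈ closure Ω) {A : ℕ → EuclideanSpace ℝ (Fin n)} {r : ℕ → ℝ} {θ : ℝ} (hθ : 0 < θ)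
    (hθ1 : θ ≤ 1) (hr : ∀ k, 0 < r k) (hr0 : Filter.Tendsto r Filter.atTop (𝓝 0))
    (hA : ∀ k, dist (A k) Q < r k) (hsub : ∀ k, ball (A k) (θ * r k) ⊆ Ω) :
    Filter.Tendsto (fun k => mAvg w (A k) (θ * r k)) Filter.atTop
      (𝓝 (volume.real (ball (0 : EuclideanSpace ℝ (Fin n)) 1) * w Q)) := by
  obtain ⟨B, hB0, hB⟩ := hw.bdd hb
  set v := volume.real (ball (0 : EuclideanSpace ℝ (Fin n)) 1) with hv
  rw [Metric.tendsto_atTop]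
  intro ε hε
  have hv0 : 0 ≤ v := measureReal_nonneg
  set τ := ε / (v + 1) with hτ
  have hτ0 : 0 < τ := by positivity
  obtain ⟨δ, hδ, hcont⟩ := Metric.continuousWithinAt_iff.1 (hw.cont Q hQ) τ hτ0
  obtain ⟨N, hN⟩ := Metric.tendsto_atTop.1 hr0 (δ / 2) (by positivity)
  refine ⟨N, fun k hk => ?_⟩
  have hk1 := hN k hk
  rw [dist_zero_right, Real.norm_eq_abs, abs_of_pos (hr k)] at hk1
  have := mAvg_close (hw.cont.mono subset_closure) (fun z hz => hB z (subset_closure hz))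
    (mul_pos hθ (hr k)) (hsub k) (c := w Q) (τ := τ) (fun z hz => by
      refine (hcont (subset_closure (hsub k hz)) ?_).le
      have h1 := dist_triangle z (A k) Q
      have h2 := mem_ball.1 hz
      have h3 := hA k
      have h4 : θ * r k ≤ r k := mul_le_of_le_one_left (hr k).le hθ1
      linarith)
  rw [Real.dist_eq]
  refine lt_of_le_of_lt this ?_
  rw [← hv, hτ, ← mul_div_assoc, div_lt_iff₀ (by positivity)]
  nlinarith

theorem base_sq {n : ℕ} {Ω : Set (EuclideanSpace ℝ (Fin n))} (hΩ : IsOpen Ω) {C₀ : ℝ}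
    (hC : Ω ⊆ ball 0 C₀) {w : EuclideanSpace ℝ (Fin n) → ℝ} (hw : GoodFn Ω w)
    (hw0 : ∀ x ∈ ball (0 : EuclideanSpace ℝ (Fin n)) 1, w x = 0) {A : EuclideanSpace ℝ (Fin n)}
    {ρ R : ℝ} (hρ : 0 < ρ) (hρ1 : ρ ≤ 1) (hA : ‖A‖ + ρ ≤ R) (hR : 1 ≤ R) (hRΩ : ball 0 R ⊆ Ω)
    (hAC : ‖A‖ ≤ C₀) :
    (mAvg w A ρ) ^ 2 ≤ ((C₀ + 1) / ρ ^ n) ^ 2 *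
      volume.real (ball (0 : EuclideanSpace ℝ (Fin n)) C₀) * ∫ z in Ω, ‖fderiv ℝ w z‖ ^ 2 := by
  have hb : Bornology.IsBounded Ω := isBounded_ball.subset hC
  obtain ⟨B, hB0, hB⟩ := hw.bdd hb
  have h := mAvg_sub_le hΩ hw.cd (fun x hx => hB x (subset_closure hx)) (hw.int1 hb)
    A 0 (ρ := ρ) (ρ' := 1) hρ le_rfl hρ1 (by
      intro t ht
      refine (ball_subset_ball' ?_).trans hRΩ
      rw [smul_zero, add_zero, dist_zero_right, norm_smul, Real.norm_eq_abs,
        abs_of_nonneg (by linarith [ht.2])]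
      nlinarith [ht.1, ht.2])
  have h0 : mAvg w 0 1 = 0 := by
    unfold mAvg
    refine setIntegral_eq_zero_of_forall_eq_zero fun x hx => ?_
    rw [zero_add, one_smul]; exact hw0 x hx
  rw [h0, sub_zero, sub_zero] at h
  have : Fact (volume Ω < ⊤) := ⟨hb.measure_lt_top⟩
  have h2 := sq_integral_le (hw.int1 hb) hw.int2
  rw [measureReal_restrict_apply_univ] at h2
  have h3 : volume.real Ω ≤ volume.real (ball (0 : EuclideanSpace ℝ (Fin n)) C₀) :=
    measureReal_mono hC measure_ball_lt_top.ne
  have h5 : |ρ - 1| ≤ 1 := by rw [abs_le]; constructor <;> linarith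
  have hE : 0 ≤ ∫ z in Ω, ‖fderiv ℝ w z‖ ^ 2 := integral_nonneg fun _ => by positivity
  have hI : 0 ≤ ∫ z in Ω, ‖fderiv ℝ w z‖ := integral_nonneg fun _ => by positivity
  set I := ∫ z in Ω, ‖fderiv ℝ w z‖
  set J := ∫ z in Ω, ‖fderiv ℝ w z‖ ^ 2
  calc (mAvg w A ρ) ^ 2 = |mAvg w A ρ| ^ 2 := (sq_abs _).symm
    _ ≤ ((C₀ + 1) / ρ ^ n * I) ^ 2 := by
        gcongr
        refine h.trans ?_
        gcongr
    _ = ((C₀ + 1) / ρ ^ n) ^ 2 * I ^ 2 := by ring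
    _ ≤ ((C₀ + 1) / ρ ^ n) ^ 2 * (volume.real Ω * J) := by gcongr
    _ ≤ ((C₀ + 1) / ρ ^ n) ^ 2 * (volume.real (ball (0 : EuclideanSpace ℝ (Fin n)) C₀) * J) := by
        gcongr
    _ = _ := by ring

theorem amgm {x y z : ℝ} (hy : 0 < y) (h : x ^ 2 ≤ z) : |x| ≤ y + z / y := by
  have h1 : x ^ 2 / y ≤ z / y := by gcongr
  have h2 : |x| ≤ y + x ^ 2 / y := by
    rw [← sq_abs, ← sub_nonneg]
    have : y + |x| ^ 2 / y - |x| = ((y - |x|) ^ 2 + y * |x|) / y := by field_simp; ring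
    rw [this]; positivity
  linarith

theorem pointwise {n : ℕ} {M θ K Λ C : ℝ} (hM : 1 < M) (hθ : 0 < θ) (hθ2 : θ ≤ 1 / 2)
    (hθM : θ ≤ 1 / (2 * M)) (hΛ : 1 ≤ Λ) (hC0 : 0 < C)
    {Ω : Set (EuclideanSpace ℝ (Fin n))} (hΩ : IsOneSidedNTA M Ω) (hb : Bornology.IsBounded Ω)
    {w : EuclideanSpace ℝ (Fin n) → ℝ} (hw : GoodFn Ω w)
    (H : ∀ Q, ∀ A ∈ Ω, ∀ A' ∈ Ω, ∀ r : ℝ, 0 < r → Λ * r < Metric.diam Ω / 10 → dist A Q < 2 * r →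
        dist A' Q < r → (2 * r) / (2 * M) ≤ infDist A (frontier Ω) →
        r / (2 * M) ≤ infDist A' (frontier Ω) →
        (mAvg w A (θ * (2 * r)) - mAvg w A' (θ * r)) ^ 2 ≤
          C * (r ^ 2 / r ^ n) * ∫ z in Ω ∩ ball Q (K * r), ‖fderiv ℝ w z‖ ^ 2)
    {Q A : EuclideanSpace ℝ (Fin n)} (hQ : Q ∈ frontier Ω) (hA : A ∈ Ω) {r : ℝ} (hr : 0 < r)
    (hrd : Λ * r < Metric.diam Ω / 10) (hAQ : dist A Q < r) (hdA : r / (2 * M) ≤ infDist A (frontier Ω))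
    (p : ℕ → ℝ) (hp : ∀ k, 0 < p k) :
    edist (mAvg w A (θ * r)) (volume.real (ball (0 : EuclideanSpace ℝ (Fin n)) 1) * w Q) ≤
      ∑' k : ℕ, (ENNReal.ofReal (p k) +
        ENNReal.ofReal (C * ((r / 2 ^ (k + 1)) ^ 2 / (r / 2 ^ (k + 1)) ^ n) / p k) *
        ∫⁻ z in Ω ∩ ball Q (K * (r / 2 ^ (k + 1))), ENNReal.ofReal (‖fderiv ℝ w z‖ ^ 2)) := by
  have hM0 : 0 < M := by linarith
  have hd : r < diam Ω / 10 := by nlinarith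
  have hcs : ∀ k : ℕ, ∃ A' ∈ Ω, dist A' Q < r / 2 ^ (k + 1) ∧
      (r / 2 ^ (k + 1)) / (2 * M) ≤ infDist A' (frontier Ω) := by
    intro k
    have hlt : r / 2 ^ (k + 1) ≤ r := div_le_self hr.le (one_le_pow₀ (by norm_num))
    obtain ⟨A', ⟨h1, h2⟩, h3⟩ := hΩ.corkscrew Q hQ (r / 2 ^ (k + 1)) (by positivity) (by linarith)
    refine ⟨A', h1, h2, le_trans ?_ h3⟩
    gcongr; linarith
  choose A' hA'Ω hA'Q hA'd using hcs
  set a : ℕ → EuclideanSpace ℝ (Fin n) := fun k => Nat.casesOn k A A' with ha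
  have haΩ : ∀ k, a k ∈ Ω := by rintro (_ | k); exacts [hA, hA'Ω k]
  have haQ : ∀ k, dist (a k) Q < r / 2 ^ k := by
    rintro (_ | k)
    · simpa [ha] using hAQ
    · exact hA'Q k
  have had : ∀ k, (r / 2 ^ k) / (2 * M) ≤ infDist (a k) (frontier Ω) := by
    rintro (_ | k)
    · simpa [ha] using hdA
    · exact hA'd k
  have hlim := mAvg_lim hb hw (frontier_subset_closure hQ) (A := a) (r := fun k => r / 2 ^ k) hθ
    (by linarith) (fun k => by positivity)
    (by
      have : Filter.Tendsto (fun k : ℕ => r * (1 / 2 : ℝ) ^ k) Filter.atTop (𝓝 (r * 0)) :=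
        (tendsto_pow_atTop_nhds_zero_of_lt_one (by norm_num) (by norm_num)).const_mul r
      rw [mul_zero] at this
      refine this.congr fun k => ?_
      rw [one_div, inv_pow, div_eq_mul_inv])
    haQ (fun k => by
      refine (ball_subset_ball (le_trans ?_ (had k))).trans
        (ball_infDist_frontier_subset hΩ.isOpen (haΩ k))
      calc θ * (r / 2 ^ k) ≤ 1 / (2 * M) * (r / 2 ^ k) := by gcongr
        _ = _ := by field_simp)
  have key := edist_le_tsum_of_edist_le_of_tendsto₀ (fun k : ℕ => ENNReal.ofReal (p k) +
        ENNReal.ofReal (C * ((r / 2 ^ (k + 1)) ^ 2 / (r / 2 ^ (k + 1)) ^ n) / p k) *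
        ∫⁻ z in Ω ∩ ball Q (K * (r / 2 ^ (k + 1))), ENNReal.ofReal (‖fderiv ℝ w z‖ ^ 2))
    (f := fun k => mAvg w (a k) (θ * (r / 2 ^ k))) (fun k => by
      have hlt : r / 2 ^ (k + 1) ≤ r := div_le_self hr.le (one_le_pow₀ (by norm_num))
      have e2 : r / 2 ^ k = 2 * (r / 2 ^ (k + 1)) := by rw [pow_succ]; field_simp
      have q1 := haQ k
      have q2 := had k
      rw [e2] at q1 q2
      have h1 := H Q (a k) (haΩ k) (a (k + 1)) (haΩ (k + 1)) (r / 2 ^ (k + 1)) (by positivity)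
        (by nlinarith) q1 (haQ (k + 1)) q2 (had (k + 1))
      have h2 := amgm (hp k) h1
      have hI : 0 ≤ ∫ z in Ω ∩ ball Q (K * (r / 2 ^ (k + 1))), ‖fderiv ℝ w z‖ ^ 2 :=
        integral_nonneg fun _ => by positivity
      have hpk := hp k
      show edist (mAvg w (a k) (θ * (r / 2 ^ k))) (mAvg w (a (k + 1)) (θ * (r / 2 ^ (k + 1)))) ≤ _
      rw [edist_dist, Real.dist_eq, e2, ← ofReal_int_sq (hw.int2.mono_set inter_subset_left),
        ← ENNReal.ofReal_mul (by positivity), ← ENNReal.ofReal_add (by positivity) (by positivity)]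
      refine ENNReal.ofReal_le_ofReal (h2.trans (le_of_eq ?_))
      ring) hlim
  simpa [ha] using key

theorem meas_ball {n : ℕ} {Ω : Set (EuclideanSpace ℝ (Fin n))}
    {f : EuclideanSpace ℝ (Fin n) → ℝ≥0∞} (hf : Measurable f) (s : ℝ) :
    Measurable fun x => ∫⁻ z in Ω ∩ ball x s, f z := by
  have h1 : ∀ x, ∫⁻ z in Ω ∩ ball x s, f z =
      ∫⁻ z in Ω, ({p : EuclideanSpace ℝ (Fin n) × EuclideanSpace ℝ (Fin n) |
        dist p.1 p.2 < s}.indicator (fun p => f p.2)) (x, z) := by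
    intro x
    rw [inter_comm, ← Measure.restrict_restrict measurableSet_ball, ← lintegral_indicator
      measurableSet_ball]
    refine lintegral_congr fun z => ?_
    by_cases h : dist x z < s
    · rw [indicator_of_mem, indicator_of_mem] <;> simpa [dist_comm z x] using h
    · rw [indicator_of_notMem, indicator_of_notMem] <;> simpa [dist_comm z x] using h
  simp_rw [h1]
  refine Measurable.lintegral_prod_right' ?_
  exact (hf.comp measurable_snd).indicator
    (isOpen_lt (by fun_prop) continuous_const).measurableSet

theorem rpow_id (n : ℕ) (d r : ℝ) (hr : 0 < r) :
    r ^ 2 / r ^ n / r ^ ((2 - n + d) / 2) * r ^ d = r ^ ((2 - n + d) / 2) := by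
  rw [← Real.rpow_natCast r 2, ← Real.rpow_natCast r n, ← Real.rpow_sub hr, ← Real.rpow_sub hr,
    ← Real.rpow_add hr]
  congr 1; push_cast; ring

theorem term_bound {n : ℕ} {M Cσ d cd : ℝ} {Ω : Set (EuclideanSpace ℝ (Fin n))}
    {σ : Measure (EuclideanSpace ℝ (Fin n))} (h : IsMixedPair M Cσ d cd Ω σ) (hD : 1 < diam Ω)
    {w : EuclideanSpace ℝ (Fin n) → ℝ} (hw : GoodFn Ω w) (T : Set (EuclideanSpace ℝ (Fin n)))
    {K C r l : ℝ} (hK : 0 < K) (hC : 0 < C) (hr : 0 < r) (hKr : K * r < 1 / 2) (hl : 0 < l) :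
    ∫⁻ Q in T, (ENNReal.ofReal (l * r ^ ((2 - n + d) / 2)) +
        ENNReal.ofReal (C * (r ^ 2 / r ^ n) / (l * r ^ ((2 - n + d) / 2))) *
        ∫⁻ z in Ω ∩ ball Q (K * r), ENNReal.ofReal (‖fderiv ℝ w z‖ ^ 2)) ∂σ ≤
      ENNReal.ofReal (σ.real (frontier Ω) * r ^ ((2 - n + d) / 2) *
        (l + C * (2 ^ d / cd * K ^ d) * (∫ z in Ω, ‖fderiv ℝ w z‖ ^ 2) / l)) := by
  have := mixed_finite h
  have hcd := h.cd_pos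
  have hid := rpow_id n d r hr
  set β : ℝ := (2 - n + d) / 2
  have hrb : 0 < r ^ β := by positivity
  have hf : Measurable fun z => ENNReal.ofReal (‖fderiv ℝ w z‖ ^ 2) :=
    ((measurable_fderiv ℝ w).norm.pow_const 2).ennreal_ofReal
  have hE : 0 ≤ ∫ z in Ω, ‖fderiv ℝ w z‖ ^ 2 := integral_nonneg fun _ => by positivity
  have hS : 0 ≤ σ.real (frontier Ω) := measureReal_nonneg
  have hT : σ.restrict T univ ≤ ENNReal.ofReal (σ.real (frontier Ω)) := by
    rw [Measure.restrict_apply_univ, measureReal_def, ENNReal.ofReal_toReal h.finite]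
    calc σ T ≤ σ (frontier Ω) + σ (frontier Ω)ᶜ :=
          (measure_mono (subset_univ _)).trans (by
            rw [← union_compl_self (frontier Ω)]; exact measure_union_le _ _)
      _ = _ := by rw [h.null_outside, add_zero]
  have hI : ∫⁻ Q in T, (∫⁻ z in Ω ∩ ball Q (K * r), ENNReal.ofReal (‖fderiv ℝ w z‖ ^ 2)) ∂σ ≤
      ENNReal.ofReal ((∫ z in Ω, ‖fderiv ℝ w z‖ ^ 2) *
        (2 ^ d / cd * (K * r) ^ d * σ.real (frontier Ω))) := by
    rw [tonelli_ball (σ.restrict T) Ω h.nta.isOpen.measurableSet _ hf, ENNReal.ofReal_mul hE,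
      ofReal_int_sq hw.int2, ← lintegral_mul_const' _ _ ENNReal.ofReal_ne_top]
    refine lintegral_mono fun z => ?_
    gcongr
    exact (Measure.restrict_apply_le _ _).trans (sigma_ball h hD z (by positivity) hKr)
  rw [lintegral_add_left measurable_const, lintegral_const,
    lintegral_const_mul' _ _ ENNReal.ofReal_ne_top]
  calc _ ≤ ENNReal.ofReal (l * r ^ β) * ENNReal.ofReal (σ.real (frontier Ω)) +
        ENNReal.ofReal (C * (r ^ 2 / r ^ n) / (l * r ^ β)) *
        ENNReal.ofReal ((∫ z in Ω, ‖fderiv ℝ w z‖ ^ 2) *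
        (2 ^ d / cd * (K * r) ^ d * σ.real (frontier Ω))) := by gcongr
    _ = _ := by
      rw [← ENNReal.ofReal_mul (by positivity), ← ENNReal.ofReal_mul (by positivity),
        ← ENNReal.ofReal_add (by positivity) (by positivity), Real.mul_rpow hK.le hr.le]
      congr 1
      have : C * (r ^ 2 / r ^ n) / (l * r ^ β) * ((∫ z in Ω, ‖fderiv ℝ w z‖ ^ 2) *
        (2 ^ d / cd * (K ^ d * r ^ d) * σ.real (frontier Ω))) =
        C / l * (∫ z in Ω, ‖fderiv ℝ w z‖ ^ 2) * (2 ^ d / cd * K ^ d) * σ.real (frontier Ω) *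
        (r ^ 2 / r ^ n / r ^ β * r ^ d) := by field_simp
      rw [this, hid]; ring

theorem geom_bound {β r X : ℝ} (hβ : 0 < β) (hr : 0 < r) (hr1 : r ≤ 1) (hX : 0 ≤ X) :
    ∑' k : ℕ, ENNReal.ofReal ((r / 2 ^ (k + 1)) ^ β * X) ≤
      ENNReal.ofReal ((1 - (1 / 2 : ℝ) ^ β)⁻¹ * X) := by
  set q : ℝ := (1 / 2 : ℝ) ^ β with hq
  have hq0 : 0 ≤ q := by positivity
  have hq1 : q < 1 := Real.rpow_lt_one (by norm_num) (by norm_num) hβ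
  have h1 : ∀ k : ℕ, (r / 2 ^ (k + 1)) ^ β ≤ q ^ k := by
    intro k
    have e : q ^ k = ((1 / 2 : ℝ) ^ k) ^ β := by
      rw [hq, ← Real.rpow_natCast ((1 / 2 : ℝ) ^ β) k, ← Real.rpow_mul (by norm_num), mul_comm,
        Real.rpow_mul (by norm_num), Real.rpow_natCast]
    rw [e]
    refine Real.rpow_le_rpow (by positivity) ?_ hβ.le
    rw [one_div, inv_pow, ← one_div]
    refine div_le_div₀ zero_le_one hr1 (by positivity) (pow_le_pow_right₀ (by norm_num) (by omega))
  calc _ ≤ ∑' k : ℕ, ENNReal.ofReal (q ^ k * X) := by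
        refine ENNReal.tsum_le_tsum fun k => ENNReal.ofReal_le_ofReal ?_
        exact mul_le_mul_of_nonneg_right (h1 k) hX
    _ = ENNReal.ofReal (∑' k : ℕ, q ^ k * X) :=
        (ENNReal.ofReal_tsum_of_nonneg (fun k => by positivity)
          ((summable_geometric_of_lt_one hq0 hq1).mul_right X)).symm
    _ = _ := by rw [tsum_mul_right, tsum_geometric_of_lt_one hq0 hq1]

theorem diam_ge {n : ℕ} (hn : 0 < n) {Ω : Set (EuclideanSpace ℝ (Fin n))}
    (hb : Bornology.IsBounded Ω) (h4 : ball 0 4 ⊆ Ω) : 6 ≤ diam Ω := by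
  set e : EuclideanSpace ℝ (Fin n) := EuclideanSpace.single ⟨0, hn⟩ 1 with he
  have hen : ‖e‖ = 1 := by simp [he]
  have h1 : (3 : ℝ) • e ∈ Ω := h4 (by rw [mem_ball_zero_iff, norm_smul, hen]; norm_num)
  have h2 : (-3 : ℝ) • e ∈ Ω := h4 (by rw [mem_ball_zero_iff, norm_smul, hen]; norm_num)
  have := dist_le_diam_of_mem hb h1 h2
  rw [dist_eq_norm, ← sub_smul, norm_smul, hen] at this
  norm_num at this
  exact this

theorem frontier_ne {n : ℕ} (hn : 0 < n) {Ω : Set (EuclideanSpace ℝ (Fin n))}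
    (hb : Bornology.IsBounded Ω) (h4 : ball 0 4 ⊆ Ω) : (frontier Ω).Nonempty := by
  have : Nonempty (Fin n) := ⟨⟨0, hn⟩⟩
  rw [nonempty_iff_ne_empty]
  intro h
  rcases isClopen_iff.1 (isClopen_iff_frontier_eq_empty.2 h) with h | h
  · have : (0 : EuclideanSpace ℝ (Fin n)) ∈ Ω := h4 (by simp)
    rw [h] at this; exact this
  · rw [h] at hb
    exact NormedSpace.unbounded_univ ℝ (EuclideanSpace ℝ (Fin n)) hb

set_option maxHeartbeats 1000000 in
theorem trace_bound (n : ℕ) (hn : 0 < n) (M Cσ d cd C₀ : ℝ) (hM : 1 < M) (hd : (n : ℝ) - 2 < d)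
    (hcd : 0 < cd) (hC₀ : 4 < C₀) : ∃ r C : ℝ, 0 < r ∧ 0 < C ∧
      ∀ (Ω : Set (EuclideanSpace ℝ (Fin n))) (σ : Measure (EuclideanSpace ℝ (Fin n))),
        IsMixedPair M Cσ d cd Ω σ → ball 0 4 ⊆ Ω → Ω ⊆ ball 0 C₀ →
        ∀ Q₀ ∈ frontier Ω, infDist 0 (frontier Ω) = ‖Q₀‖ →
        ∀ w : EuclideanSpace ℝ (Fin n) → ℝ, GoodFn Ω w →
        (∀ x ∈ ball (0 : EuclideanSpace ℝ (Fin n)) 1, w x = 0) → ∀ l : ℝ, 0 < l →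
        ∫ P in frontier Ω ∩ ball Q₀ (r / 2), |w P| ∂σ ≤
          C * σ.real (frontier Ω) * (l + (∫ z in Ω, ‖fderiv ℝ w z‖ ^ 2) / l) := by
  obtain ⟨θ, K, Λ, C, hθ, hθ2, hθM, hK, hΛ, hC, H⟩ := step_sq n M hM
  set β : ℝ := (2 - n + d) / 2 with hβ
  have hβ0 : 0 < β := by rw [hβ]; linarith
  set v := volume.real (ball (0 : EuclideanSpace ℝ (Fin n)) 1) with hv
  have hv0 : 0 < v := ENNReal.toReal_pos (measure_ball_pos _ _ one_pos).ne' measure_ball_lt_top.ne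
  set r : ℝ := 1 / (4 * (Λ + K)) with hr
  have hr0 : 0 < r := by positivity
  have hrΛ : Λ * r ≤ 1 / 4 := by
    rw [hr, mul_one_div, div_le_iff₀ (by positivity)]; linarith
  have hrK : K * r ≤ 1 / 4 := by
    rw [hr, mul_one_div, div_le_iff₀ (by positivity)]; linarith
  have hr1 : r ≤ 1 / 4 := by nlinarith
  set Cb : ℝ := ((C₀ + 1) / (θ * r) ^ n) ^ 2 *
    volume.real (ball (0 : EuclideanSpace ℝ (Fin n)) C₀) with hCb
  have hCb0 : 0 ≤ Cb := by positivity
  set C' : ℝ := C * (2 ^ d / cd * K ^ d) with hC'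
  have hC'0 : 0 < C' := by positivity
  set g : ℝ := (1 - (1 / 2 : ℝ) ^ β)⁻¹ with hg
  have hg0 : 0 < g := by
    rw [hg, inv_pos, sub_pos]; exact Real.rpow_lt_one (by norm_num) (by norm_num) hβ0
  refine ⟨r, ((1 + Cb) + g * (1 + C')) / v, hr0, by positivity, ?_⟩
  intro Ω σ h h4 hΩC Q₀ hQ₀ hdist w hw hw0 l hl
  have := mixed_finite h
  have hΩ := h.nta
  have hb := h.bounded
  have hD := diam_ge hn hb h4
  have hQ4 : 4 ≤ ‖Q₀‖ := by
    by_contra hc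
    have : Q₀ ∈ Ω := h4 (by rw [mem_ball_zero_iff]; linarith)
    rw [hΩ.isOpen.frontier_eq] at hQ₀
    exact hQ₀.2 this
  have hRΩ : ball 0 ‖Q₀‖ ⊆ Ω := by
    rw [← hdist]; exact ball_infDist_frontier_subset hΩ.isOpen (h4 (by simp))
  set A : EuclideanSpace ℝ (Fin n) := (1 - r / (2 * ‖Q₀‖)) • Q₀ with hA
  have hQp : 0 < ‖Q₀‖ := by linarith
  have ht : r / (2 * ‖Q₀‖) * ‖Q₀‖ = r / 2 := by field_simp
  have ht1 : r / (2 * ‖Q₀‖) ≤ 1 := by rw [div_le_one (by positivity)]; linarith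
  have hAn : ‖A‖ = ‖Q₀‖ - r / 2 := by
    rw [hA, norm_smul, Real.norm_eq_abs, abs_of_nonneg (by linarith), sub_mul, ht, one_mul]
  have hAQ : dist A Q₀ = r / 2 := by
    rw [dist_eq_norm, hA]
    have : (1 - r / (2 * ‖Q₀‖)) • Q₀ - Q₀ = (-(r / (2 * ‖Q₀‖))) • Q₀ := by
      rw [sub_smul, neg_smul, one_smul]; abel
    rw [this, norm_smul, norm_neg, Real.norm_eq_abs, abs_of_nonneg (by positivity), ht]
  have hAΩ : A ∈ Ω := hRΩ (by rw [mem_ball_zero_iff, hAn]; linarith)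
  have hAC : ‖A‖ ≤ C₀ := (mem_ball_zero_iff.1 (hΩC hAΩ)).le
  have hAd : r / 2 ≤ infDist A (frontier Ω) := by
    have := infDist_le_infDist_add_dist (s := frontier Ω) (x := (0 : EuclideanSpace ℝ (Fin n))) (y := A)
    rw [hdist, dist_zero_left, hAn] at this
    linarith
  have hAd' : r / (2 * M) ≤ infDist A (frontier Ω) := le_trans (by gcongr; linarith) hAd
  have hθr : θ * r ≤ r / 2 := by nlinarith
  set E := ∫ z in Ω, ‖fderiv ℝ w z‖ ^ 2 with hE
  have hE0 : 0 ≤ E := integral_nonneg fun _ => by positivity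
  have hbase := amgm hl (base_sq hΩ.isOpen hΩC hw hw0 (A := A) (ρ := θ * r) (R := ‖Q₀‖) (by positivity)
    (by linarith) (by linarith) (by linarith) hRΩ hAC)
  rw [← hCb, ← hE] at hbase
  set S := σ.real (frontier Ω) with hS
  have hS0 : 0 ≤ S := measureReal_nonneg
  set T := frontier Ω ∩ ball Q₀ (r / 2) with hT
  have hTm : MeasurableSet T := isClosed_frontier.measurableSet.inter measurableSet_ball
  have hTS : σ.real T ≤ S := measureReal_mono inter_subset_left
  have hint : IntegrableOn (fun P => |w P|) T σ :=
    (cont_int hb σ hw.cont.abs).mono_set inter_subset_left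
  set f : EuclideanSpace ℝ (Fin n) → ℝ≥0∞ := fun z => ENNReal.ofReal (‖fderiv ℝ w z‖ ^ 2) with hf
  have hfm : Measurable f := ((measurable_fderiv ℝ w).norm.pow_const 2).ennreal_ofReal
  have hpt : ∀ Q ∈ T, ENNReal.ofReal (v * |w Q|) ≤ ENNReal.ofReal (l + Cb * E / l) +
      ∑' k : ℕ, (ENNReal.ofReal (l * (r / 2 ^ (k + 1)) ^ β) +
        ENNReal.ofReal (C * ((r / 2 ^ (k + 1)) ^ 2 / (r / 2 ^ (k + 1)) ^ n) /
          (l * (r / 2 ^ (k + 1)) ^ β)) *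
        ∫⁻ z in Ω ∩ ball Q (K * (r / 2 ^ (k + 1))), f z) := by
    intro Q hQ
    have hAQ' : dist A Q < r := by
      have h1 := dist_triangle_right A Q Q₀
      have h2 := mem_ball.1 hQ.2
      linarith
    have hp := pointwise hM hθ hθ2 hθM hΛ hC hΩ hb hw (fun Q A hA A' hA' r => H Ω hΩ hb w hw Q A hA A' hA' r)
      hQ.1 hAΩ hr0 (by linarith) hAQ' hAd' (fun k => l * (r / 2 ^ (k + 1)) ^ β)
      (fun k => by positivity)
    refine le_trans ?_ (add_le_add (ENNReal.ofReal_le_ofReal hbase) hp)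
    rw [edist_dist, ← ENNReal.ofReal_add (abs_nonneg _) dist_nonneg, Real.dist_eq]
    refine ENNReal.ofReal_le_ofReal ?_
    have := abs_sub_abs_le_abs_sub (v * w Q) (mAvg w A (θ * r))
    rw [abs_mul, abs_of_pos hv0, abs_sub_comm] at this
    linarith
  have hmain : ENNReal.ofReal (∫ P in T, v * |w P| ∂σ) ≤
      ENNReal.ofReal (((1 + Cb) + g * (1 + C')) * S * (l + E / l)) := by
    rw [ofReal_integral_eq_lintegral_ofReal (hint.const_mul v)
      (Filter.Eventually.of_forall fun x => by positivity)]
    calc ∫⁻ Q in T, ENNReal.ofReal (v * |w Q|) ∂σ ≤ _ := setLIntegral_mono' hTm hpt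
      _ = ENNReal.ofReal (l + Cb * E / l) * σ T +
          ∑' k : ℕ, ∫⁻ Q in T, (ENNReal.ofReal (l * (r / 2 ^ (k + 1)) ^ β) +
          ENNReal.ofReal (C * ((r / 2 ^ (k + 1)) ^ 2 / (r / 2 ^ (k + 1)) ^ n) /
          (l * (r / 2 ^ (k + 1)) ^ β)) *
          ∫⁻ z in Ω ∩ ball Q (K * (r / 2 ^ (k + 1))), f z) ∂σ := by
          rw [lintegral_add_left measurable_const, lintegral_const, Measure.restrict_apply_univ,
            lintegral_tsum]
          intro k
          exact (measurable_const.add ((meas_ball hfm _).const_mul _)).aemeasurable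
      _ ≤ ENNReal.ofReal (l + Cb * E / l) * ENNReal.ofReal S +
          ∑' k : ℕ, ENNReal.ofReal ((r / 2 ^ (k + 1)) ^ β * (S * (l + C' * E / l))) := by
          gcongr with k
          · rw [← ENNReal.ofReal_toReal (measure_ne_top σ T)]
            exact ENNReal.ofReal_le_ofReal hTS
          · have hlt : r / 2 ^ (k + 1) ≤ r := div_le_self hr0.le (one_le_pow₀ (by norm_num))
            refine (term_bound h (by linarith) hw T (by linarith : 0 < K) hC
              (by positivity : 0 < r / 2 ^ (k + 1)) (by nlinarith) hl).trans (le_of_eq ?_)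
            congr 1; rw [← hβ, ← hS, ← hE, ← hC']; ring
      _ ≤ ENNReal.ofReal (l + Cb * E / l) * ENNReal.ofReal S +
          ENNReal.ofReal (g * (S * (l + C' * E / l))) := by
          gcongr
          exact geom_bound hβ0 hr0 (by linarith) (by positivity)
      _ = ENNReal.ofReal ((l + Cb * E / l) * S + g * (S * (l + C' * E / l))) := by
          rw [← ENNReal.ofReal_mul (by positivity), ← ENNReal.ofReal_add (by positivity) (by positivity)]
      _ ≤ _ := by
          refine ENNReal.ofReal_le_ofReal ?_
          have hEl : 0 ≤ E / l := by positivity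
          rw [mul_div_assoc, mul_div_assoc]
          set y := E / l
          have e : ((1 + Cb) + g * (1 + C')) * S * (l + y) -
            ((l + Cb * y) * S + g * (S * (l + C' * y))) =
            S * (Cb * l + y) + g * (S * (C' * l + y)) := by ring
          have : 0 ≤ S * (Cb * l + y) + g * (S * (C' * l + y)) := by positivity
          linarith
  have hfin := (ENNReal.ofReal_le_ofReal_iff (by positivity)).1 hmain
  rw [integral_const_mul] at hfin
  rw [div_mul_eq_mul_div, div_mul_eq_mul_div, le_div_iff₀ hv0]
  linarith

theorem mass_bound (n : ℕ) (M Cσ d cd C₀ r : ℝ) (hCσ : 0 < Cσ) (hr : 0 < r) : ∃ Cm : ℝ, 0 < Cm ∧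
      ∀ (Ω : Set (EuclideanSpace ℝ (Fin n))) (σ : Measure (EuclideanSpace ℝ (Fin n))),
        IsMixedPair M Cσ d cd Ω σ → Ω ⊆ ball 0 C₀ → 0 < diam Ω → ∀ Q ∈ frontier Ω,
        σ.real (frontier Ω) ≤ Cm * σ.real (frontier Ω ∩ ball Q r) := by
  obtain ⟨N, hN⟩ := pow_unbounded_of_one_lt (3 * C₀ / r) (by norm_num : (1:ℝ) < 2)
  refine ⟨Cσ ^ N, by positivity, ?_⟩
  intro Ω σ h hC hD Q hQ
  have := mixed_finite h
  have hb := h.bounded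
  set D := diam Ω with hDd
  have hC0 : 0 ≤ C₀ := by
    obtain ⟨x, hx⟩ := h.nonempty
    have := hC hx
    exact (pos_of_mem_ball this).le
  have hD2 : D ≤ 2 * C₀ := (diam_mono hC isBounded_ball).trans (diam_ball hC0)
  have step : ∀ j : ℕ, σ.real (ball Q (3 * D / 2)) ≤ Cσ ^ j * σ.real (ball Q (3 * D / 2 / 2 ^ j)) := by
    intro j
    induction j with
    | zero => simp
    | succ j ih =>
      have hlt : 3 * D / 2 / 2 ^ (j + 1) < D := by
        rw [div_lt_iff₀ (by positivity), pow_succ]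
        have : (1:ℝ) ≤ 2 ^ j := one_le_pow₀ (by norm_num)
        nlinarith
      have h1 := h.doubling Q hQ (3 * D / 2 / 2 ^ (j + 1)) (by positivity) hlt
      have e : 2 * (3 * D / 2 / 2 ^ (j + 1)) = 3 * D / 2 / 2 ^ j := by rw [pow_succ]; field_simp
      rw [e] at h1
      calc _ ≤ _ := ih
        _ ≤ Cσ ^ j * (Cσ * σ.real (ball Q (3 * D / 2 / 2 ^ (j + 1)))) := by gcongr; exact h1
        _ = _ := by ring
  have hsub : frontier Ω ⊆ ball Q (3 * D / 2) := by
    intro x hx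
    have := dist_le_diam_of_mem hb.closure (frontier_subset_closure hx) (frontier_subset_closure hQ)
    rw [diam_closure] at this
    rw [mem_ball]; linarith
  have hsm : 3 * D / 2 / 2 ^ N ≤ r := by
    rw [div_lt_iff₀ hr] at hN
    rw [div_le_iff₀ (by positivity)]
    nlinarith
  have hin : σ.real (ball Q (3 * D / 2 / 2 ^ N)) ≤ σ.real (frontier Ω ∩ ball Q r) := by
    refine ENNReal.toReal_mono (measure_ne_top _ _) ?_
    calc σ (ball Q (3 * D / 2 / 2 ^ N)) ≤ σ ((frontier Ω ∩ ball Q r) ∪ (frontier Ω)ᶜ) :=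
          measure_mono fun x hx => by
            by_cases hxf : x ∈ frontier Ω
            · exact Or.inl ⟨hxf, ball_subset_ball hsm hx⟩
            · exact Or.inr hxf
      _ ≤ _ := by
          refine (measure_union_le _ _).trans ?_
          rw [h.null_outside, add_zero]
  calc σ.real (frontier Ω) ≤ σ.real (ball Q (3 * D / 2)) := measureReal_mono hsub
    _ ≤ _ := step N
    _ ≤ _ := by gcongr

theorem lower_bound (n : ℕ) (hn : 0 < n) (M Cσ d cd C₀ : ℝ) (hM : 1 < M) (hd : (n : ℝ) - 2 < d)
    (hcd : 0 < cd) (hC₀ : 4 < C₀) (hCσ : 0 < Cσ) : ∃ B : ℝ, 0 < B ∧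
      ∀ (Ω : Set (EuclideanSpace ℝ (Fin n))) (σ : Measure (EuclideanSpace ℝ (Fin n))),
        IsMixedPair M Cσ d cd Ω σ → ball 0 4 ⊆ Ω → Ω ⊆ ball 0 C₀ → ∀ a : ℝ, 0 < a →
        ∀ u : EuclideanSpace ℝ (Fin n) → ℝ, IsFluxSolution Ω σ a u →
        a * σ.real (frontier Ω) ≤
          B * (a * ∫ P in frontier Ω, u P ∂σ) * (1 + a * σ.real (frontier Ω)) := by
  obtain ⟨r, C, hr, hC, HT⟩ := trace_bound n hn M Cσ d cd C₀ hM hd hcd hC₀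
  obtain ⟨Cm, hCm, HM⟩ := mass_bound n M Cσ d cd C₀ (r / 2) hCσ (by positivity)
  set l : ℝ := 1 / (2 * Cm * (1 + C)) with hl
  have hl0 : 0 < l := by positivity
  refine ⟨2 * Cm * (1 + C) / l, by positivity, ?_⟩
  intro Ω σ h h4 hΩC a ha u hu
  have := mixed_finite h
  have hΩ := h.nta
  have hb := h.bounded
  have hD := diam_ge hn hb h4
  have hne := frontier_ne hn hb h4
  have hen := energy hn hΩ hb hne (by linarith) h4 σ hu
  obtain ⟨Q₀, hQ₀, hdist⟩ := isClosed_frontier.exists_infDist_eq_dist hne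
    (0 : EuclideanSpace ℝ (Fin n))
  rw [dist_zero_left] at hdist
  have hmass := HM Ω σ h hΩC (by linarith) Q₀ hQ₀
  have htr := HT Ω σ h h4 hΩC Q₀ hQ₀ hdist
  set E := ∫ z in Ω, ‖fderiv ℝ u z‖ ^ 2 with hE
  have hE0 : 0 ≤ E := integral_nonneg fun _ => by positivity
  set S := σ.real (frontier Ω) with hS
  have hS0 : 0 ≤ S := measureReal_nonneg
  set T := frontier Ω ∩ ball Q₀ (r / 2) with hT
  have hTS : σ.real T ≤ S := measureReal_mono inter_subset_left
  have hc := hu.contOn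
  have i1 : IntegrableOn (fun P => |1 - u P|) T σ :=
    (cont_int hb σ (continuousOn_const.sub hc).abs).mono_set inter_subset_left
  have i2 : IntegrableOn (fun P => u P ^ 2) (frontier Ω) σ := cont_int hb σ (hc.pow 2)
  have i2' : IntegrableOn (fun P => u P ^ 2 / l) T σ := (i2.mono_set inter_subset_left).div_const l
  have ic : ∀ c : ℝ, IntegrableOn (fun _ => c) T σ := fun c => integrable_const c
  have hone : ∫ P in T, |1 - u P| ∂σ ≤ C * S * (l + E / l) := by
    refine le_of_forall_pos_le_add fun ε hε => ?_
    set η := ε / (2 * S + 1) with hη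
    have hη0 : 0 < η := by positivity
    obtain ⟨hg, ⟨R, hR1, hR4, hR0⟩, -, -⟩ := trunc hΩ.isOpen h4 hu hη0
    have h1 := htr _ hg (fun x hx => hR0 x (ball_subset_ball hR1.le hx)) l hl0
    have i3 : IntegrableOn (fun P => |tF η (1 - u P)|) T σ :=
      (cont_int hb σ hg.cont.abs).mono_set inter_subset_left
    have i4 : IntegrableOn (fun P => |tF η (1 - u P)| + 2 * η) T σ := i3.add (ic _)
    have h2 : ∫ P in T, |1 - u P| ∂σ ≤ ∫ P in T, (|tF η (1 - u P)| + 2 * η) ∂σ := by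
      refine integral_mono i1 i4 fun x => ?_
      have := abs_sub_abs_le_abs_sub (1 - u x) (tF η (1 - u x))
      have h3 := tF_close (1 - u x) hη0
      rw [abs_sub_comm (1 - u x)] at this
      show |1 - u x| ≤ |tF η (1 - u x)| + 2 * η
      linarith
    rw [integral_add i3 (ic _), setIntegral_const, smul_eq_mul] at h2
    have h5 := trunc_le hΩ.isOpen h4 hu hη0
    have h6 : σ.real T * (2 * η) ≤ ε := by
      calc σ.real T * (2 * η) ≤ S * (2 * η) := by gcongr
        _ = (2 * S) * η := by ring
        _ ≤ (2 * S + 1) * η := by gcongr; linarith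
        _ = ε := by rw [hη]; field_simp
    have h7 : C * S * (l + (∫ z in Ω, ‖fderiv ℝ (fun x => tF η (1 - u x)) z‖ ^ 2) / l) ≤
        C * S * (l + E / l) := by gcongr
    linarith
  have i5 : IntegrableOn (fun P => l + u P ^ 2 / l) T σ := (ic l).add i2'
  have i6 : IntegrableOn (fun P => (l + u P ^ 2 / l) + |1 - u P|) T σ := i5.add i1
  have hq0 : 0 ≤ ∫ P in frontier Ω, u P ^ 2 ∂σ := integral_nonneg fun _ => by positivity
  have hq : ∫ P in T, u P ^ 2 ∂σ ≤ ∫ P in frontier Ω, u P ^ 2 ∂σ :=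
    setIntegral_mono_set i2 (Filter.Eventually.of_forall fun _ => by positivity)
      (LE.le.eventuallyLE inter_subset_left)
  have hTle : σ.real T ≤ l * S + (∫ P in frontier Ω, u P ^ 2 ∂σ) / l + C * S * (l + E / l) := by
    have h1 : ∫ P in T, (1:ℝ) ∂σ ≤ ∫ P in T, ((l + u P ^ 2 / l) + |1 - u P|) ∂σ := by
      refine integral_mono (ic 1) i6 fun x => ?_
      have h2 := amgm hl0 (le_refl (u x ^ 2))
      have h3 := le_abs_self (u x)
      have h4 := le_abs_self (1 - u x)
      show 1 ≤ (l + u x ^ 2 / l) + |1 - u x|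
      linarith
    rw [integral_add i5 i1, integral_add (ic l) i2', setIntegral_const, setIntegral_const, smul_eq_mul,
      smul_eq_mul, mul_one, integral_div] at h1
    have h2 : σ.real T * l ≤ l * S := by rw [mul_comm]; gcongr
    have h3 : (∫ P in T, u P ^ 2 ∂σ) / l ≤ (∫ P in frontier Ω, u P ^ 2 ∂σ) / l := by gcongr
    linarith
  set q := ∫ P in frontier Ω, u P ^ 2 ∂σ with hqq
  set F := a * ∫ P in frontier Ω, u P ∂σ with hF
  have haq : a * q ≤ F := by linarith
  have hEF : E ≤ F := by
    have : 0 ≤ a * q := by positivity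
    linarith
  have hF0 : 0 ≤ F := hE0.trans hEF
  have hll : Cm * ((1 + C) * l) = 1 / 2 := by rw [hl]; field_simp
  have k1 : S ≤ Cm * (l * S + q / l + C * S * (l + E / l)) := hmass.trans (by gcongr)
  have k2 : Cm * (l * S + q / l + C * S * (l + E / l)) =
      (Cm * ((1 + C) * l)) * S + Cm / l * (q + C * S * E) := by field_simp; ring
  rw [k2, hll] at k1
  have k3 : S ≤ 2 * Cm / l * (q + C * S * E) := by
    have : 2 * Cm / l * (q + C * S * E) = 2 * (Cm / l * (q + C * S * E)) := by ring
    linarith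
  calc a * S ≤ a * (2 * Cm / l * (q + C * S * E)) := by gcongr
    _ = 2 * Cm / l * (a * q + C * (a * S) * E) := by ring
    _ ≤ 2 * Cm / l * (F + C * (a * S) * F) := by gcongr
    _ ≤ 2 * Cm / l * ((1 + C) * (F * (1 + a * S))) := by
        gcongr
        have : 0 ≤ F * (a * S) := by positivity
        have : 0 ≤ C * F := by positivity
        nlinarith
    _ = _ := by ring

/-- Phase transition for the total flow `F(a) = a ∫_{∂Ω} u_a dσ`:
`F(a) ≍ a σ(∂Ω)` when `a σ(∂Ω) ≤ 1`, and `F(a) ≍ 1` when `a σ(∂Ω) ≥ 1`, with comparability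
constants depending only on `n`, `C₀` and the geometric constants. -/
theorem stmt_18 (n : ℕ) (hn : 3 ≤ n) (M Cσ d cd C₀ : ℝ) (hC₀ : 4 < C₀) :
    ∃ C : ℝ, 1 < C ∧
      ∀ (Ω : Set (EuclideanSpace ℝ (Fin n))) (σ : MeasureTheory.Measure (EuclideanSpace ℝ (Fin n))),
        IsMixedPair M Cσ d cd Ω σ →
        Metric.ball (0 : EuclideanSpace ℝ (Fin n)) 4 ⊆ Ω →
        Ω ⊆ Metric.ball (0 : EuclideanSpace ℝ (Fin n)) C₀ →
        ∀ a : ℝ, 0 < a →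
          ∀ u : EuclideanSpace ℝ (Fin n) → ℝ, IsFluxSolution Ω σ a u →
            (a * (σ (frontier Ω)).toReal ≤ 1 →
              C⁻¹ * (a * (σ (frontier Ω)).toReal) ≤ a * ∫ P in frontier Ω, u P ∂σ ∧
                a * ∫ P in frontier Ω, u P ∂σ ≤ C * (a * (σ (frontier Ω)).toReal)) ∧
            (1 ≤ a * (σ (frontier Ω)).toReal →
              C⁻¹ ≤ a * ∫ P in frontier Ω, u P ∂σ ∧
                a * ∫ P in frontier Ω, u P ∂σ ≤ C) := by
  by_cases hc : 1 < M ∧ 0 < Cσ ∧ (n : ℝ) - 2 < d ∧ 0 < cd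
  swap
  · refine ⟨2, by norm_num, fun Ω σ h => absurd ⟨h.nta.M_gt_one, h.Cσ_pos, h.d_gt, h.cd_pos⟩ hc⟩
  obtain ⟨hM, hCσ, hd, hcd⟩ := hc
  have hn0 : 0 < n := by omega
  obtain ⟨B, hB, HL⟩ := lower_bound n hn0 M Cσ d cd C₀ hM hd hcd hC₀ hCσ
  obtain ⟨Cu, hCu, HU⟩ := upper2 n hn0
  have hCp : 0 < 2 * B + Cu + 2 := by positivity
  refine ⟨2 * B + Cu + 2, by linarith, ?_⟩
  intro Ω σ h h4 hΩC a ha u hu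
  have := mixed_finite h
  have hD := diam_ge hn0 h.bounded h4
  have hne := frontier_ne hn0 h.bounded h4
  have h1 := HL Ω σ h h4 hΩC a ha u hu
  have h2 := HU M Ω h.nta h.bounded hne (by linarith) h4 σ a ha u hu
  have h3 := upper1 hn0 h.nta h.bounded hne (by linarith) h4 σ ha hu
  rw [measureReal_def] at h1 h3
  set F := a * ∫ P in frontier Ω, u P ∂σ with hF
  have hS0 : 0 ≤ a * (σ (frontier Ω)).toReal := by positivity
  set s := a * (σ (frontier Ω)).toReal with hs
  have hF0 : 0 ≤ F := by
    by_contra hcon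
    push Not at hcon
    have : B * F * (1 + s) < 0 := by
      have := mul_pos hB (neg_pos.2 hcon)
      nlinarith
    linarith
  refine ⟨fun hs1 => ⟨?_, ?_⟩, fun hs1 => ⟨?_, ?_⟩⟩
  · rw [inv_mul_le_iff₀ hCp]
    have : B * F * (1 + s) ≤ B * F * 2 := by gcongr; linarith
    nlinarith
  · nlinarith
  · rw [inv_le_iff_one_le_mul₀ hCp]
    have hsp : 0 < s := by linarith
    have h5 : B * F * (1 + s) ≤ B * F * (2 * s) := by gcongr; linarith
    have h6 : 1 * s ≤ (2 * B * F) * s := by linarith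
    have h7 := le_of_mul_le_mul_right h6 hsp
    nlinarith
  · linarith
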